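/- Let f be a mixing piecewise expanding C^2 unimodal map, and let λ₀ = lim_n (sup |(f^{-n})'|)^{1/n}. Then: (i) the part of the spectrum of the transfer operator L₁ acting on BV outside the closed disc of radius λ₀ consists of isolated eigenvalues of finite multiplicity (i.e. the essential spectral radius of L₁ on BV is ≤ λ₀); (ii) 1 is a simple maximal eigenvalue of L₁ on BV, with eigenvector the invariant density ρ₀, and L₁ has no other eigenvalue of modulus 1 on BV; (iii) the spectral radius of L₀ on BV equals 1; (iv) the spectrum of L₀ acting on BV^{(1)} coincides with the spectrum of L₁ acting on BV. -/

import Mathlib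

open Set MeasureTheory Filter Topology

noncomputable section

/-- A piecewise expanding `C^r` unimodal map on `I = [a,b]` with critical (turning) point `c`:
`f` is continuous on `I`, strictly increasing on `[a,c]`, strictly decreasing on `[c,b]`,
`f(a) = f(b) = a`, and on each side the map extends to a `C^r` map (`fp`, resp. `fm`) on an
open neighbourhood (`Up`, resp. `Um`) with derivative bounded below in modulus by some `κ > 1`. -/
structure PWUnimodal (r : ℕ) where
  a : ℝ
  b : ℝ
  c : ℝ
  hac : a < c
  hcb : c < b
  f : ℝ → ℝ
  cont : ContinuousOn f (Set.Icc a b)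
  mapsI : Set.MapsTo f (Set.Icc a b) (Set.Icc a b)
  mono : StrictMonoOn f (Set.Icc a c)
  anti : StrictAntiOn f (Set.Icc c b)
  fa : f a = a
  fb : f b = a
  Up : Set ℝ
  Um : Set ℝ
  openUp : IsOpen Up
  openUm : IsOpen Um
  subUp : Set.Icc a c ⊆ Up
  subUm : Set.Icc c b ⊆ Um
  fp : ℝ → ℝ
  fm : ℝ → ℝ
  fp_eq : Set.EqOn fp f (Set.Icc a c)
  fm_eq : Set.EqOn fm f (Set.Icc c b)
  fp_smooth : ContDiffOn ℝ r fp Up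
  fm_smooth : ContDiffOn ℝ r fm Um
  κ : ℝ
  one_lt_κ : 1 < κ
  fp_exp : ∀ x ∈ Up, κ ≤ |deriv fp x|
  fm_exp : ∀ x ∈ Um, κ ≤ |deriv fm x|

namespace PWUnimodal

variable {r : ℕ}

/-- The (one-sided) derivative `f'` of a piecewise expanding unimodal map, defined via the
two smooth extensions. -/
def d (F : PWUnimodal r) (x : ℝ) : ℝ := if x ≤ F.c then deriv F.fp x else deriv F.fm x

/-- `(f^n)'(x)`, the derivative of the `n`-th iterate. -/
def dn (F : PWUnimodal r) (n : ℕ) (x : ℝ) : ℝ :=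
  ∏ i ∈ Finset.range n, F.d (F.f^[i] x)

/-- `c_k = f^k(c)`, the postcritical orbit. -/
def ck (F : PWUnimodal r) (k : ℕ) : ℝ := F.f^[k] F.c

/-- The critical point is periodic. -/
def CritPeriodic (F : PWUnimodal r) : Prop := ∃ n, 0 < n ∧ F.f^[n] F.c = F.c

/-- `f` is good: either `c` is not periodic, or `inf |(f^{n₁})'| > 2` where `n₁` is the
minimal period of `c`. -/
def Good (F : PWUnimodal r) : Prop :=
  ¬ F.CritPeriodic ∨
    ∀ x ∈ Set.Icc F.a F.b, 2 < |F.dn (Function.minimalPeriod F.f F.c) x|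

/-- `f` is topologically mixing on `[f²(c), f(c)]`. -/
def Mixing (F : PWUnimodal r) : Prop :=
  ∀ U V : Set ℝ, IsOpen U → IsOpen V →
    (U ∩ Set.Icc (F.ck 2) (F.ck 1)).Nonempty →
    (V ∩ Set.Icc (F.ck 2) (F.ck 1)).Nonempty →
    ∃ N, ∀ n ≥ N, (F.f^[n] '' (U ∩ Set.Icc (F.ck 2) (F.ck 1)) ∩ V).Nonempty

/-- `v` is horizontal for `f`: `∑_{j=0}^{M_f-1} v(c_j)/(f^j)'(c_1) = 0`, where `M_f = n₁` if
`c` is periodic of minimal period `n₁` and `M_f = ∞` otherwise. -/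
def Horizontal (F : PWUnimodal r) (v : ℝ → ℝ) : Prop :=
  (F.CritPeriodic →
    ∑ j ∈ Finset.range (Function.minimalPeriod F.f F.c), v (F.ck j) / F.dn j (F.ck 1) = 0) ∧
  (¬ F.CritPeriodic → ∑' j : ℕ, v (F.ck j) / F.dn j (F.ck 1) = 0)

open scoped Classical in
/-- `N_f = n₀ + n₁ - 1` if `c` is preperiodic, `n₁` if `c` is periodic of minimal period `n₁`,
and `∞` otherwise. -/
def Nf (F : PWUnimodal r) : ℕ∞ :=
  if F.c ∈ Function.periodicPts F.f then (Function.minimalPeriod F.f F.c : ℕ∞)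
  else if h : ∃ m, 0 < m ∧ F.f^[m] F.c ∈ Function.periodicPts F.f then
    ((Nat.find h + Function.minimalPeriod F.f (F.f^[Nat.find h] F.c) - 1 : ℕ) : ℕ∞)
  else ⊤

open scoped Classical in
/-- `M_f = n₁` if `c` is periodic of minimal period `n₁`, and `∞` otherwise. -/
def Mf (F : PWUnimodal r) : ℕ∞ :=
  if F.c ∈ Function.periodicPts F.f then (Function.minimalPeriod F.f F.c : ℕ∞) else ⊤

/-- `ρ` is the (unique) absolutely continuous invariant probability density of `f`:
a nonnegative integrable function of bounded variation, supported in `[a,b]`, of total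
integral one, whose associated measure is `f`-invariant. -/
structure IsInvDensity (F : PWUnimodal r) (ρ : ℝ → ℝ) : Prop where
  nonneg : ∀ x, 0 ≤ ρ x
  integrable : MeasureTheory.Integrable ρ
  mass : (∫ x, ρ x) = 1
  supp : Function.support ρ ⊆ Set.Icc F.a F.b
  bv : BoundedVariationOn ρ Set.univ
  invariant : ∀ φ : ℝ → ℝ, Continuous φ → (∫ x, φ (F.f x) * ρ x) = ∫ x, φ x * ρ x

end PWUnimodal

/-- Sum of `g n` over `1 ≤ n ≤ N`, where `N ∈ ℕ∞`. -/
def sumTo (N : ℕ∞) (g : ℕ → ℝ) : ℝ :=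
  ∑' n : ℕ, if 1 ≤ n ∧ (n : ℕ∞) ≤ N then g n else 0

/-- The jump function `H_u`: `-1` on `(-∞,u)`, `-1/2` at `u`, `0` on `(u,∞)`. -/
def Hfun (u x : ℝ) : ℝ := if x < u then -1 else if x = u then -(1/2) else 0

namespace PWUnimodal

variable {r : ℕ}

/-- The saltus function `∑_{n=1}^{N_f} s_n H_{c_n}`. -/
def saltus (F : PWUnimodal r) (s : ℕ → ℝ) (x : ℝ) : ℝ :=
  sumTo F.Nf (fun n => s n * Hfun (F.ck n) x)

/-- The decomposition `ρ₀ = ρ_reg + ρ_sal` of the invariant density into a continuous part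
and the saltus part `ρ_sal = ∑_{n=1}^{N_f} s_n H_{c_n}`. -/
structure SaltusDecomp (F : PWUnimodal r) (ρ₀ ρreg : ℝ → ℝ) (s : ℕ → ℝ) : Prop where
  cont : Continuous ρreg
  eq : ∀ x, ρ₀ x = ρreg x + F.saltus s x

/-- The weighted total jump `J(f,X) = ∑_{n=1}^{N_f} s_n X(c_n)`. -/
def Jfun (F : PWUnimodal r) (s : ℕ → ℝ) (X : ℝ → ℝ) : ℝ :=
  sumTo F.Nf (fun n => s n * X (F.ck n))

open scoped Classical in
/-- The solution `α_{(0)}` (with `α(c) = 0`) of the twisted cohomological equation, given by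
the explicit series/finite-sum formula. -/
def alpha0 (F : PWUnimodal r) (v : ℝ → ℝ) (x : ℝ) : ℝ :=
  if h : ∃ ℓ, 1 ≤ ℓ ∧ F.f^[ℓ] x = F.c then
    -∑ j ∈ Finset.range (Nat.find h), v (F.f^[j] x) / F.dn (j+1) x
  else -∑' j : ℕ, v (F.f^[j] x) / F.dn (j+1) x

/-- `C^r` extensions `ψ₊, ψ₋` of the two inverse branches of `f` to `J = (-∞, f(c)]`,
with derivatives bounded in modulus by some `θ < 1`. -/
structure InvBranches (F : PWUnimodal r) where
  ψp : ℝ → ℝ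
  ψm : ℝ → ℝ
  smooth_p : ContDiffOn ℝ r ψp (Set.Iic (F.f F.c))
  smooth_m : ContDiffOn ℝ r ψm (Set.Iic (F.f F.c))
  inv_p : ∀ y ∈ Set.Icc F.a (F.f F.c), ψp y ∈ Set.Icc F.a F.c ∧ F.f (ψp y) = y
  inv_m : ∀ y ∈ Set.Icc F.a (F.f F.c), ψm y ∈ Set.Icc F.c F.b ∧ F.f (ψm y) = y
  θ : ℝ
  θ_lt : θ < 1
  dψp : ∀ y ∈ Set.Iic (F.f F.c), |deriv ψp y| ≤ θ
  dψm : ∀ y ∈ Set.Iic (F.f F.c), |deriv ψm y| ≤ θ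

/-- `χ`: the indicator `1` on `(-∞, f(c))`, `1/2` at `f(c)`, `0` beyond. -/
def χ (F : PWUnimodal r) (x : ℝ) : ℝ :=
  if x < F.f F.c then 1 else if x = F.f F.c then 1/2 else 0

/-- The operator `L₀`. -/
def InvBranches.L0 {F : PWUnimodal r} (B : F.InvBranches) (φ : ℝ → ℝ) (x : ℝ) : ℝ :=
  F.χ x * φ (B.ψp x) - F.χ x * φ (B.ψm x)

/-- The Perron-Frobenius transfer operator `L₁`. -/
def InvBranches.L1 {F : PWUnimodal r} (B : F.InvBranches) (φ : ℝ → ℝ) (x : ℝ) : ℝ :=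
  F.χ x * (deriv B.ψp x * φ (B.ψp x)) + F.χ x * (|deriv B.ψm x| * φ (B.ψm x))

/-- The operator `L₀` on complex-valued functions. -/
def InvBranches.L0c {F : PWUnimodal r} (B : F.InvBranches) (φ : ℝ → ℂ) (x : ℝ) : ℂ :=
  (F.χ x : ℂ) * φ (B.ψp x) - (F.χ x : ℂ) * φ (B.ψm x)

/-- The transfer operator `L₁` on complex-valued functions. -/
def InvBranches.L1c {F : PWUnimodal r} (B : F.InvBranches) (φ : ℝ → ℂ) (x : ℝ) : ℂ :=
  (F.χ x : ℂ) * (Complex.ofReal (deriv B.ψp x) * φ (B.ψp x)) +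
    (F.χ x : ℂ) * (Complex.ofReal |deriv B.ψm x| * φ (B.ψm x))

/-- Forgetting smoothness: a piecewise expanding `C^r` unimodal map is also `C^{r'}` for
`r' ≤ r`. -/
def restrict (F : PWUnimodal r) (r' : ℕ) (h : r' ≤ r) : PWUnimodal r' :=
  { F with
    fp_smooth := F.fp_smooth.of_le (by exact_mod_cast h)
    fm_smooth := F.fm_smooth.of_le (by exact_mod_cast h) }

end PWUnimodal

/-- A `C^{r₀,r}` perturbation `(f_t)_{|t|<ε}` of a piecewise expanding `C^r` unimodal map `F`:
a family of piecewise expanding `C^r` unimodal maps on the same interval with the same turning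
point, with `f_0 = f`, uniformly bounded `C^r` norms of the one-sided extensions on fixed
neighbourhoods, `‖(f - f_t)|_{I_σ}‖_{C^{r-1}} = O(t)`, and such that `(x,t) ↦ f_t(x)` extends,
on each side, to a `C^{r₀}` function on a neighbourhood of `I_σ × {0}`. -/
structure PWFamily (r₀ r : ℕ) (F : PWUnimodal r) (ε : ℝ) where
  εpos : 0 < ε
  fam : ℝ → PWUnimodal r
  same_a : ∀ t, (fam t).a = F.a
  same_b : ∀ t, (fam t).b = F.b
  same_c : ∀ t, (fam t).c = F.c
  at0 : fam 0 = F
  Vp : Set ℝ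
  Vm : Set ℝ
  openVp : IsOpen Vp
  openVm : IsOpen Vm
  subVp : Set.Icc F.a F.c ⊆ Vp
  subVm : Set.Icc F.c F.b ⊆ Vm
  VpUp : ∀ t, |t| < ε → Vp ⊆ (fam t).Up
  VmUm : ∀ t, |t| < ε → Vm ⊆ (fam t).Um
  Cb : ℝ
  unif_p : ∀ t, |t| < ε → ∀ i ≤ r, ∀ x ∈ Vp, |iteratedDeriv i (fam t).fp x| ≤ Cb
  unif_m : ∀ t, |t| < ε → ∀ i ≤ r, ∀ x ∈ Vm, |iteratedDeriv i (fam t).fm x| ≤ Cb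
  close_p : ∀ t, |t| < ε → ∀ i ≤ r - 1, ∀ x ∈ Vp,
    |iteratedDeriv i (fun y => F.fp y - (fam t).fp y) x| ≤ Cb * |t|
  close_m : ∀ t, |t| < ε → ∀ i ≤ r - 1, ∀ x ∈ Vm,
    |iteratedDeriv i (fun y => F.fm y - (fam t).fm y) x| ≤ Cb * |t|
  Gp : ℝ × ℝ → ℝ
  Gm : ℝ × ℝ → ℝ
  Wp : Set (ℝ × ℝ)
  Wm : Set (ℝ × ℝ)
  openWp : IsOpen Wp
  openWm : IsOpen Wm
  subWp : (Set.Icc F.a F.c) ×ˢ ({0} : Set ℝ) ⊆ Wp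
  subWm : (Set.Icc F.c F.b) ×ˢ ({0} : Set ℝ) ⊆ Wm
  smoothGp : ContDiffOn ℝ r₀ Gp Wp
  smoothGm : ContDiffOn ℝ r₀ Gm Wm
  Gp_eq : ∀ t, |t| < ε → ∀ x ∈ Set.Icc F.a F.c, (x, t) ∈ Wp → Gp (x, t) = (fam t).f x
  Gm_eq : ∀ t, |t| < ε → ∀ x ∈ Set.Icc F.c F.b, (x, t) ∈ Wm → Gm (x, t) = (fam t).f x

/-- The infinitesimal deformation `v = ∂_t f_t|_{t=0}`. -/
def PWFamily.v {r₀ r : ℕ} {F : PWUnimodal r} {ε : ℝ} (P : PWFamily r₀ r F ε) (x : ℝ) : ℝ :=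
  if x ≤ F.c then deriv (fun t => P.Gp (x, t)) 0 else deriv (fun t => P.Gm (x, t)) 0

/-- A `C^{r₀,r}` perturbation staying in the topological class of `F`: each `f_t` is
conjugated to `f` by a homeomorphism `h_t` of `I` fixing `c`. -/
structure ConjFamily (r₀ r : ℕ) (F : PWUnimodal r) (ε : ℝ) extends PWFamily r₀ r F ε where
  h : ℝ → ℝ → ℝ
  h_cont : ∀ t, |t| < ε → ContinuousOn (h t) (Set.Icc F.a F.b)
  h_bij : ∀ t, |t| < ε → Set.BijOn (h t) (Set.Icc F.a F.b) (Set.Icc F.a F.b)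
  h_c : ∀ t, |t| < ε → h t F.c = F.c
  h_conj : ∀ t, |t| < ε → ∀ x ∈ Set.Icc F.a F.b, (fam t).f (h t x) = h t (F.f x)

/-- The infinitesimal conjugacy `α = ∂_t h_t|_{t=0}`. -/
def ConjFamily.alpha {r₀ r : ℕ} {F : PWUnimodal r} {ε : ℝ} (C : ConjFamily r₀ r F ε)
    (x : ℝ) : ℝ :=
  deriv (fun t => C.h t x) 0

/-- A perturbation `P` is tangent to the topological class of `F` if there is a `C^{2,2}`
perturbation `f̃_t` of `F` lying in the topological class of `F` with
`sup_x |f̃_t(x) - f_t(x)| = O(t²)`. -/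
structure PWFamily.TangentData {r₀ r : ℕ} {F : PWUnimodal r} {ε : ℝ}
    (P : PWFamily r₀ r F ε) (hr : 2 ≤ r) where
  Q : ConjFamily 2 2 (F.restrict 2 hr) ε
  K : ℝ
  close : ∀ t, |t| < ε → ∀ x ∈ Set.Icc F.a F.b, |(Q.fam t).f x - (P.fam t).f x| ≤ K * t ^ 2

/-- An abstract realization of the Banach space `BV` of bounded variation functions supported
in `[a,b]`, modulo functions differing on an at most countable set, with the variation norm. -/
structure BVRealization (a b : ℝ) (V : Type) [NormedAddCommGroup V] [NormedSpace ℂ V] where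
  toFun : V →ₗ[ℂ] (ℝ → ℂ)
  bv : ∀ φ, BoundedVariationOn (toFun φ) Set.univ
  supp : ∀ φ, Function.support (toFun φ) ⊆ Set.Icc a b
  zero_iff : ∀ φ : V, φ = 0 ↔ (Function.support (toFun φ)).Countable
  surj : ∀ g : ℝ → ℂ, BoundedVariationOn g Set.univ → Function.support g ⊆ Set.Icc a b →
    ∃ φ : V, {x | toFun φ x ≠ g x}.Countable
  norm_eq : ∀ φ : V, ENNReal.ofReal ‖φ‖ =
    ⨅ g ∈ {g : ℝ → ℂ | {x | g x ≠ toFun φ x}.Countable}, eVariationOn g Set.univ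

/-- An abstract realization of the Banach space `BV^{(1)}` of functions supported in
`(-∞, b]` whose (distributional) derivative is a function of bounded variation, with norm
`‖φ‖ = ‖φ'‖_{BV}`. -/
structure BV1Realization (a b : ℝ) (W : Type) [NormedAddCommGroup W] [NormedSpace ℂ W] where
  toFun : W →ₗ[ℂ] (ℝ → ℂ)
  inj : ∀ φ : W, toFun φ = 0 → φ = 0
  deriv_bv : ∀ φ : W, ∃ g : ℝ → ℂ, BoundedVariationOn g Set.univ ∧
    Function.support g ⊆ Set.Icc a b ∧ ∀ x, toFun φ x = -∫ t in Set.Ioc x b, g t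
  surj : ∀ g : ℝ → ℂ, BoundedVariationOn g Set.univ → Function.support g ⊆ Set.Icc a b →
    ∃ φ : W, ∀ x, toFun φ x = -∫ t in Set.Ioc x b, g t
  norm_eq : ∀ φ : W, ENNReal.ofReal ‖φ‖ =
    ⨅ g ∈ {g : ℝ → ℂ | ∀ x, toFun φ x = -∫ t in Set.Ioc x b, g t}, eVariationOn g Set.univ


section QC

variable {E F : Type*} [NormedAddCommGroup E] [NormedSpace ℂ E]
  [NormedAddCommGroup F] [NormedSpace ℂ F] [FiniteDimensional ℂ F]

lemma qc_seq (T : E →L[ℂ] E) (Λ : E →L[ℂ] F) {N : ℕ} {α r : ℝ}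
    (hLY : ∀ x, ‖(T ^ N) x‖ ≤ α * ‖x‖ + ‖Λ x‖) (hα : 0 ≤ α) (hr : 8 * α < r)
    (x : ℕ → E) (hx : ∀ n, ‖x n‖ ≤ 2)
    (h : ∀ m n, m < n → r ≤ ‖(T ^ N) (x n - x m)‖) : False := by
  have hb : ∀ n, Λ (x n) ∈ Metric.closedBall (0 : F) (‖Λ‖ * 2) := by
    intro n
    rw [mem_closedBall_zero_iff]
    exact (Λ.le_opNorm _).trans (by gcongr; exact hx n)
  have : ProperSpace F := FiniteDimensional.proper ℂ F
  obtain ⟨y, -, φ, hφ, hlim⟩ := (isCompact_closedBall (0 : F) (‖Λ‖ * 2)).tendsto_subseq hb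
  have hc := hlim.cauchySeq
  rw [Metric.cauchySeq_iff'] at hc
  obtain ⟨M, hM⟩ := hc (r - 4 * α) (by linarith)
  have h1 := hM (M + 1) (by omega)
  rw [dist_eq_norm] at h1
  simp only [Function.comp] at h1
  rw [← map_sub] at h1
  have h2 := h (φ M) (φ (M + 1)) (hφ (by omega))
  have h3 := hLY (x (φ (M + 1)) - x (φ M))
  have h4 : ‖x (φ (M + 1)) - x (φ M)‖ ≤ 4 := by
    refine (norm_sub_le _ _).trans ?_
    linarith [hx (φ (M + 1)), hx (φ M)]
  nlinarith

lemma pow_sub_mem (T : E →L[ℂ] E) (z : ℂ) (A : Submodule ℂ E) (hA : ∀ x ∈ A, T x ∈ A)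
    (x : E) (hx : T x - z • x ∈ A) (k : ℕ) : (T ^ k) x - z ^ k • x ∈ A := by
  induction k with
  | zero => simp
  | succ k ih =>
    have : (T ^ (k + 1)) x - z ^ (k + 1) • x
        = T ((T ^ k) x - z ^ k • x) + z ^ k • (T x - z • x) := by
      have e : (T ^ (k + 1)) x = T ((T ^ k) x) := by rw [pow_succ']; rfl
      rw [e, pow_succ]
      simp only [map_sub, map_smul, smul_sub, smul_smul]
      abel
    rw [this]
    exact A.add_mem (hA _ ih) (A.smul_mem _ hx)

/-- Riesz lemma relative to a bigger subspace. -/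
lemma riesz_rel (A B : Submodule ℂ E) (hA : IsClosed (A : Set E)) (hlt : A < B) :
    ∃ x ∈ B, ‖x‖ ≤ 2 ∧ ∀ y ∈ A, 1 ≤ ‖x - y‖ := by
  have h₁ : IsClosed (A.comap B.subtype : Set B) := by
    simpa using! hA.preimage_val
  have h₂ : ∃ x : B, x ∉ A.comap B.subtype := by
    obtain ⟨x, hxB, hxA⟩ := SetLike.exists_of_lt hlt
    exact ⟨⟨x, hxB⟩, by simpa using hxA⟩
  obtain ⟨⟨x, hx⟩, hxn, hxy⟩ := riesz_lemma_of_norm_lt (𝕜 := ℂ) (c := (3 / 2 : ℂ)) (R := 2)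
    (by norm_num) (by norm_num) h₁ h₂
  simp only [Submodule.mem_comap, Submodule.subtype_apply, Subtype.forall] at hxn hxy
  exact ⟨x, hx, hxn, fun y hy => hxy y (hlt.le hy) hy⟩

lemma qc_incr (T : E →L[ℂ] E) (Λ : E →L[ℂ] F) {N : ℕ} {α r : ℝ}
    (hLY : ∀ x, ‖(T ^ N) x‖ ≤ α * ‖x‖ + ‖Λ x‖) (hα : 0 ≤ α) (hr0 : 0 ≤ r) (hr : 8 * α < r ^ N)
    (A : ℕ → Submodule ℂ E) (hA : ∀ n, IsClosed (A n : Set E)) (hlt : StrictMono A)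
    (hT : ∀ n, ∀ x ∈ A n, T x ∈ A n)
    (z : ℕ → ℂ) (hz : ∀ n, r ≤ ‖z n‖) (h : ∀ n, ∀ x ∈ A (n + 1), T x - z n • x ∈ A n) : False := by
  have hx : ∀ n, ∃ x ∈ A (n + 1), ‖x‖ ≤ 2 ∧ ∀ y ∈ A n, 1 ≤ ‖x - y‖ := fun n =>
    riesz_rel _ _ (hA n) (hlt (by omega))
  choose x hxA hx2 hxy using hx
  refine qc_seq T Λ hLY hα hr x hx2 ?_
  intro m n hmn
  have e1 := pow_sub_mem T (z n) (A n) (hT n) (x n) (h n _ (hxA n)) N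
  have e2 : (T ^ N) (x m) ∈ A n := by
    have : ∀ k, (T ^ k) (x m) ∈ A n := by
      intro k
      induction k with
      | zero => simpa using hlt.monotone (show m + 1 ≤ n by omega) (hxA m)
      | succ k ih => rw [pow_succ']; exact hT n _ ih
    exact this N
  have hz0 : z n ^ N ≠ 0 := by
    have : 0 < r ^ N := by linarith
    have h2 : 0 < ‖z n‖ ^ N := this.trans_le (by gcongr; exact hz n)
    rw [← norm_pow] at h2
    exact norm_pos_iff.1 h2
  set e := (z n ^ N)⁻¹ • ((T ^ N) (x m) - ((T ^ N) (x n) - z n ^ N • x n)) with he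
  have heA : e ∈ A n := (A n).smul_mem _ ((A n).sub_mem e2 e1)
  have h5 : (T ^ N) (x n - x m) = z n ^ N • (x n - e) := by
    rw [he, smul_sub, smul_smul, mul_inv_cancel₀ hz0, one_smul, map_sub]; abel
  rw [h5, norm_smul, norm_pow]
  calc r ^ N ≤ ‖z n‖ ^ N * 1 := by rw [mul_one]; gcongr; exact hz n
    _ ≤ _ := by gcongr; exact hxy n e heA

lemma qc_indep (T : E →L[ℂ] E) (Λ : E →L[ℂ] F) {N : ℕ} {α r : ℝ}
    (hLY : ∀ x, ‖(T ^ N) x‖ ≤ α * ‖x‖ + ‖Λ x‖) (hα : 0 ≤ α) (hr0 : 0 ≤ r) (hr : 8 * α < r ^ N)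
    (v : ℕ → E) (hv : LinearIndependent ℂ v)
    (z : ℕ → ℂ) (hz : ∀ n, r ≤ ‖z n‖) (h : ∀ n, T (v n) = z n • v n) : False := by
  let A : ℕ → Submodule ℂ E := fun n => Submodule.span ℂ (v '' (Set.Iio n))
  have hfin : ∀ n, FiniteDimensional ℂ (A n) := fun n =>
    FiniteDimensional.span_of_finite ℂ ((Set.finite_Iio n).image v)
  have hTA : ∀ n, ∀ x ∈ A n, T x ∈ A n := by
    intro n x hx
    induction hx using Submodule.span_induction with
    | mem x hx =>
      obtain ⟨i, hi, rfl⟩ := hx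
      rw [h]
      exact Submodule.smul_mem _ _ (Submodule.subset_span ⟨i, hi, rfl⟩)
    | zero => simp
    | add x y _ _ hx hy => rw [map_add]; exact Submodule.add_mem _ hx hy
    | smul a x _ hx => rw [map_smul]; exact Submodule.smul_mem _ _ hx
  refine qc_incr T Λ hLY hα hr0 hr A (fun n => Submodule.closed_of_finiteDimensional _) ?_ hTA z hz ?_
  · apply strictMono_nat_of_lt_succ
    intro n
    refine lt_of_le_of_ne (Submodule.span_mono (Set.image_mono (Set.Iio_subset_Iio (by omega)))) ?_
    intro heq
    have h1 : v n ∈ A (n + 1) := Submodule.subset_span ⟨n, by simp, rfl⟩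
    rw [← heq] at h1
    have := hv.notMem_span_image (s := Set.Iio n) (x := n) (by simp)
    exact this h1
  · intro n x hx
    induction hx using Submodule.span_induction with
    | mem x hx =>
      obtain ⟨i, hi, rfl⟩ := hx
      rw [h, ← sub_smul]
      rcases Nat.lt_succ_iff_lt_or_eq.1 hi with hi | rfl
      · exact Submodule.smul_mem _ _ (Submodule.subset_span ⟨i, hi, rfl⟩)
      · simp
    | zero => simp
    | add x y _ _ hx hy =>
      rw [map_add, smul_add, add_sub_add_comm]; exact Submodule.add_mem _ hx hy
    | smul a x _ hx =>
      rw [map_smul, smul_comm, ← smul_sub]; exact Submodule.smul_mem _ _ hx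

lemma qc_eig_finite (T : E →L[ℂ] E) (Λ : E →L[ℂ] F) {N : ℕ} {α r : ℝ}
    (hLY : ∀ x, ‖(T ^ N) x‖ ≤ α * ‖x‖ + ‖Λ x‖) (hα : 0 ≤ α) (hr0 : 0 ≤ r) (hr : 8 * α < r ^ N) :
    {z : ℂ | r ≤ ‖z‖ ∧ Module.End.HasEigenvalue (T : E →ₗ[ℂ] E) z}.Finite := by
  by_contra hinf
  have hinf : Set.Infinite _ := hinf
  let e := hinf.natEmbedding
  have hv : ∀ n, ∃ v, Module.End.HasEigenvector (T : E →ₗ[ℂ] E) (e n : ℂ) v := fun n =>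
    (e n).2.2.exists_hasEigenvector
  choose v hv using hv
  have hli : LinearIndependent ℂ v :=
    Module.End.eigenvectors_linearIndependent' (T : E →ₗ[ℂ] E) (fun n => (e n : ℂ))
      (Subtype.val_injective.comp e.injective) v hv
  exact qc_indep T Λ hLY hα hr0 hr v hli (fun n => (e n : ℂ)) (fun n => (e n).2.1)
    (fun n => (hv n).apply_eq_smul)

lemma qc_ker_finite (T : E →L[ℂ] E) (Λ : E →L[ℂ] F) {N : ℕ} {α r : ℝ}
    (hLY : ∀ x, ‖(T ^ N) x‖ ≤ α * ‖x‖ + ‖Λ x‖) (hα : 0 ≤ α) (hr0 : 0 ≤ r) (hr : 8 * α < r ^ N)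
    (z : ℂ) (hz : r ≤ ‖z‖) :
    FiniteDimensional ℂ (Module.End.eigenspace (T : E →ₗ[ℂ] E) z) := by
  by_contra hinf
  obtain ⟨b⟩ : Nonempty (ℕ → Module.End.eigenspace (T : E →ₗ[ℂ] E) z) := ⟨fun _ => 0⟩
  have : ∃ v : ℕ → Module.End.eigenspace (T : E →ₗ[ℂ] E) z, LinearIndependent ℂ v := by
    have hB := Module.Basis.ofVectorSpace ℂ (Module.End.eigenspace (T : E →ₗ[ℂ] E) z)
    have hi : Infinite (Module.Basis.ofVectorSpaceIndex ℂ (Module.End.eigenspace (T : E →ₗ[ℂ] E) z)) := by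
      by_contra hf
      rw [not_infinite_iff_finite] at hf
      exact hinf (Module.Finite.of_basis hB)
    exact ⟨_, hB.linearIndependent.comp _ (Infinite.natEmbedding _).injective⟩
  obtain ⟨v, hv⟩ := this
  refine qc_indep T Λ hLY hα hr0 hr (fun n => (v n : E))
    (hv.map' (Submodule.subtype _) (Submodule.ker_subtype _)) (fun _ => z) (fun _ => hz) ?_
  intro n
  exact Module.End.mem_eigenspace_iff.1 (v n).2

lemma qc_gen_finite (T : E →L[ℂ] E) (Λ : E →L[ℂ] F) {N : ℕ} {α r : ℝ}
    (hLY : ∀ x, ‖(T ^ N) x‖ ≤ α * ‖x‖ + ‖Λ x‖) (hα : 0 ≤ α) (hr0 : 0 ≤ r) (hr : 8 * α < r ^ N)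
    (z : ℂ) (hz : r ≤ ‖z‖) :
    FiniteDimensional ℂ (Module.End.maxGenEigenspace (T : E →ₗ[ℂ] E) z) := by
  set S : E →ₗ[ℂ] E := (T : E →ₗ[ℂ] E) - z • 1 with hS
  have hSa : ∀ x, S x = T x - z • x := fun x => by simp [hS]
  have hk1 : FiniteDimensional ℂ (LinearMap.ker S) := by
    have := qc_ker_finite T Λ hLY hα hr0 hr z hz
    rwa [Module.End.eigenspace_def] at this
  have hfin : ∀ n, FiniteDimensional ℂ (LinearMap.ker (S ^ n)) := by
    intro n
    induction n with
    | zero => rw [pow_zero]; rw [Module.End.one_eq_id, LinearMap.ker_id]; infer_instance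
    | succ n ih =>
      have hmap : ∀ x ∈ LinearMap.ker (S ^ (n + 1)), S x ∈ LinearMap.ker (S ^ n) := by
        intro x hx
        rw [LinearMap.mem_ker, pow_succ] at hx
        exact hx
      let R : LinearMap.ker (S ^ (n + 1)) →ₗ[ℂ] LinearMap.ker (S ^ n) := S.restrict hmap
      have hkR : FiniteDimensional ℂ (LinearMap.ker R) := by
        let ι : LinearMap.ker R →ₗ[ℂ] LinearMap.ker S :=
          LinearMap.codRestrict _ ((Submodule.subtype _).comp (Submodule.subtype _)) (by
            intro x
            have := x.2
            rw [LinearMap.mem_ker] at this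
            exact congrArg Subtype.val this)
        refine FiniteDimensional.of_injective ι ?_
        intro x y hxy
        have := congrArg Subtype.val hxy
        exact Subtype.ext (Subtype.ext this)
      have hrR : FiniteDimensional ℂ (LinearMap.range R) := inferInstance
      have hq : FiniteDimensional ℂ (LinearMap.ker (S ^ (n + 1)) ⧸ LinearMap.ker R) :=
        Module.Finite.equiv R.quotKerEquivRange.symm
      exact Module.Finite.of_submodule_quotient (LinearMap.ker R)
  have hstab : ∃ p, LinearMap.ker (S ^ p) = LinearMap.ker (S ^ (p + 1)) := by
    by_contra hne
    push Not at hne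
    refine qc_incr T Λ hLY hα hr0 hr (fun n => LinearMap.ker (S ^ n))
      (fun n => Submodule.closed_of_finiteDimensional _) ?_ ?_ (fun _ => z) (fun _ => hz) ?_
    · apply strictMono_nat_of_lt_succ
      intro n
      refine lt_of_le_of_ne ?_ (hne n)
      intro x hx
      rw [LinearMap.mem_ker] at hx ⊢
      rw [pow_succ', Module.End.mul_apply, hx, map_zero]
    · intro n x hx
      rw [LinearMap.mem_ker] at hx ⊢
      have : T x = S x + z • x := by rw [hSa]; abel
      rw [this, map_add, map_smul, hx, ← Module.End.mul_apply, ← pow_succ, pow_succ',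
        Module.End.mul_apply, hx]
      simp
    · intro n x hx
      rw [← hSa]
      rw [LinearMap.mem_ker] at hx ⊢
      rw [← Module.End.mul_apply, ← pow_succ, hx]
  obtain ⟨p, hp⟩ := hstab
  have : Module.End.maxGenEigenspace (T : E →ₗ[ℂ] E) z = LinearMap.ker (S ^ p) := by
    ext x
    rw [Module.End.mem_maxGenEigenspace]
    constructor
    · rintro ⟨k, hk⟩
      have hk' : x ∈ LinearMap.ker (S ^ (p + k)) := by
        rw [LinearMap.mem_ker, pow_add, Module.End.mul_apply]
        rw [show (S ^ k) x = 0 from hk, map_zero]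
      rwa [← Module.End.ker_pow_constant hp k] at hk'
    · intro h; exact ⟨p, h⟩
  rw [this]
  exact hfin p

lemma qc_antilip (T : E →L[ℂ] E) (Λ : E →L[ℂ] F) {N : ℕ} {α r : ℝ} [CompleteSpace E]
    (hLY : ∀ x, ‖(T ^ N) x‖ ≤ α * ‖x‖ + ‖Λ x‖) (hα : 0 ≤ α) (hr0 : 0 ≤ r) (hr : 8 * α < r ^ N)
    (z : ℂ) (hz : r ≤ ‖z‖) (hinj : Function.Injective (T - z • 1 : E →L[ℂ] E)) :
    ∃ K, AntilipschitzWith K (T - z • 1 : E →L[ℂ] E) := by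
  set S : E →L[ℂ] E := T - z • 1 with hS
  rw [antilipschitzWith_iff_exists_mul_le_norm]
  by_contra! hcon
  have hx : ∀ n : ℕ, ∃ x : E, ‖x‖ = 1 ∧ ‖S x‖ < 1 / (n + 1 : ℝ) := by
    intro n
    obtain ⟨x, hx⟩ := hcon (1 / (n + 1 : ℝ)) (by positivity)
    have hx0 : x ≠ 0 := by rintro rfl; simp at hx
    have hxn : 0 < ‖x‖ := norm_pos_iff.2 hx0
    refine ⟨((‖x‖⁻¹ : ℝ) : ℂ) • x, ?_, ?_⟩
    · rw [norm_smul]; simp [hxn.ne']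
    · rw [map_smul, norm_smul]
      simp only [Complex.ofReal_inv, norm_inv, Complex.norm_real, norm_norm]
      rw [inv_mul_lt_iff₀ hxn, mul_comm]; exact hx
  choose x hx1 hxS using hx
  have hS0 : Tendsto (fun n => S (x n)) atTop (𝓝 0) := by
    rw [tendsto_zero_iff_norm_tendsto_zero]
    exact squeeze_zero (fun _ => norm_nonneg _) (fun n => (hxS n).le) tendsto_one_div_add_atTop_nhds_zero_nat
  -- T^N x - z^N x → 0
  have hQ : ∃ Q : E →L[ℂ] E, T ^ N - z ^ N • 1 = Q * S := by
    have hc : Commute T (z • 1 : E →L[ℂ] E) := by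
      ext y; simp
    have := hc.geom_sum₂_mul N
    refine ⟨_, Eq.symm (this.trans ?_)⟩
    rw [smul_pow, one_pow]
  obtain ⟨Q, hQ⟩ := hQ
  have hT0 : Tendsto (fun n => (T ^ N) (x n) - z ^ N • x n) atTop (𝓝 0) := by
    have h1 : ∀ n, (T ^ N) (x n) - z ^ N • x n = Q (S (x n)) := by
      intro n
      have := congrArg (fun A : E →L[ℂ] E => A (x n)) hQ
      simpa using this
    simp_rw [h1]
    have := (Q.continuous.tendsto 0).comp hS0
    rw [map_zero] at this
    exact this
  have hb : ∀ n, Λ (x n) ∈ Metric.closedBall (0 : F) (‖Λ‖ * 1) := by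
    intro n
    rw [mem_closedBall_zero_iff]
    exact (Λ.le_opNorm _).trans (by gcongr; exact (hx1 n).le)
  have : ProperSpace F := FiniteDimensional.proper ℂ F
  obtain ⟨y, -, φ, hφ, hlim⟩ := (isCompact_closedBall (0 : F) (‖Λ‖ * 1)).tendsto_subseq hb
  have hT1 := (hT0.comp hφ.tendsto_atTop).cauchySeq
  have hL1 := hlim.cauchySeq
  have hzN : 8 * α < ‖z‖ ^ N := hr.trans_le (by gcongr)
  have hcs : CauchySeq (fun n => x (φ n)) := by
    rw [Metric.cauchySeq_iff] at hT1 hL1 ⊢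
    intro ε hε
    have hδ : 0 < (‖z‖ ^ N - α) * ε / 2 := by
      have : 0 < ‖z‖ ^ N - α := by linarith
      positivity
    obtain ⟨M1, hM1⟩ := hT1 _ hδ
    obtain ⟨M2, hM2⟩ := hL1 _ hδ
    refine ⟨max M1 M2, fun m hm n hn => ?_⟩
    have h1 := hM1 m (le_trans (le_max_left _ _) hm) n (le_trans (le_max_left _ _) hn)
    have h2 := hM2 m (le_trans (le_max_right _ _) hm) n (le_trans (le_max_right _ _) hn)
    rw [dist_eq_norm] at h1 h2 ⊢
    simp only [Function.comp] at h1 h2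
    rw [← map_sub] at h2
    have h3 := hLY (x (φ m) - x (φ n))
    have h4 : ‖z‖ ^ N * ‖x (φ m) - x (φ n)‖ ≤ ‖(T ^ N) (x (φ m) - x (φ n))‖ +
      ‖(T ^ N) (x (φ m)) - z ^ N • x (φ m) - ((T ^ N) (x (φ n)) - z ^ N • x (φ n))‖ := by
      rw [← norm_pow, ← norm_smul]
      have : z ^ N • (x (φ m) - x (φ n)) = (T ^ N) (x (φ m) - x (φ n)) -
        ((T ^ N) (x (φ m)) - z ^ N • x (φ m) - ((T ^ N) (x (φ n)) - z ^ N • x (φ n))) := by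
        rw [map_sub, smul_sub]; abel
      rw [this]
      exact norm_sub_le _ _
    have h5 : (‖z‖ ^ N - α) * ‖x (φ m) - x (φ n)‖ < (‖z‖ ^ N - α) * ε := by nlinarith
    exact lt_of_mul_lt_mul_left h5 (by linarith)
  obtain ⟨w, hw⟩ := cauchySeq_tendsto_of_complete hcs
  have hw1 : ‖w‖ = 1 := by
    have := hw.norm
    simp_rw [hx1] at this
    exact (tendsto_nhds_unique this tendsto_const_nhds)
  have hSw : S w = 0 := by
    have h1 : Tendsto (fun n => S (x (φ n))) atTop (𝓝 (S w)) := (S.continuous.tendsto w).comp hw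
    exact tendsto_nhds_unique h1 (hS0.comp hφ.tendsto_atTop)
  have : w = 0 := hinj (by rw [hSw, map_zero])
  rw [this] at hw1
  simp at hw1

lemma qc_eigen (T : E →L[ℂ] E) (Λ : E →L[ℂ] F) {N : ℕ} {α r : ℝ} [CompleteSpace E]
    (hLY : ∀ x, ‖(T ^ N) x‖ ≤ α * ‖x‖ + ‖Λ x‖) (hα : 0 ≤ α) (hr0 : 0 ≤ r) (hr : 8 * α < r ^ N)
    (z : ℂ) (hz : r ≤ ‖z‖) (hsp : z ∈ spectrum ℂ T) :
    Module.End.HasEigenvalue (T : E →ₗ[ℂ] E) z := by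
  by_contra hne
  set S : E →L[ℂ] E := T - z • 1 with hS
  have hSa : ∀ x, S x = T x - z • x := fun x => by simp [hS]
  have hinj : Function.Injective S := by
    rw [injective_iff_map_eq_zero]
    intro x hx
    by_contra hx0
    refine hne (Module.End.hasEigenvalue_of_hasEigenvector (x := x) ⟨?_, hx0⟩)
    rw [Module.End.mem_genEigenspace_one]
    rw [hSa] at hx
    exact sub_eq_zero.1 hx
  obtain ⟨K, hK⟩ := qc_antilip T Λ hLY hα hr0 hr z hz hinj
  have hns : ¬ Function.Surjective S := by
    intro hsurj
    have hu : IsUnit S := ContinuousLinearMap.isUnit_iff_bijective.2 ⟨hinj, hsurj⟩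
    rw [spectrum.mem_iff] at hsp
    apply hsp
    rw [Algebra.algebraMap_eq_smul_one, ← IsUnit.neg_iff]
    simpa [hS] using hu
  have hce : IsClosedEmbedding S := hK.isClosedEmbedding S.uniformContinuous
  let A : ℕ → Submodule ℂ E := fun n => LinearMap.range ((S : E →ₗ[ℂ] E) ^ n)
  have hAs : ∀ n x, x ∈ A n → S x ∈ A (n + 1) := by
    rintro n x ⟨y, rfl⟩
    exact ⟨y, by rw [pow_succ']; rfl⟩
  have hAsub : ∀ n, A (n + 1) ≤ A n := by
    rintro n x ⟨y, rfl⟩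
    exact ⟨S y, by rw [pow_succ]; rfl⟩
  have hAc : ∀ n, IsClosed (A n : Set E) := by
    intro n
    induction n with
    | zero => simp [A, Module.End.one_eq_id]
    | succ n ih =>
      have : (A (n + 1) : Set E) = S '' (A n : Set E) := by
        ext x
        constructor
        · rintro ⟨y, rfl⟩
          exact ⟨((S : E →ₗ[ℂ] E) ^ n) y, ⟨y, rfl⟩, by rw [pow_succ']; rfl⟩
        · rintro ⟨y, hy, rfl⟩
          exact hAs n y hy
      rw [this]
      exact hce.isClosedMap _ ih
  have hanti : Antitone A := antitone_nat_of_succ_le hAsub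
  have hlt : ∀ n, A (n + 1) < A n := by
    intro n
    refine lt_of_le_of_ne (hAsub n) ?_
    intro heq
    apply hns
    intro y
    have h1 : ((S : E →ₗ[ℂ] E) ^ n) y ∈ A n := ⟨y, rfl⟩
    rw [← heq] at h1
    obtain ⟨w, hw⟩ := h1
    refine ⟨w, ?_⟩
    have hinjn : Function.Injective ((S : E →ₗ[ℂ] E) ^ n) := by
      rw [Module.End.coe_pow]; exact hinj.iterate n
    apply hinjn
    rw [← hw, pow_succ]; rfl
  choose x hxA hx2 hxy using fun n => riesz_rel _ _ (hAc (n + 1)) (hlt n)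
  have hTA : ∀ n, ∀ y ∈ A n, T y ∈ A n := by
    intro n y hy
    have : T y = S y + z • y := by rw [hSa]; abel
    rw [this]
    exact (A n).add_mem (hAsub n (hAs n y hy)) ((A n).smul_mem _ hy)
  have hTAk : ∀ k n, ∀ y ∈ A n, (T ^ k) y ∈ A n := by
    intro k n y hy
    induction k with
    | zero => simpa using hy
    | succ k ih => rw [pow_succ']; exact hTA n _ ih
  refine qc_seq T Λ hLY hα hr x hx2 ?_
  intro m n hmn
  have e1 := pow_sub_mem T z (A (m + 1)) (hTA _) (x m) (by rw [← hSa]; exact hAs _ _ (hxA m)) N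
  have e2 : (T ^ N) (x n) ∈ A (m + 1) := hTAk N _ _ (hanti (show m + 1 ≤ n by omega) (hxA n))
  have hz0 : z ^ N ≠ 0 := by
    have : 0 < r ^ N := by linarith
    have h2 : 0 < ‖z‖ ^ N := this.trans_le (by gcongr)
    rw [← norm_pow] at h2
    exact norm_pos_iff.1 h2
  set e := (z ^ N)⁻¹ • ((T ^ N) (x n) - ((T ^ N) (x m) - z ^ N • x m)) with he
  have heA : e ∈ A (m + 1) := (A _).smul_mem _ ((A _).sub_mem e2 e1)
  have h5 : (T ^ N) (x n - x m) = - (z ^ N • (x m - e)) := by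
    rw [he, smul_sub, smul_smul, mul_inv_cancel₀ hz0, one_smul, map_sub]; abel
  rw [h5, norm_neg, norm_smul, norm_pow]
  calc r ^ N ≤ ‖z‖ ^ N * 1 := by rw [mul_one]; gcongr
    _ ≤ _ := by gcongr; exact hxy m e heA

end QC

/-! ### Part B : bounded variation generalities -/

theorem evar_add_le (f g : ℝ → ℂ) (s : Set ℝ) :
    eVariationOn (fun x => f x + g x) s ≤ eVariationOn f s + eVariationOn g s := by
  refine iSup_le ?_
  rintro ⟨n, u, hu, us⟩
  calc ∑ i ∈ Finset.range n, edist (f (u (i+1)) + g (u (i+1))) (f (u i) + g (u i))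
      ≤ ∑ i ∈ Finset.range n, (edist (f (u (i+1))) (f (u i)) + edist (g (u (i+1))) (g (u i))) :=
        Finset.sum_le_sum fun i _ => edist_add_add_le _ _ _ _
    _ = _ := Finset.sum_add_distrib
    _ ≤ _ := add_le_add (eVariationOn.sum_le hu us) (eVariationOn.sum_le hu us)

theorem evar_const_smul (z : ℂ) (g : ℝ → ℂ) (s : Set ℝ) :
    eVariationOn (fun x => z * g x) s ≤ ‖z‖ₑ * eVariationOn g s := by
  refine iSup_le ?_
  rintro ⟨n, u, hu, us⟩
  calc ∑ i ∈ Finset.range n, edist (z * g (u (i+1))) (z * g (u i))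
      = ∑ i ∈ Finset.range n, (‖z‖ₑ * edist (g (u (i+1))) (g (u i))) := by
        refine Finset.sum_congr rfl fun i _ => ?_
        rw [edist_eq_enorm_sub, edist_eq_enorm_sub, ← mul_sub, enorm_mul]
    _ = ‖z‖ₑ * ∑ i ∈ Finset.range n, (edist (g (u (i+1))) (g (u i))) := by rw [Finset.mul_sum]
    _ ≤ _ := by gcongr; exact eVariationOn.sum_le hu us

theorem evar_sum_le {ι : Type*} (A : Finset ι) (f : ι → ℝ → ℂ) (s : Set ℝ) :
    eVariationOn (fun x => ∑ i ∈ A, f i x) s ≤ ∑ i ∈ A, eVariationOn (f i) s := by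
  classical
  induction A using Finset.induction_on with
  | empty =>
    simp only [Finset.sum_empty, nonpos_iff_eq_zero]
    exact eVariationOn.constant_on (by rintro _ ⟨x, _, rfl⟩ _ ⟨y, _, rfl⟩; rfl)
  | insert i A hi ih =>
    simp only [Finset.sum_insert hi]
    exact (evar_add_le _ _ _).trans (by gcongr)

theorem evar_union_le {E : Type*} [PseudoEMetricSpace E] (f : ℝ → E) {s t : Set ℝ} {D : ENNReal}
    (hst : ∀ x ∈ s, ∀ y ∈ t, x ≤ y) (hD : ∀ x ∈ s, ∀ y ∈ t, edist (f x) (f y) ≤ D) :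
    eVariationOn f (s ∪ t) ≤ eVariationOn f s + D + eVariationOn f t := by
  refine iSup_le ?_
  rintro ⟨n, u, hu, us⟩
  have h1 : ∑ i ∈ Finset.range n, edist (f (u (i+1))) (f (u i)) = eVariationOn f (u '' Iic n) := by
    rw [eVariationOn.image_range_of_monotone f hu n]
    exact Finset.sum_congr rfl fun i _ => edist_comm _ _
  change ∑ i ∈ Finset.range n, edist (f (u (i+1))) (f (u i)) ≤ _
  rw [h1]
  set S := u '' Iic n with hS
  have hSf : S.Finite := (finite_Iic n).image _
  have hSu : S = (S ∩ s) ∪ (S ∩ t) := by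
    ext x; constructor
    · intro hx
      obtain ⟨i, _, rfl⟩ := hx
      rcases us i with h | h
      · exact Or.inl ⟨⟨i, ‹_›, rfl⟩, h⟩
      · exact Or.inr ⟨⟨i, ‹_›, rfl⟩, h⟩
    · rintro (h | h) <;> exact h.1
  rcases (S ∩ s).eq_empty_or_nonempty with he | hne
  · rw [he, empty_union] at hSu
    exact (eVariationOn.mono f (by rw [hSu]; exact inter_subset_right)).trans le_add_self
  rcases (S ∩ t).eq_empty_or_nonempty with he | hne'
  · rw [he, union_empty] at hSu
    exact (eVariationOn.mono f (by rw [hSu]; exact inter_subset_right)).trans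
      (le_self_add.trans le_self_add)
  obtain ⟨x, hx, hx'⟩ := Set.exists_max_image (S ∩ s) id (hSf.inter_of_left _) hne
  obtain ⟨y, hy, hy'⟩ := Set.exists_min_image (S ∩ t) id (hSf.inter_of_left _) hne'
  rw [hSu, eVariationOn.union' f (x := x) (y := y) ⟨hx, fun z hz => hx' z hz⟩
    ⟨hy, fun z hz => hy' z hz⟩ (hst x hx.2 y hy.2)]
  gcongr
  · exact eVariationOn.mono f inter_subset_right
  · exact hD x hx.2 y hy.2
  · exact eVariationOn.mono f inter_subset_right

theorem evar_indicator_le (h : ℝ → ℂ) {P : Set ℝ} (hP : P.OrdConnected) {M : ENNReal}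
    (hM : ∀ x ∈ P, ‖h x‖ₑ ≤ M) :
    eVariationOn (P.indicator h) univ ≤ eVariationOn h P + 2 * M := by
  rcases P.eq_empty_or_nonempty with he | ⟨p, hp⟩
  · subst he
    rw [indicator_empty]
    refine le_trans (le_of_eq ?_) zero_le
    exact eVariationOn.constant_on (by rintro _ ⟨x, _, rfl⟩ _ ⟨y, _, rfl⟩; rfl)
  have hU : (univ : Set ℝ) = {x | x ∉ P ∧ x < p} ∪ (P ∪ {x | x ∉ P ∧ p < x}) := by
    ext x
    simp only [mem_univ, mem_union, mem_ofPred_eq, true_iff]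
    rcases lt_trichotomy x p with h | h | h
    · tauto
    · subst h; tauto
    · tauto
  have z1 : ∀ s : Set ℝ, (∀ x ∈ s, x ∉ P) → eVariationOn (P.indicator h) s = 0 := by
    intro s hs
    refine eVariationOn.constant_on ?_
    rintro _ ⟨x, hx, rfl⟩ _ ⟨y, hy, rfl⟩
    simp [hs x hx, hs y hy]
  have hb : ∀ y, ‖P.indicator h y‖ₑ ≤ M := by
    intro y
    by_cases hy : y ∈ P
    · simpa [hy] using hM y hy
    · simp [hy]
  have e1 : eVariationOn (P.indicator h) (P ∪ {x | x ∉ P ∧ p < x}) ≤ eVariationOn h P + M + 0 := by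
    refine (evar_union_le (D := M) _ ?_ ?_).trans ?_
    · intro x hx y hy
      by_contra hlt
      exact hy.1 (hP.out hp hx ⟨hy.2.le, (not_le.1 hlt).le⟩)
    · intro x hx y hy
      rw [indicator_of_notMem hy.1, edist_zero_right]; exact hb x
    · rw [z1 {x | x ∉ P ∧ p < x} (fun x hx => hx.1), eVariationOn.congr (g := h) (s := P)]
      intro x hx; simp [hx]
  rw [hU]
  refine (evar_union_le (D := M) _ ?_ ?_).trans ?_
  · intro x hx y hy
    rcases hy with hy | hy
    · by_contra hlt
      exact hx.1 (hP.out hy hp ⟨(not_le.1 hlt).le, hx.2.le⟩)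
    · exact (hx.2.trans hy.2).le
  · intro x hx y _
    rw [indicator_of_notMem hx.1, edist_comm, edist_zero_right]; exact hb y
  · rw [z1 _ (fun x hx => hx.1)]
    refine (add_le_add_right e1 _).trans (le_of_eq ?_)
    ring

theorem enorm_sub_average_le (h : ℝ → ℂ) {P : Set ℝ} (hIntg : IntegrableOn h P)
    (h0 : volume P ≠ 0) (ht : volume P ≠ ⊤) (hfin : eVariationOn h P ≠ ⊤) (hm : MeasurableSet P)
    {y : ℝ} (hy : y ∈ P) :
    ‖h y - ⨍ x in P, h x‖ₑ ≤ eVariationOn h P := by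
  have key : (⨍ x in P, h x) ∈ Metric.closedBall (h y) (eVariationOn h P).toReal := by
    refine Convex.set_average_mem (convex_closedBall _ _) Metric.isClosed_closedBall h0 ht ?_ hIntg
    refine (ae_restrict_iff' hm).2 (Eventually.of_forall fun x hx => ?_)
    rw [Metric.mem_closedBall]
    rw [dist_edist]
    exact ENNReal.toReal_mono hfin (eVariationOn.edist_le h hx hy)
  rw [← edist_eq_enorm_sub, edist_comm, edist_dist]
  exact ENNReal.ofReal_le_of_le_toReal (Metric.mem_closedBall.1 key)

theorem evar_piece_le (g h : ℝ → ℂ) {P : Set ℝ} (hP : P.OrdConnected) (hm : MeasurableSet P)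
    (hIntg : IntegrableOn h P) (h0 : P.Nonempty → volume P ≠ 0) (ht : volume P ≠ ⊤)
    (hfin : eVariationOn h P ≠ ⊤) {G ε : ENNReal} (hG : ∀ x ∈ P, ‖g x‖ₑ ≤ G)
    (hε : eVariationOn g P ≤ ε) :
    eVariationOn (P.indicator (fun x => g x * h x)) univ ≤
      (3 * G + ε) * eVariationOn h P + (2 * G + ε) * ‖⨍ x in P, h x‖ₑ := by
  rcases P.eq_empty_or_nonempty with he | hne
  · subst he
    rw [indicator_empty]
    refine le_trans (le_of_eq ?_) zero_le
    exact eVariationOn.constant_on (by rintro _ ⟨x, _, rfl⟩ _ ⟨y, _, rfl⟩; rfl)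
  have hb : ∀ x ∈ P, ‖h x‖ₑ ≤ eVariationOn h P + ‖⨍ x in P, h x‖ₑ := by
    intro y hy
    calc ‖h y‖ₑ = ‖(h y - ⨍ x in P, h x) + ⨍ x in P, h x‖ₑ := by simp
      _ ≤ _ := enorm_add_le _ _
      _ ≤ _ := by gcongr; exact enorm_sub_average_le h hIntg (h0 hne) ht hfin hm hy
  have h1 := evar_indicator_le (fun x => g x * h x) hP
    (M := G * (eVariationOn h P + ‖⨍ x in P, h x‖ₑ)) (fun x hx => by
      rw [enorm_mul]; exact mul_le_mul' (hG x hx) (hb x hx))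
  have h2 : eVariationOn (fun x => g x * h x) P ≤
      G * eVariationOn h P + (eVariationOn h P + ‖⨍ x in P, h x‖ₑ) * eVariationOn g P :=
    eVariationOn_smul_le (𝕜 := ℂ) (f := g) (g := h) hG hb
  refine h1.trans ((add_le_add_left h2 _).trans ?_)
  calc _ ≤ G * eVariationOn h P + (eVariationOn h P + ‖⨍ x in P, h x‖ₑ) * ε
        + 2 * (G * (eVariationOn h P + ‖⨍ x in P, h x‖ₑ)) := by gcongr
    _ = _ := by ring

theorem bv_countable_disc {h : ℝ → ℂ} (hbv : BoundedVariationOn h univ) :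
    {x | ¬ ContinuousAt h x}.Countable := by
  have real : ∀ g : ℝ → ℝ, BoundedVariationOn g univ → {x | ¬ ContinuousAt g x}.Countable := by
    intro g hg
    obtain ⟨p, q, hp, hq, rfl⟩ := hg.locallyBoundedVariationOn.exists_monotoneOn_sub_monotoneOn
    rw [monotoneOn_univ] at hp hq
    refine (hp.countable_not_continuousAt.union hq.countable_not_continuousAt).mono ?_
    intro x hx
    by_contra hcon
    simp only [mem_union, mem_ofPred_eq, not_or, not_not] at hcon
    exact hx (hcon.1.sub hcon.2)
  have hre := real (fun x => (h x).re)
    ((LipschitzWith.of_le_add_mul 1 (f := Complex.re) (fun x y => by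
      have := Complex.abs_re_le_norm (x - y)
      rw [dist_eq_norm]
      simp only [Complex.sub_re, NNReal.coe_one, one_mul] at this ⊢
      linarith [le_abs_self (x.re - y.re)])).comp_boundedVariationOn hbv)
  have him := real (fun x => (h x).im)
    ((LipschitzWith.of_le_add_mul 1 (f := Complex.im) (fun x y => by
      have := Complex.abs_im_le_norm (x - y)
      rw [dist_eq_norm]
      simp only [Complex.sub_im, NNReal.coe_one, one_mul] at this ⊢
      linarith [le_abs_self (x.im - y.im)])).comp_boundedVariationOn hbv)
  refine (hre.union him).mono ?_
  intro x hx
  by_contra hcon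
  simp only [mem_union, mem_ofPred_eq, not_or, not_not] at hcon
  apply hx
  have : h = fun x => (((h x).re : ℝ) : ℂ) + (((h x).im : ℝ) : ℂ) * Complex.I := by
    ext1 x; exact (Complex.re_add_im _).symm
  rw [this]
  exact (Complex.continuous_ofReal.continuousAt.comp hcon.1).add
    ((Complex.continuous_ofReal.continuousAt.comp hcon.2).mul continuousAt_const)

theorem bv_measurable {h : ℝ → ℂ} (hbv : BoundedVariationOn h univ) : Measurable h :=
  measurable_of_countable_not_continuousAt (bv_countable_disc hbv)

theorem bv_bounded {h : ℝ → ℂ} (hbv : BoundedVariationOn h univ) : ∃ C, 0 ≤ C ∧ ∀ x, ‖h x‖ ≤ C := by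
  refine ⟨‖h 0‖ + (eVariationOn h univ).toReal, by positivity, fun x => ?_⟩
  have := hbv.dist_le (mem_univ x) (mem_univ 0)
  rw [dist_eq_norm] at this
  calc ‖h x‖ = ‖h 0 + (h x - h 0)‖ := by simp
    _ ≤ _ := norm_add_le _ _
    _ ≤ _ := by gcongr

theorem bv_integrable {h : ℝ → ℂ} (hbv : BoundedVariationOn h univ) {a b : ℝ}
    (hs : Function.support h ⊆ Icc a b) : Integrable h := by
  obtain ⟨C, _, hC⟩ := bv_bounded hbv
  rw [← integrableOn_iff_integrable_of_support_subset hs]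
  exact Measure.integrableOn_of_bounded (M := C) (by simp) (bv_measurable hbv).aestronglyMeasurable
    (Eventually.of_forall hC)

theorem bv_ae_eq_countable {g h : ℝ → ℂ} (hg : BoundedVariationOn g univ)
    (hh : BoundedVariationOn h univ) (hae : g =ᵐ[volume] h) : {x | g x ≠ h x}.Countable := by
  refine ((bv_countable_disc hg).union (bv_countable_disc hh)).mono ?_
  intro x hx
  by_contra hcon
  simp only [mem_union, mem_ofPred_eq, not_or, not_not] at hcon
  have h1 : ∀ᶠ y in 𝓝 x, g y ≠ h y := by
    have := (hcon.1.sub hcon.2).eventually_ne (y := 0) (by simpa [sub_eq_zero] using hx)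
    filter_upwards [this] with y hy using sub_ne_zero.1 hy
  obtain ⟨U, hU, hUo, hxU⟩ := eventually_nhds_iff.1 h1
  have : volume U ≤ 0 := by
    refine (measure_mono (fun y hy => ?_)).trans (le_of_eq hae)
    exact hU y hy
  exact (hUo.measure_pos volume ⟨x, hxU⟩).ne' (le_antisymm this zero_le)

/-! realization lemmas -/

theorem not_countable_Iio (t : ℝ) : ¬ (Iio t).Countable := by
  intro h
  have := h.measure_zero volume
  simp at this

theorem not_countable_Ioi (t : ℝ) : ¬ (Ioi t).Countable := by
  intro h
  have := h.measure_zero volume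
  simp at this

theorem not_countable_Ioo {s t : ℝ} (hst : s < t) : ¬ (Ioo s t).Countable := by
  intro h
  have := h.measure_zero volume
  simp at this
  linarith

section realization
variable {a b : ℝ} {V : Type} [NormedAddCommGroup V] [NormedSpace ℂ V] (R : BVRealization a b V)

theorem BVRealization.exists_rep (φ : V) {ε : ℝ} (hε : 0 < ε) :
    ∃ g : ℝ → ℂ, {x | g x ≠ R.toFun φ x}.Countable ∧
      eVariationOn g univ ≤ ENNReal.ofReal (‖φ‖ + ε) := by
  have h := R.norm_eq φ
  have hlt : (⨅ g ∈ {g : ℝ → ℂ | {x | g x ≠ R.toFun φ x}.Countable}, eVariationOn g Set.univ)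
      < ENNReal.ofReal (‖φ‖ + ε) := by
    rw [← h]
    exact (ENNReal.ofReal_lt_ofReal_iff (by positivity)).2 (by linarith)
  simp only [iInf_lt_iff] at hlt
  obtain ⟨g, hg, hg'⟩ := hlt
  exact ⟨g, hg, hg'.le⟩

theorem BVRealization.norm_le (φ : V) {g : ℝ → ℂ} (hg : {x | g x ≠ R.toFun φ x}.Countable)
    {C : ℝ} (hC : 0 ≤ C) (hgC : eVariationOn g univ ≤ ENNReal.ofReal C) : ‖φ‖ ≤ C := by
  have h := R.norm_eq φ
  have : ENNReal.ofReal ‖φ‖ ≤ ENNReal.ofReal C := by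
    rw [h]
    exact (iInf₂_le g hg).trans hgC
  exact (ENNReal.ofReal_le_ofReal_iff hC).1 this

theorem BVRealization.exists_zero (φ : V) {g : ℝ → ℂ} (hg : {x | g x ≠ R.toFun φ x}.Countable)
    {s : Set ℝ} (hs : ¬ s.Countable) (hs' : ∀ x ∈ s, x ∉ Icc a b) : ∃ x ∈ s, g x = 0 := by
  by_contra hcon
  push Not at hcon
  apply hs
  refine hg.mono fun x hx => ?_
  have : R.toFun φ x = 0 := by
    by_contra h; exact hs' x hx (R.supp φ h)
  simp only [mem_ofPred_eq, this]
  exact hcon x hx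

theorem BVRealization.enorm_rep_le (φ : V) {g : ℝ → ℂ} (hg : {x | g x ≠ R.toFun φ x}.Countable)
    (x : ℝ) : ‖g x‖ₑ ≤ eVariationOn g univ := by
  obtain ⟨y, _, hy⟩ := R.exists_zero φ hg (s := Ioi b) (by
      intro h
      have := h.measure_zero volume
      simp at this) (fun x hx hx' => not_lt.2 hx'.2 hx)
  have := eVariationOn.edist_le g (mem_univ x) (mem_univ y)
  rwa [hy, edist_zero_right] at this

theorem BVRealization.eq_of_countable {φ φ' : V} (h : {x | R.toFun φ x ≠ R.toFun φ' x}.Countable) :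
    φ = φ' := by
  rw [← sub_eq_zero, R.zero_iff]
  refine h.mono fun x hx => ?_
  intro he
  apply hx
  simp [he]

theorem BVRealization.eq_of_ae {φ φ' : V} (h : R.toFun φ =ᵐ[volume] R.toFun φ') :
    φ = φ' :=
  R.eq_of_countable (bv_ae_eq_countable (R.bv φ) (R.bv φ') h)

theorem BVRealization.integrable (φ : V) : Integrable (R.toFun φ) :=
  bv_integrable (R.bv φ) (R.supp φ)

theorem BVRealization.zero_of_notMem (φ : V) {x : ℝ} (hx : x ∉ Icc a b) : R.toFun φ x = 0 := by
  by_contra h; exact hx (R.supp φ h)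

end realization

theorem countable_ae {p : ℝ → Prop} (h : {x | ¬ p x}.Countable) : ∀ᵐ x, p x :=
  h.measure_zero volume

/-! ### Part C : elementary dynamics -/

section dyn
variable (F : PWUnimodal 2)

theorem uf_hasDerivAt_fp {x : ℝ} (hx : x ∈ F.Up) : HasDerivAt F.fp (deriv F.fp x) x :=
  ((F.fp_smooth.differentiableOn (by norm_num)).differentiableAt
    (F.openUp.mem_nhds hx)).hasDerivAt

theorem uf_hasDerivAt_fm {x : ℝ} (hx : x ∈ F.Um) : HasDerivAt F.fm (deriv F.fm x) x :=
  ((F.fm_smooth.differentiableOn (by norm_num)).differentiableAt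
    (F.openUm.mem_nhds hx)).hasDerivAt

theorem uf_expand_p {x y : ℝ} (hx : F.a ≤ x) (hxy : x < y) (hy : y ≤ F.c) :
    F.κ * (y - x) ≤ F.f y - F.f x := by
  have hsub : Icc x y ⊆ F.Up := fun z hz => F.subUp ⟨hx.trans hz.1, hz.2.trans hy⟩
  obtain ⟨z, hz, hz'⟩ := exists_deriv_eq_slope F.fp hxy
    (fun z hz => (uf_hasDerivAt_fp F (hsub hz)).continuousAt.continuousWithinAt)
    (fun z hz => (uf_hasDerivAt_fp F (hsub (Ioo_subset_Icc_self hz))).differentiableAt.differentiableWithinAt)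
  have h1 := F.fp_exp z (hsub (Ioo_subset_Icc_self hz))
  have hm := F.mono ⟨hx, hxy.le.trans hy⟩ ⟨hx.trans hxy.le, hy⟩ hxy
  rw [hz', F.fp_eq ⟨hx, hxy.le.trans hy⟩, F.fp_eq ⟨hx.trans hxy.le, hy⟩, abs_of_pos
    (div_pos (by linarith) (by linarith)), le_div_iff₀ (by linarith)] at h1
  exact h1

theorem uf_expand_m {x y : ℝ} (hx : F.c ≤ x) (hxy : x < y) (hy : y ≤ F.b) :
    F.κ * (y - x) ≤ F.f x - F.f y := by
  have hsub : Icc x y ⊆ F.Um := fun z hz => F.subUm ⟨hx.trans hz.1, hz.2.trans hy⟩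
  obtain ⟨z, hz, hz'⟩ := exists_deriv_eq_slope F.fm hxy
    (fun z hz => (uf_hasDerivAt_fm F (hsub hz)).continuousAt.continuousWithinAt)
    (fun z hz => (uf_hasDerivAt_fm F (hsub (Ioo_subset_Icc_self hz))).differentiableAt.differentiableWithinAt)
  have h1 := F.fm_exp z (hsub (Ioo_subset_Icc_self hz))
  have hm := F.anti ⟨hx, hxy.le.trans hy⟩ ⟨hx.trans hxy.le, hy⟩ hxy
  rw [hz', F.fm_eq ⟨hx, hxy.le.trans hy⟩, F.fm_eq ⟨hx.trans hxy.le, hy⟩, abs_of_neg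
    (div_neg_of_neg_of_pos (by linarith) (by linarith)), ← neg_div, le_div_iff₀ (by linarith)] at h1
  linarith

theorem uf_c_lt_c1 : F.c < F.f F.c := by
  have := uf_expand_p F le_rfl F.hac le_rfl
  rw [F.fa] at this
  nlinarith [F.one_lt_κ, F.hac]

theorem uf_c_mem : F.c ∈ Icc F.a F.b := ⟨F.hac.le, F.hcb.le⟩

theorem uf_c1_le_b : F.f F.c ≤ F.b := (F.mapsI (uf_c_mem F)).2

theorem uf_a_lt_c1 : F.a < F.f F.c := F.hac.trans (uf_c_lt_c1 F)

theorem uf_c2_lt_c : F.f (F.f F.c) < F.c := by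
  have h1 := uf_c_lt_c1 F
  have := uf_expand_m F le_rfl h1 (uf_c1_le_b F)
  nlinarith [F.one_lt_κ]

theorem uf_a_le_c2 : F.a ≤ F.f (F.f F.c) :=
  (F.mapsI (F.mapsI (uf_c_mem F))).1

theorem uf_le_c1 {x : ℝ} (hx : x ∈ Icc F.a F.b) : F.f x ≤ F.f F.c := by
  rcases le_total x F.c with h | h
  · exact F.mono.monotoneOn ⟨hx.1, h⟩ ⟨F.hac.le, le_rfl⟩ h
  · exact F.anti.antitoneOn ⟨le_rfl, F.hcb.le⟩ ⟨h, hx.2⟩ h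

theorem uf_lt_c1 {x : ℝ} (hx : x ∈ Icc F.a F.b) (hc : x ≠ F.c) : F.f x < F.f F.c := by
  rcases lt_or_gt_of_ne hc with h | h
  · exact F.mono ⟨hx.1, h.le⟩ ⟨F.hac.le, le_rfl⟩ h
  · exact F.anti ⟨le_rfl, F.hcb.le⟩ ⟨h.le, hx.2⟩ h

theorem uf_a_lt {x : ℝ} (hx : x ∈ Ioo F.a F.b) : F.a < F.f x := by
  rcases le_total x F.c with h | h
  · have := F.mono ⟨le_rfl, F.hac.le⟩ ⟨hx.1.le, h⟩ hx.1
    rwa [F.fa] at this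
  · have := F.anti ⟨h, hx.2.le⟩ ⟨F.hcb.le, le_rfl⟩ hx.2
    rwa [F.fb] at this

theorem uf_mapsJ {x : ℝ} (hx : x ∈ Icc (F.f (F.f F.c)) (F.f F.c)) :
    F.f x ∈ Icc (F.f (F.f F.c)) (F.f F.c) := by
  have hxI : x ∈ Icc F.a F.b := ⟨(uf_a_le_c2 F).trans hx.1, hx.2.trans (uf_c1_le_b F)⟩
  refine ⟨?_, uf_le_c1 F hxI⟩
  rcases le_total x F.c with h | h
  · have h3 := uf_c2_lt_c F
    have h2 : F.f (F.f (F.f F.c)) ≤ F.f x := F.mono.monotoneOn ⟨uf_a_le_c2 F, h3.le⟩ ⟨hxI.1, h⟩ hx.1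
    refine le_trans ?_ h2
    rcases (uf_a_le_c2 F).lt_or_eq with h4 | h4
    · have := uf_expand_p F le_rfl h4 h3.le
      rw [F.fa] at this
      nlinarith [F.one_lt_κ]
    · rw [← h4, F.fa]
  · exact F.anti.antitoneOn ⟨h, hxI.2⟩ ⟨(uf_c_lt_c1 F).le, uf_c1_le_b F⟩ hx.2

theorem uf_d_ge {x : ℝ} (hx : x ∈ Icc F.a F.b) : F.κ ≤ |F.d x| := by
  unfold PWUnimodal.d
  split_ifs with h
  · exact F.fp_exp _ (F.subUp ⟨hx.1, h⟩)
  · exact F.fm_exp _ (F.subUm ⟨(not_le.1 h).le, hx.2⟩)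

theorem uf_iter_mem (n : ℕ) {x : ℝ} (hx : x ∈ Icc F.a F.b) : F.f^[n] x ∈ Icc F.a F.b := by
  induction n with
  | zero => exact hx
  | succ n ih => rw [Function.iterate_succ_apply']; exact F.mapsI ih

theorem uf_dn_ge (n : ℕ) {x : ℝ} (hx : x ∈ Icc F.a F.b) : F.κ ^ n ≤ |F.dn n x| := by
  unfold PWUnimodal.dn
  rw [Finset.abs_prod]
  have := Finset.prod_le_prod (s := Finset.range n) (f := fun _ => F.κ)
    (g := fun i => |F.d (F.f^[i] x)|) (fun _ _ => by linarith [F.one_lt_κ])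
    (fun i _ => uf_d_ge F (uf_iter_mem F i hx))
  simpa using this

/-- `G n = sup 1/|(f^n)'|`. -/
def PWUnimodal.G (n : ℕ) : ℝ := (sInf ((fun x => |F.dn n x|) '' Icc F.a F.b))⁻¹

theorem uf_sInf_ge (n : ℕ) : F.κ ^ n ≤ sInf ((fun x => |F.dn n x|) '' Icc F.a F.b) := by
  refine le_csInf ⟨_, ⟨F.c, uf_c_mem F, rfl⟩⟩ ?_
  rintro _ ⟨x, hx, rfl⟩
  exact uf_dn_ge F n hx

theorem uf_G_pos (n : ℕ) : 0 < F.G n := by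
  have h1 : 0 < F.κ ^ n := pow_pos (by linarith [F.one_lt_κ]) _
  exact inv_pos.2 (h1.trans_le (uf_sInf_ge F n))

theorem uf_G_le (n : ℕ) : F.G n ≤ (F.κ⁻¹) ^ n := by
  have h1 : 0 < F.κ ^ n := pow_pos (by linarith [F.one_lt_κ]) _
  rw [inv_pow]
  exact inv_anti₀ h1 (uf_sInf_ge F n)

theorem uf_dn_inv_le (n : ℕ) {x : ℝ} (hx : x ∈ Icc F.a F.b) : |F.dn n x|⁻¹ ≤ F.G n := by
  have h1 : 0 < F.κ ^ n := pow_pos (by linarith [F.one_lt_κ]) _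
  refine inv_anti₀ (h1.trans_le (uf_sInf_ge F n)) (csInf_le ⟨0, ?_⟩ ⟨x, hx, rfl⟩)
  rintro _ ⟨y, _, rfl⟩
  exact abs_nonneg _

theorem uf_lam0 {lam0 : ℝ} (hlam0 : Filter.Tendsto
      (fun n : ℕ => (sInf ((fun x => |F.dn n x|) '' Set.Icc F.a F.b))⁻¹ ^ ((n : ℝ)⁻¹))
      Filter.atTop (nhds lam0)) :
    0 ≤ lam0 ∧ lam0 < 1 ∧ ∀ r, lam0 < r → ∀ᶠ n : ℕ in atTop, F.G n ≤ r ^ n := by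
  have hk : F.κ⁻¹ < 1 := inv_lt_one_of_one_lt₀ F.one_lt_κ
  have hk0 : 0 ≤ F.κ⁻¹ := inv_nonneg.2 (by linarith [F.one_lt_κ])
  have h0 : 0 ≤ lam0 := ge_of_tendsto' hlam0 fun n => Real.rpow_nonneg (uf_G_pos F n).le _
  refine ⟨h0, ?_, ?_⟩
  · refine lt_of_le_of_lt (le_of_tendsto hlam0 ?_) hk
    filter_upwards [eventually_ge_atTop 1] with n hn
    have := Real.rpow_le_rpow (z := ((n:ℝ)⁻¹)) (uf_G_pos F n).le (uf_G_le F n) (by positivity)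
    rwa [Real.pow_rpow_inv_natCast hk0 (by omega)] at this
  · intro r hr
    filter_upwards [hlam0.eventually_lt_const hr, eventually_ge_atTop 1] with n hn hn1
    have h1 : F.G n = (F.G n ^ ((n:ℝ)⁻¹)) ^ n :=
      (Real.rpow_inv_natCast_pow (uf_G_pos F n).le (by omega)).symm
    rw [h1]
    exact pow_le_pow_left₀ (Real.rpow_nonneg (uf_G_pos F n).le _) hn.le _

variable {F} (B : F.InvBranches)

theorem br_ψp_f {x : ℝ} (hx : x ∈ Icc F.a F.c) : B.ψp (F.f x) = x := by
  have hxI : x ∈ Icc F.a F.b := ⟨hx.1, hx.2.trans F.hcb.le⟩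
  have := B.inv_p (F.f x) ⟨(F.mapsI hxI).1, uf_le_c1 F hxI⟩
  exact F.mono.injOn this.1 hx this.2

theorem br_ψm_f {x : ℝ} (hx : x ∈ Icc F.c F.b) : B.ψm (F.f x) = x := by
  have hxI : x ∈ Icc F.a F.b := ⟨F.hac.le.trans hx.1, hx.2⟩
  have := B.inv_m (F.f x) ⟨(F.mapsI hxI).1, uf_le_c1 F hxI⟩
  exact F.anti.injOn this.1 hx this.2

theorem br_ψp_a : B.ψp F.a = F.a := by
  have := br_ψp_f B (x := F.a) ⟨le_rfl, F.hac.le⟩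
  rwa [F.fa] at this
theorem br_ψm_a : B.ψm F.a = F.b := by
  have := br_ψm_f B (x := F.b) ⟨F.hcb.le, le_rfl⟩
  rwa [F.fb] at this
theorem br_ψp_c1 : B.ψp (F.f F.c) = F.c := br_ψp_f B ⟨F.hac.le, le_rfl⟩
theorem br_ψm_c1 : B.ψm (F.f F.c) = F.c := br_ψm_f B ⟨le_rfl, F.hcb.le⟩

theorem br_ψp_mono : StrictMonoOn B.ψp (Icc F.a (F.f F.c)) := by
  intro x hx y hy hxy
  by_contra h
  have := F.mono.monotoneOn (B.inv_p y hy).1 (B.inv_p x hx).1 (not_lt.1 h)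
  rw [(B.inv_p y hy).2, (B.inv_p x hx).2] at this
  linarith

theorem br_ψm_anti : StrictAntiOn B.ψm (Icc F.a (F.f F.c)) := by
  intro x hx y hy hxy
  by_contra h
  have := F.anti.antitoneOn (B.inv_m x hx).1 (B.inv_m y hy).1 (not_lt.1 h)
  rw [(B.inv_m y hy).2, (B.inv_m x hx).2] at this
  linarith

theorem br_ψp_mem {x : ℝ} (hx : x ∈ Ioo F.a (F.f F.c)) : B.ψp x ∈ Ioo F.a F.c := by
  have h1 := br_ψp_mono B ⟨le_rfl, (uf_a_lt_c1 F).le⟩ (Ioo_subset_Icc_self hx) hx.1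
  have h2 := br_ψp_mono B (Ioo_subset_Icc_self hx) ⟨(uf_a_lt_c1 F).le, le_rfl⟩ hx.2
  rw [br_ψp_a] at h1
  rw [br_ψp_c1] at h2
  exact ⟨h1, h2⟩

theorem br_ψm_mem {x : ℝ} (hx : x ∈ Ioo F.a (F.f F.c)) : B.ψm x ∈ Ioo F.c F.b := by
  have h1 := br_ψm_anti B ⟨le_rfl, (uf_a_lt_c1 F).le⟩ (Ioo_subset_Icc_self hx) hx.1
  have h2 := br_ψm_anti B (Ioo_subset_Icc_self hx) ⟨(uf_a_lt_c1 F).le, le_rfl⟩ hx.2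
  rw [br_ψm_a] at h1
  rw [br_ψm_c1] at h2
  exact ⟨h2, h1⟩

theorem br_hasDerivAt_p {x : ℝ} (hx : x < F.f F.c) : HasDerivAt B.ψp (deriv B.ψp x) x :=
  ((B.smooth_p.differentiableOn (by norm_num)).differentiableAt (Iic_mem_nhds hx)).hasDerivAt
theorem br_hasDerivAt_m {x : ℝ} (hx : x < F.f F.c) : HasDerivAt B.ψm (deriv B.ψm x) x :=
  ((B.smooth_m.differentiableOn (by norm_num)).differentiableAt (Iic_mem_nhds hx)).hasDerivAt

theorem br_chain_p {x : ℝ} (hx : x ∈ Ioo F.a (F.f F.c)) :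
    F.d (B.ψp x) * deriv B.ψp x = 1 := by
  have hm := br_ψp_mem B hx
  have h1 := (uf_hasDerivAt_fp F (F.subUp (Ioo_subset_Icc_self hm))).comp x (br_hasDerivAt_p B hx.2)
  have h2 : HasDerivAt (F.fp ∘ B.ψp) 1 x := by
    refine (hasDerivAt_id x).congr_of_eventuallyEq ?_
    filter_upwards [isOpen_Ioo.mem_nhds hx] with y hy
    have := B.inv_p y (Ioo_subset_Icc_self hy)
    simp only [Function.comp, F.fp_eq this.1, this.2, id]
  have := h1.unique h2
  rw [PWUnimodal.d, if_pos hm.2.le]; exact this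

theorem br_chain_m {x : ℝ} (hx : x ∈ Ioo F.a (F.f F.c)) :
    F.d (B.ψm x) * deriv B.ψm x = 1 := by
  have hm := br_ψm_mem B hx
  have h1 := (uf_hasDerivAt_fm F (F.subUm (Ioo_subset_Icc_self hm))).comp x (br_hasDerivAt_m B hx.2)
  have h2 : HasDerivAt (F.fm ∘ B.ψm) 1 x := by
    refine (hasDerivAt_id x).congr_of_eventuallyEq ?_
    filter_upwards [isOpen_Ioo.mem_nhds hx] with y hy
    have := B.inv_m y (Ioo_subset_Icc_self hy)
    simp only [Function.comp, F.fm_eq this.1, this.2, id]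
  have := h1.unique h2
  rw [PWUnimodal.d, if_neg (not_le.2 hm.1)]; exact this

theorem br_deriv_p_pos {x : ℝ} (hx : x ∈ Ioo F.a (F.f F.c)) : 0 < deriv B.ψp x := by
  have h0 : deriv B.ψp x ≠ 0 := right_ne_zero_of_mul_eq_one (br_chain_p B hx)
  refine lt_of_le_of_ne ?_ h0.symm
  have hmono : MonotoneOn B.ψp (Ioo F.a (F.f F.c)) :=
    (br_ψp_mono B).monotoneOn.mono Ioo_subset_Icc_self
  have := hmono.derivWithin_nonneg (x := x)
  rwa [derivWithin_of_isOpen isOpen_Ioo hx] at this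

theorem br_lip (ψ : ℝ → ℝ) (c1 a : ℝ) (hs : ContDiffOn ℝ (2:ℕ) ψ (Iic c1)) :
    ∃ K : NNReal, LipschitzOnWith K (fun x => |deriv ψ x|) (Ioo a c1) := by
  have h1 : ContDiffOn ℝ 1 (derivWithin ψ (Iic c1)) (Iic c1) := by
    have hs' : ContDiffOn ℝ (1 + 1) ψ (Iic c1) := by
      convert hs using 1
      norm_num
    exact ((contDiffOn_succ_iff_derivWithin (uniqueDiffOn_Iic c1)).1 hs').2.2
  obtain ⟨K, hK⟩ := (h1.mono (Icc_subset_Iic_self (a := a))).exists_lipschitzOnWith one_ne_zero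
    (convex_Icc a c1) isCompact_Icc
  refine ⟨K, ?_⟩
  have h2 : LipschitzOnWith K (deriv ψ) (Ioo a c1) := by
    intro x hx y hy
    have := hK (Ioo_subset_Icc_self hx) (Ioo_subset_Icc_self hy)
    rwa [derivWithin_of_mem_nhds (Iic_mem_nhds hx.2),
      derivWithin_of_mem_nhds (Iic_mem_nhds hy.2)] at this
  rw [lipschitzOnWith_iff_dist_le_mul] at h2 ⊢
  intro x hx y hy
  refine le_trans ?_ (h2 x hx y hy)
  rw [Real.dist_eq, Real.dist_eq]
  exact abs_abs_sub_abs_le_abs_sub _ _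

/-- the two inverse branches, indexed by `Bool`. -/
def PWUnimodal.InvBranches.br (s : Bool) : ℝ → ℝ := if s then B.ψp else B.ψm

theorem br_mem (s : Bool) {x : ℝ} (hx : x ∈ Ioo F.a (F.f F.c)) : B.br s x ∈ Ioo F.a F.b := by
  cases s
  · have := br_ψm_mem B hx
    exact ⟨F.hac.trans this.1, this.2⟩
  · have := br_ψp_mem B hx
    exact ⟨this.1, this.2.trans F.hcb⟩

theorem br_f (s : Bool) {x : ℝ} (hx : x ∈ Icc F.a (F.f F.c)) : F.f (B.br s x) = x := by
  cases s
  · exact (B.inv_m x hx).2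
  · exact (B.inv_p x hx).2

theorem br_injOn (s : Bool) : InjOn (B.br s) (Icc F.a (F.f F.c)) := by
  intro x hx y hy h
  rw [← br_f B s hx, ← br_f B s hy, h]

theorem br_contOn (s : Bool) : ContinuousOn (B.br s) (Iic (F.f F.c)) := by
  cases s
  · exact B.smooth_m.continuousOn
  · exact B.smooth_p.continuousOn

theorem br_hasDerivAt (s : Bool) {x : ℝ} (hx : x < F.f F.c) :
    HasDerivAt (B.br s) (deriv (B.br s) x) x := by
  cases s
  · exact br_hasDerivAt_m B hx
  · exact br_hasDerivAt_p B hx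

theorem br_deriv (s : Bool) {x : ℝ} (hx : x ∈ Ioo F.a (F.f F.c)) :
    |deriv (B.br s) x| = |F.d (B.br s x)|⁻¹ := by
  have key : F.d (B.br s x) * deriv (B.br s) x = 1 := by
    cases s
    · exact br_chain_m B hx
    · exact br_chain_p B hx
  rw [← abs_inv, eq_inv_of_mul_eq_one_right key]

theorem br_deriv_le (s : Bool) {x : ℝ} (hx : x < F.f F.c) : |deriv (B.br s) x| ≤ B.θ := by
  cases s
  · exact B.dψm x hx.le
  · exact B.dψp x hx.le

theorem br_lipschitz (s : Bool) :
    ∃ K : NNReal, LipschitzOnWith K (fun x => |deriv (B.br s) x|) (Ioo F.a (F.f F.c)) := by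
  cases s
  · exact br_lip B.ψm _ _ B.smooth_m
  · exact br_lip B.ψp _ _ B.smooth_p

theorem br_monoanti (s : Bool) :
    MonotoneOn (B.br s) (Icc F.a (F.f F.c)) ∨ AntitoneOn (B.br s) (Icc F.a (F.f F.c)) := by
  cases s
  · exact Or.inr (br_ψm_anti B).antitoneOn
  · exact Or.inl (br_ψp_mono B).monotoneOn

/-- every point of `I` is one of the preimages of its image. -/
theorem br_of_f {x : ℝ} (hx : x ∈ Icc F.a F.b) : ∃ s, B.br s (F.f x) = x := by
  rcases le_total x F.c with h | h
  · exact ⟨true, br_ψp_f B ⟨hx.1, h⟩⟩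
  · exact ⟨false, br_ψm_f B ⟨h, hx.2⟩⟩

/-- Normalised transfer operator. -/
def PWUnimodal.InvBranches.P1 (h : ℝ → ℂ) (x : ℝ) : ℂ :=
  (Ioo F.a (F.f F.c)).indicator
    (fun x => ∑ s : Bool, ((|deriv (B.br s) x| : ℝ) : ℂ) * h (B.br s x)) x

theorem P1_of_mem (h : ℝ → ℂ) {x : ℝ} (hx : x ∈ Ioo F.a (F.f F.c)) :
    B.P1 h x = ∑ s : Bool, ((|deriv (B.br s) x| : ℝ) : ℂ) * h (B.br s x) := by
  simp [PWUnimodal.InvBranches.P1, hx]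

theorem P1_of_notMem (h : ℝ → ℂ) {x : ℝ} (hx : x ∉ Ioo F.a (F.f F.c)) : B.P1 h x = 0 := by
  simp [PWUnimodal.InvBranches.P1, hx]

theorem L1c_eq_P1 (h : ℝ → ℂ) {x : ℝ} (hx : x ∈ Ioo F.a (F.f F.c)) : B.L1c h x = B.P1 h x := by
  rw [P1_of_mem B h hx]
  have := br_deriv_p_pos B hx
  simp [PWUnimodal.InvBranches.L1c, PWUnimodal.χ, hx.2, PWUnimodal.InvBranches.br, abs_of_pos this]

variable {V : Type} [NormedAddCommGroup V] [NormedSpace ℂ V] (R : BVRealization F.a F.b V)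

theorem TL1_P1 {TL1 : V →L[ℂ] V}
    (hTL1 : ∀ φ : V, {x | R.toFun (TL1 φ) x ≠ B.L1c (R.toFun φ) x}.Countable) (φ : V) :
    {x | R.toFun (TL1 φ) x ≠ B.P1 (R.toFun φ) x}.Countable := by
  refine ((hTL1 φ).union ((countable_singleton F.a).union (countable_singleton (F.f F.c)))).mono ?_
  intro x hx
  by_contra hcon
  simp only [mem_union, mem_ofPred_eq, not_or, not_not, mem_singleton_iff] at hcon
  apply hx
  by_cases h : x ∈ Ioo F.a (F.f F.c)
  · rw [hcon.1, L1c_eq_P1 B _ h]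
  · rw [P1_of_notMem B _ h]
    rcases lt_trichotomy x F.a with h1 | h1 | h1
    · exact R.zero_of_notMem _ (fun h2 => by linarith [h2.1])
    · exact absurd h1 hcon.2.1
    · have h2 : F.f F.c < x := lt_of_le_of_ne (not_lt.1 fun h2 => h ⟨h1, h2⟩) (Ne.symm hcon.2.2)
      rw [hcon.1]
      simp [PWUnimodal.InvBranches.L1c, PWUnimodal.χ, not_lt.2 h2.le, h2.ne']

/-- countable sets pull back through the inverse branches. -/
theorem br_preimage_countable (s : Bool) {E : Set ℝ} (hE : E.Countable) :
    {x | x ∈ Icc F.a (F.f F.c) ∧ B.br s x ∈ E}.Countable := by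
  have : MapsTo (B.br s) {x | x ∈ Icc F.a (F.f F.c) ∧ B.br s x ∈ E} E := fun x hx => hx.2
  exact this.countable_of_injOn ((br_injOn B s).mono fun x hx => hx.1) hE

end dyn

/-! ### Part D : Lasota-Yorke inequality -/

section ly
variable {F : PWUnimodal 2} (B : F.InvBranches)

/-- The system of inverse branches of `f^N`. -/
structure BrSys (N : ℕ) where
  ι : Type
  fin : Fintype ι
  J : ι → Set ℝ
  ψ : ι → ℝ → ℝ
  g : ι → ℝ → ℝ
  isOpen : ∀ i, IsOpen (J i)
  ord : ∀ i, (J i).OrdConnected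
  sub : ∀ i, J i ⊆ Ioo F.a F.b
  inj : ∀ i, InjOn (ψ i) (J i)
  contOn : ∀ i, ContinuousOn (ψ i) (J i)
  maps : ∀ i, MapsTo (ψ i) (J i) (Icc F.a F.b)
  lip : ∀ i, ∃ K : NNReal, LipschitzOnWith K (g i) (J i)
  gval : ∀ i, ∀ x ∈ J i, g i x = |F.dn N (ψ i x)|⁻¹
  iter : ∀ i, ∀ x ∈ J i, F.f^[N] (ψ i x) = x
  var : ∀ h : ℝ → ℂ, ∑ i, eVariationOn (h ∘ ψ i) (J i) ≤ eVariationOn h univ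
  form : ∀ h : ℝ → ℂ, ∀ x ∈ Ioo F.a F.b,
    (B.P1)^[N] h x = ∑ i, (J i).indicator (fun x => (g i x : ℂ) * h (ψ i x)) x

attribute [instance] BrSys.fin

def BrSys.zero : BrSys B 0 where
  ι := Unit
  fin := inferInstance
  J := fun _ => Ioo F.a F.b
  ψ := fun _ => id
  g := fun _ _ => 1
  isOpen := fun _ => isOpen_Ioo
  ord := fun _ => ordConnected_Ioo
  sub := fun _ => Subset.rfl
  inj := fun _ => Function.injective_id.injOn
  contOn := fun _ => continuousOn_id
  maps := fun _ => fun x hx => Ioo_subset_Icc_self hx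
  lip := fun _ => ⟨0, (LipschitzWith.const 1).lipschitzOnWith⟩
  gval := fun _ x _ => by simp [PWUnimodal.dn]
  iter := fun _ x _ => rfl
  var := fun h => by simpa using eVariationOn.mono h (subset_univ _)
  form := fun h x hx => by simp [hx]

variable {B}

theorem br_evar_le (h : ℝ → ℂ) (J : Set ℝ) :
    ∑ s : Bool, eVariationOn (h ∘ B.br s) {x | x ∈ Ioo F.a (F.f F.c) ∧ B.br s x ∈ J} ≤
      eVariationOn h J := by
  have h1 : eVariationOn (h ∘ B.br true) {x | x ∈ Ioo F.a (F.f F.c) ∧ B.br true x ∈ J} ≤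
      eVariationOn h (J ∩ Iic F.c) := by
    refine eVariationOn.comp_le_of_monotoneOn _ _ ((br_ψp_mono B).monotoneOn.mono
      fun x hx => Ioo_subset_Icc_self hx.1) ?_
    intro x hx
    exact ⟨hx.2, (br_ψp_mem B hx.1).2.le⟩
  have h2 : eVariationOn (h ∘ B.br false) {x | x ∈ Ioo F.a (F.f F.c) ∧ B.br false x ∈ J} ≤
      eVariationOn h (J ∩ Ici F.c) := by
    refine eVariationOn.comp_le_of_antitoneOn _ _ ((br_ψm_anti B).antitoneOn.mono
      fun x hx => Ioo_subset_Icc_self hx.1) ?_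
    intro x hx
    exact ⟨hx.2, (br_ψm_mem B hx.1).1.le⟩
  rw [Fintype.sum_bool]
  refine (add_le_add h1 h2).trans ((eVariationOn.add_le_union h ?_).trans ?_)
  · intro x hx y hy; exact le_trans (mem_Iic.1 hx.2) (mem_Ici.1 hy.2)
  · exact eVariationOn.mono h (union_subset inter_subset_left inter_subset_left)

theorem ordConnected_branch {ψ : ℝ → ℝ} {A J : Set ℝ} (hA : A.OrdConnected) (hJ : J.OrdConnected)
    (h : MonotoneOn ψ A ∨ AntitoneOn ψ A) : ({x | x ∈ A ∧ ψ x ∈ J}).OrdConnected := by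
  refine ⟨?_⟩
  intro x hx y hy z hz
  have hzA := hA.out hx.1 hy.1 hz
  refine ⟨hzA, ?_⟩
  rcases h with h | h
  · exact hJ.out hx.2 hy.2 ⟨h hx.1 hzA hz.1, h hzA hy.1 hz.2⟩
  · exact hJ.out hy.2 hx.2 ⟨h hzA hy.1 hz.2, h hx.1 hzA hz.1⟩

theorem br_lipschitz_self (s : Bool) :
    LipschitzOnWith 1 (B.br s) (Ioo F.a (F.f F.c)) := by
  refine Convex.lipschitzOnWith_of_nnnorm_deriv_le (𝕜 := ℝ)
    (fun x hx => (br_hasDerivAt B s hx.2).differentiableAt) (fun x hx => ?_) (convex_Ioo _ _)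
  rw [← NNReal.coe_le_coe, coe_nnnorm, Real.norm_eq_abs]
  exact (br_deriv_le B s hx.2).trans B.θ_lt.le

theorem lip_mul {u v : ℝ → ℝ} {J : Set ℝ} {K L : NNReal} (hu : LipschitzOnWith K u J)
    (hv : LipschitzOnWith L v J) (hu1 : ∀ x ∈ J, |u x| ≤ 1) (hv1 : ∀ x ∈ J, |v x| ≤ 1) :
    LipschitzOnWith (K + L) (fun x => u x * v x) J := by
  rw [lipschitzOnWith_iff_dist_le_mul] at *
  intro x hx y hy
  have h1 := hu x hx y hy
  have h2 := hv x hx y hy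
  rw [Real.dist_eq] at *
  calc |u x * v x - u y * v y| = |(u x - u y) * v x + u y * (v x - v y)| := by ring_nf
    _ ≤ |u x - u y| * |v x| + |u y| * |v x - v y| := by
      rw [← abs_mul, ← abs_mul]; exact abs_add_le _ _
    _ ≤ |u x - u y| * 1 + 1 * |v x - v y| := by
      gcongr
      · exact hv1 x hx
      · exact hu1 y hy
    _ ≤ _ := by push_cast; linarith

def BrSys.succ {N : ℕ} (S : BrSys B N) : BrSys B (N + 1) where
  ι := S.ι × Bool
  fin := inferInstance
  J := fun p => {x | x ∈ Ioo F.a (F.f F.c) ∧ B.br p.2 x ∈ S.J p.1}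
  ψ := fun p => S.ψ p.1 ∘ B.br p.2
  g := fun p x => |deriv (B.br p.2) x| * S.g p.1 (B.br p.2 x)
  isOpen := fun p => by
    have := ((br_contOn B p.2).mono (fun x hx => hx.2.le : Ioo F.a (F.f F.c) ⊆ _)).isOpen_inter_preimage
      isOpen_Ioo (S.isOpen p.1)
    exact this
  ord := fun p => ordConnected_branch ordConnected_Ioo (S.ord p.1)
    ((br_monoanti B p.2).imp (fun h => h.mono Ioo_subset_Icc_self)
      (fun h => h.mono Ioo_subset_Icc_self))
  sub := fun p x hx => ⟨hx.1.1, hx.1.2.trans_le (uf_c1_le_b F)⟩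
  inj := fun p x hx y hy h => br_injOn B p.2 (Ioo_subset_Icc_self hx.1) (Ioo_subset_Icc_self hy.1)
    (S.inj p.1 hx.2 hy.2 h)
  contOn := fun p => (S.contOn p.1).comp ((br_contOn B p.2).mono fun x hx => hx.1.2.le)
    fun x hx => hx.2
  maps := fun p x hx => S.maps p.1 hx.2
  lip := fun p => by
    obtain ⟨K, hK⟩ := br_lipschitz B p.2
    obtain ⟨L, hL⟩ := S.lip p.1
    refine ⟨K + L * 1, lip_mul (hK.mono fun x hx => hx.1) (hL.comp
      ((br_lipschitz_self p.2).mono fun x hx => hx.1) fun x hx => hx.2) ?_ ?_⟩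
    · intro x hx
      rw [abs_abs]
      exact (br_deriv_le B p.2 hx.1.2).trans B.θ_lt.le
    · intro x hx
      rw [S.gval p.1 _ hx.2, abs_inv, abs_abs]
      refine inv_le_one_of_one_le₀ ((one_le_pow₀ F.one_lt_κ.le).trans
        (uf_dn_ge F N (S.maps p.1 hx.2)))
  gval := fun p x hx => by
    rw [S.gval p.1 _ hx.2, br_deriv B p.2 hx.1]
    simp only [PWUnimodal.dn, Finset.prod_range_succ, abs_mul, mul_inv, Function.comp]
    rw [S.iter p.1 _ hx.2, mul_comm]
  iter := fun p x hx => by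
    rw [Function.iterate_succ_apply', Function.comp, S.iter p.1 _ hx.2,
      br_f B p.2 (Ioo_subset_Icc_self hx.1)]
  var := fun h => by
    rw [Fintype.sum_prod_type]
    refine le_trans (Finset.sum_le_sum fun i _ => ?_) (S.var h)
    exact br_evar_le (B := B) (h ∘ S.ψ i) (S.J i)
  form := fun h x hx => by
    rw [Function.iterate_succ_apply', Fintype.sum_prod_type]
    by_cases hx' : x ∈ Ioo F.a (F.f F.c)
    · rw [P1_of_mem B _ hx', Finset.sum_comm]
      refine Finset.sum_congr rfl fun s _ => ?_
      rw [S.form h _ (br_mem B s hx'), Finset.mul_sum]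
      refine Finset.sum_congr rfl fun i _ => ?_
      by_cases hi : B.br s x ∈ S.J i
      · have hmem : x ∈ {y | y ∈ Ioo F.a (F.f F.c) ∧ B.br s y ∈ S.J i} := ⟨hx', hi⟩
        rw [indicator_of_mem hi]
        refine Eq.trans ?_ (indicator_of_mem hmem _).symm
        simp [mul_assoc]
      · have hmem : x ∉ {y | y ∈ Ioo F.a (F.f F.c) ∧ B.br s y ∈ S.J i} := fun h => hi h.2
        rw [indicator_of_notMem hi, mul_zero]
        exact (indicator_of_notMem hmem _).symm
    · rw [P1_of_notMem B _ hx']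
      symm
      refine Finset.sum_eq_zero fun i _ => Finset.sum_eq_zero fun s _ => ?_
      exact indicator_of_notMem (fun h : x ∈ {x | _ ∧ _} => hx' h.1) _

variable (B) in
def BrSys.mk' : (N : ℕ) → BrSys B N
  | 0 => BrSys.zero B
  | N + 1 => (BrSys.mk' N).succ

variable {V : Type} [NormedAddCommGroup V] [NormedSpace ℂ V] (R : BVRealization F.a F.b V)

theorem P1_congr_countable {h h' : ℝ → ℂ} (hh : {x | h x ≠ h' x}.Countable) :
    {x | B.P1 h x ≠ B.P1 h' x}.Countable := by
  refine ((br_preimage_countable B true hh).union (br_preimage_countable B false hh)).mono ?_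
  intro x hx
  by_contra hcon
  apply hx
  by_cases hx' : x ∈ Ioo F.a (F.f F.c)
  · rw [P1_of_mem B _ hx', P1_of_mem B _ hx']
    refine Finset.sum_congr rfl fun s _ => ?_
    congr 1
    by_contra hne
    apply hcon
    cases s
    · exact Or.inr ⟨Ioo_subset_Icc_self hx', hne⟩
    · exact Or.inl ⟨Ioo_subset_Icc_self hx', hne⟩
  · rw [P1_of_notMem B _ hx', P1_of_notMem B _ hx']

theorem countable_ne_trans {f g h : ℝ → ℂ} (h1 : {x | f x ≠ g x}.Countable)
    (h2 : {x | g x ≠ h x}.Countable) : {x | f x ≠ h x}.Countable := by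
  refine (h1.union h2).mono fun x hx => ?_
  by_contra hcon
  simp only [mem_union, mem_ofPred_eq, not_or, not_not] at hcon
  exact hx (hcon.1.trans hcon.2)

theorem countable_ne_symm {f g : ℝ → ℂ} (h1 : {x | f x ≠ g x}.Countable) :
    {x | g x ≠ f x}.Countable := h1.mono fun _ hx => Ne.symm hx

theorem TL1_pow {TL1 : V →L[ℂ] V}
    (hTL1 : ∀ φ : V, {x | R.toFun (TL1 φ) x ≠ B.L1c (R.toFun φ) x}.Countable) (N : ℕ) (φ : V) :
    {x | R.toFun ((TL1 ^ N) φ) x ≠ (B.P1)^[N] (R.toFun φ) x}.Countable := by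
  induction N with
  | zero => simp
  | succ N ih =>
    rw [pow_succ']
    simp only [Function.iterate_succ_apply']
    exact countable_ne_trans (TL1_P1 B R hTL1 ((TL1 ^ N) φ)) (P1_congr_countable ih)

theorem TL1_pow_form {TL1 : V →L[ℂ] V}
    (hTL1 : ∀ φ : V, {x | R.toFun (TL1 φ) x ≠ B.L1c (R.toFun φ) x}.Countable) {N : ℕ}
    (S : BrSys B N) (φ : V) {h : ℝ → ℂ} (hh : {x | h x ≠ R.toFun φ x}.Countable) :
    {x | (∑ i, (S.J i).indicator (fun x => (S.g i x : ℂ) * h (S.ψ i x)) x) ≠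
      R.toFun ((TL1 ^ N) φ) x}.Countable := by
  have hc : (⋃ i, {x | x ∈ S.J i ∧ S.ψ i x ∈ {x | h x ≠ R.toFun φ x}}).Countable := by
    refine countable_iUnion fun i => ?_
    have : MapsTo (S.ψ i) {x | x ∈ S.J i ∧ S.ψ i x ∈ {x | h x ≠ R.toFun φ x}}
      {x | h x ≠ R.toFun φ x} := fun x hx => hx.2
    exact this.countable_of_injOn ((S.inj i).mono fun x hx => hx.1) hh
  refine ((hc.union (TL1_pow R hTL1 N φ)).union
    ((countable_singleton F.a).union (countable_singleton F.b))).mono ?_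
  intro x hx
  by_contra hcon
  simp only [mem_union, not_or, mem_iUnion, not_exists, mem_singleton_iff] at hcon
  obtain ⟨⟨h1, h2⟩, h3, h4⟩ := hcon
  apply hx
  by_cases hxI : x ∈ Ioo F.a F.b
  · have h2' : R.toFun ((TL1 ^ N) φ) x = (B.P1)^[N] (R.toFun φ) x := by
      by_contra hne; exact h2 hne
    rw [h2', S.form _ x hxI]
    refine Finset.sum_congr rfl fun i _ => ?_
    by_cases hi : x ∈ S.J i
    · rw [indicator_of_mem hi, indicator_of_mem hi]
      congr 1
      by_contra hne
      exact h1 i ⟨hi, hne⟩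
    · rw [indicator_of_notMem hi, indicator_of_notMem hi]
  · rw [R.zero_of_notMem _ (fun h5 => hxI ⟨lt_of_le_of_ne h5.1 (Ne.symm h3), lt_of_le_of_ne h5.2 h4⟩)]
    exact Finset.sum_eq_zero fun i _ => indicator_of_notMem (fun h => hxI (S.sub i h)) _

/-- pieces of an interval -/
def piece (a δ : ℝ) (J : Set ℝ) (k : ℕ) : Set ℝ := J ∩ Ico (a + k * δ) (a + (k + 1 : ℕ) * δ)

theorem piece_unique {a δ : ℝ} (hδ : 0 < δ) {J : Set ℝ} {x : ℝ} {j k : ℕ}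
    (hj : x ∈ piece a δ J j) (hk : x ∈ piece a δ J k) : j = k := by
  have key : ∀ m n : ℕ, x ∈ piece a δ J m → x ∈ piece a δ J n → ¬ m < n := by
    intro m n hm hn hmn
    have h1 := hm.2.2
    have h2 := hn.2.1
    have : ((m + 1 : ℕ) : ℝ) ≤ n := by exact_mod_cast hmn
    nlinarith
  rcases lt_trichotomy j k with h | h | h
  · exact absurd h (key j k hj hk)
  · exact h
  · exact absurd h (key k j hk hj)

theorem piece_exists {a δ b : ℝ} {M : ℕ} (hM : b ≤ a + M * δ) {J : Set ℝ}
    (hJ : J ⊆ Ioo a b) {x : ℝ} (hx : x ∈ J) : ∃ k ∈ Finset.range M, x ∈ piece a δ J k := by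
  induction M with
  | zero =>
    simp at hM
    have := hJ hx
    linarith [this.1, this.2]
  | succ M ih =>
    clear ih
    have key : ∀ m : ℕ, x < a + m * δ → ∃ k ∈ Finset.range m, x ∈ piece a δ J k := by
      intro m
      induction m with
      | zero => intro h; have := (hJ hx).1; simp at h; linarith
      | succ m ih =>
        intro h
        by_cases h' : x < a + m * δ
        · obtain ⟨k, hk, hk'⟩ := ih h'
          exact ⟨k, Finset.mem_range.2 (by have := Finset.mem_range.1 hk; omega), hk'⟩
        · exact ⟨m, Finset.mem_range.2 (by omega), hx, not_lt.1 h', h⟩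
    exact key _ ((hJ hx).2.trans_le hM)

theorem piece_indicator {a δ b : ℝ} (hδ : 0 < δ) {M : ℕ} (hM : b ≤ a + M * δ) {J : Set ℝ}
    (hJ : J ⊆ Ioo a b) (u : ℝ → ℂ) (x : ℝ) :
    J.indicator u x = ∑ k ∈ Finset.range M, (piece a δ J k).indicator u x := by
  by_cases hx : x ∈ J
  · obtain ⟨k, hk, hk'⟩ := piece_exists hM hJ hx
    rw [Finset.sum_eq_single_of_mem k hk, indicator_of_mem hx, indicator_of_mem hk']
    intro j _ hj
    exact indicator_of_notMem (fun h => hj (piece_unique hδ h hk')) _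
  · rw [indicator_of_notMem hx]
    symm
    exact Finset.sum_eq_zero fun k _ => indicator_of_notMem (fun h => hx h.1) _

theorem piece_evar {a δ : ℝ} (hδ : 0 < δ) (M : ℕ) (J : Set ℝ) (u : ℝ → ℂ) :
    ∑ k ∈ Finset.range M, eVariationOn u (piece a δ J k) ≤ eVariationOn u (J ∩ Iio (a + M * δ)) := by
  induction M with
  | zero => simp
  | succ M ih =>
    rw [Finset.sum_range_succ]
    refine (add_le_add_left ih _).trans ((eVariationOn.add_le_union u ?_).trans
      (eVariationOn.mono u ?_))
    · intro x hx y hy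
      exact (mem_Iio.1 hx.2).le.trans hy.2.1
    · rintro x (hx | hx)
      · refine ⟨hx.1, mem_Iio.2 (lt_of_lt_of_le (mem_Iio.1 hx.2) ?_)⟩
        push_cast; nlinarith
      · exact ⟨hx.1, hx.2.2⟩

theorem piece_volume {a δ : ℝ} {J : Set ℝ} (hJ : IsOpen J) {k : ℕ}
    (hne : (piece a δ J k).Nonempty) : volume (piece a δ J k) ≠ 0 := by
  obtain ⟨x, hxJ, hx⟩ := hne
  obtain ⟨e, he, hball⟩ := Metric.isOpen_iff.1 hJ x hxJ
  set y := min (x + e) (a + (k + 1 : ℕ) * δ) with hy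
  have hxy : x < y := lt_min (by linarith) hx.2
  have hsub : Ioo x y ⊆ piece a δ J k := by
    intro z hz
    refine ⟨hball ?_, hx.1.trans hz.1.le, hz.2.trans_le (min_le_right _ _)⟩
    rw [Metric.mem_ball, Real.dist_eq, abs_of_pos (by linarith [hz.1])]
    have := hz.2.trans_le (min_le_left _ _)
    linarith
  intro h0
  have := measure_mono_null hsub h0
  rw [Real.volume_Ioo, ENNReal.ofReal_eq_zero] at this
  linarith

end ly

section ly2

theorem norm_setAverage_le {u : ℝ → ℂ} {P : Set ℝ} {C : ℝ} (hC : 0 ≤ C) (ht : volume P < ⊤)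
    (hu : ∀ᵐ x ∂volume.restrict P, ‖u x‖ ≤ C) : ‖⨍ x in P, u x‖ ≤ C := by
  rw [setAverage_eq, norm_smul]
  have : IsFiniteMeasure (volume.restrict P) := ⟨by simpa using ht⟩
  have h1 := norm_integral_le_of_norm_le_const hu
  rw [measureReal_restrict_apply_univ] at h1
  rw [norm_inv, Real.norm_of_nonneg measureReal_nonneg]
  rcases (measureReal_nonneg (μ := volume) (s := P)).eq_or_lt with h0 | h0
  · rw [← h0]; simpa using hC
  · rw [inv_mul_le_iff₀ h0]; linarith

variable {F : PWUnimodal 2} {B : F.InvBranches}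
variable {V : Type} [NormedAddCommGroup V] [NormedSpace ℂ V] (R : BVRealization F.a F.b V)

theorem piece_measurable {a δ : ℝ} {J : Set ℝ} (hJ : IsOpen J) (k : ℕ) :
    MeasurableSet (piece a δ J k) := hJ.measurableSet.inter measurableSet_Ico

theorem piece_ordConnected {a δ : ℝ} {J : Set ℝ} (hJ : J.OrdConnected) (k : ℕ) :
    (piece a δ J k).OrdConnected := hJ.inter ordConnected_Ico

theorem piece_volume_lt {a δ : ℝ} {J : Set ℝ} (k : ℕ) :
    volume (piece a δ J k) < ⊤ :=
  (measure_mono inter_subset_right).trans_lt (by rw [Real.volume_Ico]; exact ENNReal.ofReal_lt_top)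

theorem BrSys.integrableOn {N : ℕ} (S : BrSys B N) {h : ℝ → ℂ} (hh : BoundedVariationOn h univ)
    (i : S.ι) (k : ℕ) (δ : ℝ) : IntegrableOn (fun x => h (S.ψ i x)) (piece F.a δ (S.J i) k) := by
  obtain ⟨C, _, hC⟩ := bv_bounded hh
  haveI : IsFiniteMeasure (volume.restrict (piece F.a δ (S.J i) k)) :=
    ⟨by rw [Measure.restrict_apply_univ]; exact piece_volume_lt k⟩
  refine Integrable.of_bound (μ := volume.restrict (piece F.a δ (S.J i) k)) ?_ C
    (Eventually.of_forall fun x => hC _)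
  refine AEMeasurable.aestronglyMeasurable ?_
  refine (bv_measurable hh).comp_aemeasurable ?_
  exact ((S.contOn i).mono inter_subset_left).aemeasurable (piece_measurable (S.isOpen i) k)

theorem BrSys.average_rep {N : ℕ} (S : BrSys B N) (φ : V) {h : ℝ → ℂ}
    (hh : {x | h x ≠ R.toFun φ x}.Countable) (i : S.ι) (k : ℕ) (δ : ℝ) :
    ∀ᵐ x ∂(volume.restrict (piece F.a δ (S.J i) k)), R.toFun φ (S.ψ i x) = h (S.ψ i x) := by
  have hc : {x | x ∈ S.J i ∧ S.ψ i x ∈ {x | h x ≠ R.toFun φ x}}.Countable := by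
    have : MapsTo (S.ψ i) {x | x ∈ S.J i ∧ S.ψ i x ∈ {x | h x ≠ R.toFun φ x}}
      {x | h x ≠ R.toFun φ x} := fun x hx => hx.2
    exact this.countable_of_injOn ((S.inj i).mono fun x hx => hx.1) hh
  rw [ae_restrict_iff' (piece_measurable (S.isOpen i) k)]
  refine countable_ae (hc.mono fun x hx => ?_)
  simp only [mem_ofPred_eq, Classical.not_imp] at hx
  exact ⟨hx.1.1, Ne.symm hx.2⟩

def BrSys.avg {N : ℕ} (S : BrSys B N) (δ : ℝ) (i : S.ι) (k : ℕ) : V →L[ℂ] ℂ :=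
  LinearMap.mkContinuous
    { toFun := fun φ => ⨍ x in piece F.a δ (S.J i) k, R.toFun φ (S.ψ i x)
      map_add' := fun φ φ' => by
        simp only [map_add, Pi.add_apply]
        rw [setAverage_eq, setAverage_eq, setAverage_eq, integral_add
          (S.integrableOn (R.bv φ) i k δ) (S.integrableOn (R.bv φ') i k δ), smul_add]
      map_smul' := fun z φ => by
        simp only [map_smul, Pi.smul_apply]
        rw [setAverage_eq, setAverage_eq, integral_smul, smul_comm]
        rfl } 1 (fun φ => by
      refine le_of_forall_pos_le_add fun e he => ?_
      obtain ⟨g, hg, hgv⟩ := R.exists_rep φ he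
      refine norm_setAverage_le (by positivity) (piece_volume_lt k) ?_
      filter_upwards [S.average_rep R φ hg i k δ] with x hx
      rw [hx, one_mul]
      have := (R.enorm_rep_le φ hg (S.ψ i x)).trans hgv
      rw [← ofReal_norm] at this
      exact (ENNReal.ofReal_le_ofReal_iff (by positivity)).1 this)

theorem BrSys.avg_apply {N : ℕ} (S : BrSys B N) (δ : ℝ) (i : S.ι) (k : ℕ) (φ : V) :
    S.avg R δ i k φ = ⨍ x in piece F.a δ (S.J i) k, R.toFun φ (S.ψ i x) := rfl

theorem ly_ineq {TL1 : V →L[ℂ] V}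
    (hTL1 : ∀ φ : V, {x | R.toFun (TL1 φ) x ≠ B.L1c (R.toFun φ) x}.Countable) (N : ℕ)
    {ε : ℝ} (hε : 0 < ε) :
    ∃ (κ : Type) (_ : Fintype κ) (Λ : V →L[ℂ] (κ → ℂ)),
      ∀ φ, ‖(TL1 ^ N) φ‖ ≤ (3 * F.G N + ε) * ‖φ‖ + ‖Λ φ‖ := by
  set S : BrSys B N := BrSys.mk' B N
  choose K hK using S.lip
  have hG0 : 0 < F.G N := uf_G_pos F N
  obtain ⟨δ, hδ, hδK⟩ : ∃ δ : ℝ, 0 < δ ∧ ∀ i, (K i : ℝ) * δ ≤ ε := by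
    have hs : 0 ≤ ∑ i, (K i : ℝ) := Finset.sum_nonneg fun i _ => (K i).2
    refine ⟨ε / (∑ i, (K i : ℝ) + 1), by positivity, fun i => ?_⟩
    have : (K i : ℝ) ≤ ∑ i, (K i : ℝ) :=
      Finset.single_le_sum (f := fun i => (K i : ℝ)) (fun i _ => (K i).2) (Finset.mem_univ i)
    rw [mul_div_assoc', div_le_iff₀ (by positivity)]
    nlinarith
  obtain ⟨M, hM⟩ : ∃ M : ℕ, F.b ≤ F.a + M * δ := by
    obtain ⟨M, hM⟩ := exists_nat_ge ((F.b - F.a) / δ)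
    refine ⟨M, ?_⟩
    rw [div_le_iff₀ hδ] at hM
    linarith
  set Cst : ℝ := (2 * F.G N + ε) * Fintype.card (S.ι × Fin M) with hCst
  refine ⟨S.ι × Fin M, inferInstance,
    ContinuousLinearMap.pi fun p => (Cst : ℂ) • S.avg R δ p.1 p.2, fun φ => ?_⟩
  -- the finite-dim part
  have hfin : (2 * F.G N + ε) * ∑ i, ∑ k ∈ Finset.range M, ‖S.avg R δ i k φ‖ ≤
      ‖ContinuousLinearMap.pi (fun p : S.ι × Fin M => (Cst : ℂ) • S.avg R δ p.1 p.2) φ‖ := by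
    have h1 : ∑ i, ∑ k ∈ Finset.range M, ‖S.avg R δ i k φ‖ =
        ∑ p : S.ι × Fin M, ‖S.avg R δ p.1 p.2 φ‖ := by
      rw [Fintype.sum_prod_type]
      refine Finset.sum_congr rfl fun i _ => ?_
      rw [Finset.sum_range]
    have hle : ∀ p : S.ι × Fin M, Cst * ‖S.avg R δ p.1 p.2 φ‖ ≤
        ‖ContinuousLinearMap.pi (fun p : S.ι × Fin M => (Cst : ℂ) • S.avg R δ p.1 p.2) φ‖ := by
      intro p
      have := norm_le_pi_norm
        (ContinuousLinearMap.pi (fun p : S.ι × Fin M => (Cst : ℂ) • S.avg R δ p.1 p.2) φ) p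
      refine le_trans (le_of_eq ?_) this
      simp only [ContinuousLinearMap.coe_pi', ContinuousLinearMap.smul_apply, norm_smul]
      rw [Complex.norm_real, Real.norm_of_nonneg (by positivity)]
    rw [h1]
    rcases isEmpty_or_nonempty (S.ι × Fin M) with hemp | hne
    · simp
    · have hcard : (0 : ℝ) < Fintype.card (S.ι × Fin M) := by exact_mod_cast Fintype.card_pos
      set T := ‖ContinuousLinearMap.pi (fun p : S.ι × Fin M => (Cst : ℂ) • S.avg R δ p.1 p.2) φ‖
      have hsum := Finset.sum_le_sum (s := (Finset.univ : Finset (S.ι × Fin M))) fun p _ => hle p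
      rw [← Finset.mul_sum, Finset.sum_const, Finset.card_univ, nsmul_eq_mul, hCst] at hsum
      have : (Fintype.card (S.ι × Fin M) : ℝ) *
          ((2 * F.G N + ε) * ∑ p : S.ι × Fin M, ‖S.avg R δ p.1 p.2 φ‖) ≤
          (Fintype.card (S.ι × Fin M) : ℝ) * T := by linarith
      exact le_of_mul_le_mul_left this hcard
  refine le_of_forall_pos_le_add fun e' he' => ?_
  set e : ℝ := e' / (3 * F.G N + ε) with he
  have hepos : 0 < e := by positivity
  obtain ⟨g, hg, hgv⟩ := R.exists_rep φ hepos
  have hgtop : eVariationOn g univ ≠ ⊤ := ne_top_of_le_ne_top ENNReal.ofReal_ne_top hgv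
  set Sg := ∑ i, ∑ k ∈ Finset.range M, ‖S.avg R δ i k φ‖ with hSg
  have hSg0 : 0 ≤ Sg := Finset.sum_nonneg fun i _ => Finset.sum_nonneg fun k _ => norm_nonneg _
  have main : ‖(TL1 ^ N) φ‖ ≤ (3 * F.G N + ε) * (‖φ‖ + e) + (2 * F.G N + ε) * Sg := by
    refine R.norm_le _ (TL1_pow_form R hTL1 S φ hg) (by positivity) ?_
    have hpc : ∀ i, ∀ k, eVariationOn ((piece F.a δ (S.J i) k).indicator
        (fun x => (S.g i x : ℂ) * g (S.ψ i x))) univ ≤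
        (3 * ENNReal.ofReal (F.G N) + ENNReal.ofReal ε) *
          eVariationOn (g ∘ S.ψ i) (piece F.a δ (S.J i) k) +
        (2 * ENNReal.ofReal (F.G N) + ENNReal.ofReal ε) * ‖S.avg R δ i k φ‖ₑ := by
      intro i k
      have havg : S.avg R δ i k φ = ⨍ x in piece F.a δ (S.J i) k, g (S.ψ i x) := by
        rw [BrSys.avg_apply, setAverage_eq, setAverage_eq]
        congr 1
        exact integral_congr_ae (S.average_rep R φ hg i k δ)
      rw [havg]
      refine evar_piece_le (fun x => (S.g i x : ℂ)) (fun x => g (S.ψ i x))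
        (piece_ordConnected (S.ord i) k) (piece_measurable (S.isOpen i) k)
        (S.integrableOn hgtop i k δ) (piece_volume (S.isOpen i)) (piece_volume_lt k).ne ?_ ?_ ?_
      · refine ne_top_of_le_ne_top hgtop (le_trans ?_ (S.var g))
        refine (eVariationOn.mono _ inter_subset_left).trans ?_
        exact Finset.single_le_sum (f := fun i => eVariationOn (g ∘ S.ψ i) (S.J i))
          (fun _ _ => zero_le) (Finset.mem_univ i)
      · intro x hx
        rw [← ofReal_norm, Complex.norm_real, S.gval i x hx.1, Real.norm_of_nonneg (by positivity)]
        exact ENNReal.ofReal_le_ofReal (uf_dn_inv_le F N (S.maps i hx.1))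
      · have hl1 : LipschitzOnWith (K i) (fun x => (S.g i x : ℂ)) (S.J i) := by
          intro x hx y hy
          have := hK i hx hy
          rwa [Complex.isometry_ofReal.edist_eq]
        have h2 := hl1.comp_eVariationOn_le (g := id) (s := piece F.a δ (S.J i) k)
          (fun x hx => hx.1)
        refine h2.trans ?_
        have h3 : eVariationOn (id : ℝ → ℝ) (piece F.a δ (S.J i) k) ≤ ENNReal.ofReal δ := by
          refine (eVariationOn.mono id (inter_subset_right.trans Ico_subset_Icc_self)).trans ?_
          rw [eVariationOn_id_Icc]
          refine le_of_eq ?_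
          congr 1; push_cast; ring
        refine (mul_le_mul_right h3 _).trans ?_
        rw [← ENNReal.ofReal_coe_nnreal, ← ENNReal.ofReal_mul (NNReal.coe_nonneg (K i))]
        exact ENNReal.ofReal_le_ofReal (hδK i)
    have hsplit : (fun x => ∑ i, (S.J i).indicator (fun x => (S.g i x : ℂ) * g (S.ψ i x)) x) =
        fun x => ∑ i, (∑ k ∈ Finset.range M, (piece F.a δ (S.J i) k).indicator
          (fun x => (S.g i x : ℂ) * g (S.ψ i x)) x) := by
      funext x
      exact Finset.sum_congr rfl fun i _ => piece_indicator hδ hM (S.sub i) _ x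
    rw [hsplit]
    calc _ ≤ ∑ i, ∑ k ∈ Finset.range M, eVariationOn ((piece F.a δ (S.J i) k).indicator
        (fun x => (S.g i x : ℂ) * g (S.ψ i x))) univ :=
          (evar_sum_le _ _ _).trans (Finset.sum_le_sum fun i _ => evar_sum_le _ _ _)
      _ ≤ ∑ i, ∑ k ∈ Finset.range M, ((3 * ENNReal.ofReal (F.G N) + ENNReal.ofReal ε) *
          eVariationOn (g ∘ S.ψ i) (piece F.a δ (S.J i) k) +
        (2 * ENNReal.ofReal (F.G N) + ENNReal.ofReal ε) * ‖S.avg R δ i k φ‖ₑ) :=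
          Finset.sum_le_sum fun i _ => Finset.sum_le_sum fun k _ => hpc i k
      _ = (3 * ENNReal.ofReal (F.G N) + ENNReal.ofReal ε) *
          (∑ i, ∑ k ∈ Finset.range M, eVariationOn (g ∘ S.ψ i) (piece F.a δ (S.J i) k)) +
          (2 * ENNReal.ofReal (F.G N) + ENNReal.ofReal ε) *
          (∑ i, ∑ k ∈ Finset.range M, ‖S.avg R δ i k φ‖ₑ) := by
          simp only [Finset.sum_add_distrib, Finset.mul_sum]
      _ ≤ (3 * ENNReal.ofReal (F.G N) + ENNReal.ofReal ε) * ENNReal.ofReal (‖φ‖ + e) +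
          (2 * ENNReal.ofReal (F.G N) + ENNReal.ofReal ε) * ENNReal.ofReal Sg := by
          gcongr
          · refine le_trans (le_trans (Finset.sum_le_sum fun i _ => ?_) (S.var g)) hgv
            exact (piece_evar hδ M _ _).trans (eVariationOn.mono _ inter_subset_left)
          · rw [hSg, ENNReal.ofReal_sum_of_nonneg
              (fun i _ => Finset.sum_nonneg fun k _ => norm_nonneg _)]
            refine Finset.sum_le_sum fun i _ => ?_
            rw [ENNReal.ofReal_sum_of_nonneg (fun i _ => norm_nonneg _)]
            refine Finset.sum_le_sum fun k _ => ?_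
            rw [ofReal_norm]
      _ = _ := by
          have hG := (uf_G_pos F N).le
          have e3 : ENNReal.ofReal (3 * F.G N + ε) =
              3 * ENNReal.ofReal (F.G N) + ENNReal.ofReal ε := by
            rw [ENNReal.ofReal_add (by positivity) hε.le, ENNReal.ofReal_mul (by norm_num)]; simp
          have e2 : ENNReal.ofReal (2 * F.G N + ε) =
              2 * ENNReal.ofReal (F.G N) + ENNReal.ofReal ε := by
            rw [ENNReal.ofReal_add (by positivity) hε.le, ENNReal.ofReal_mul (by norm_num)]; simp
          rw [← e3, ← e2, ← ENNReal.ofReal_mul (by positivity), ← ENNReal.ofReal_mul (by positivity),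
            ← ENNReal.ofReal_add (by positivity) (by positivity)]
  refine main.trans ?_
  have h5 : (3 * F.G N + ε) * e = e' := by rw [he]; field_simp
  rw [mul_add, h5]
  linarith

/-- quasi-compactness data for every `r > lam0`. -/
theorem ly_choose {lam0 : ℝ} (hlam0 : Filter.Tendsto
      (fun n : ℕ => (sInf ((fun x => |F.dn n x|) '' Set.Icc F.a F.b))⁻¹ ^ ((n : ℝ)⁻¹))
      Filter.atTop (nhds lam0)) {r : ℝ} (hr : lam0 < r) :
    ∃ (N : ℕ) (ε : ℝ), 0 < ε ∧ 8 * (3 * F.G N + ε) < r ^ N := by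
  obtain ⟨h0, h1, h2⟩ := uf_lam0 F hlam0
  set r' := (lam0 + r) / 2 with hr'
  have hrp : 0 < r := by linarith
  have hq : Tendsto (fun n : ℕ => (r' / r) ^ n) atTop (𝓝 0) :=
    tendsto_pow_atTop_nhds_zero_of_lt_one (by positivity) (by rw [div_lt_one hrp]; linarith)
  have hq' := hq.eventually_lt_const (show (0:ℝ) < 1/48 by norm_num)
  obtain ⟨N, hN1, hN2⟩ := (hq'.and (h2 r' (by linarith))).exists
  rw [div_pow, div_lt_iff₀ (by positivity)] at hN1
  have : 0 < r ^ N := by positivity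
  exact ⟨N, r ^ N / 32, by positivity, by linarith⟩

end ly2

section parti
variable {F : PWUnimodal 2} {B : F.InvBranches}
variable {V : Type} [NormedAddCommGroup V] [NormedSpace ℂ V] [CompleteSpace V]
  (R : BVRealization F.a F.b V)

theorem part_i {TL1 : V →L[ℂ] V}
    (hTL1 : ∀ φ : V, {x | R.toFun (TL1 φ) x ≠ B.L1c (R.toFun φ) x}.Countable)
    {lam0 : ℝ} (hlam0 : Filter.Tendsto
      (fun n : ℕ => (sInf ((fun x => |F.dn n x|) '' Set.Icc F.a F.b))⁻¹ ^ ((n : ℝ)⁻¹))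
      Filter.atTop (nhds lam0)) :
    ∀ z ∈ spectrum ℂ TL1, lam0 < ‖z‖ →
      (∃ U ∈ nhds z, spectrum ℂ TL1 ∩ U = {z}) ∧
      Module.End.HasEigenvalue (TL1 : V →ₗ[ℂ] V) z ∧
      FiniteDimensional ℂ (Module.End.maxGenEigenspace (TL1 : V →ₗ[ℂ] V) z) := by
  intro z hz hlz
  obtain ⟨h0, _, _⟩ := uf_lam0 F hlam0
  obtain ⟨r, hr1, hr2⟩ := exists_between hlz
  obtain ⟨N, ε, hε, hN⟩ := ly_choose hlam0 hr1
  obtain ⟨κ, _, Λ, hLY⟩ := ly_ineq R hTL1 N hε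
  have hα : 0 ≤ 3 * F.G N + ε := by have := uf_G_pos F N; positivity
  have hr0 : 0 ≤ r := by linarith
  have hfin := qc_eig_finite TL1 Λ hLY hα hr0 hN
  refine ⟨?_, qc_eigen TL1 Λ hLY hα hr0 hN z hr2.le hz, qc_gen_finite TL1 Λ hLY hα hr0 hN z hr2.le⟩
  set S := {z : ℂ | r ≤ ‖z‖ ∧ Module.End.HasEigenvalue (TL1 : V →ₗ[ℂ] V) z}
  refine ⟨{w | r < ‖w‖} ∩ (S \ {z})ᶜ, ?_, ?_⟩
  · refine inter_mem ((isOpen_lt continuous_const continuous_norm).mem_nhds hr2) ?_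
    exact (hfin.diff.isClosed.isOpen_compl).mem_nhds (by simp)
  · ext w
    constructor
    · rintro ⟨hw, hw1, hw2⟩
      by_contra hne
      exact hw2 ⟨⟨le_of_lt hw1, qc_eigen TL1 Λ hLY hα hr0 hN w (le_of_lt hw1) hw⟩, hne⟩
    · rintro rfl
      exact ⟨hz, hr2, by simp⟩

end parti

section integral
variable {F : PWUnimodal 2} (B : F.InvBranches)

theorem br_image_p {x : ℝ} (hx : x ∈ Icc F.a (F.f F.c)) :
    B.ψp '' (Ioo x (F.f F.c)) = Ioo (B.ψp x) F.c := by
  ext y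
  constructor
  · rintro ⟨t, ht, rfl⟩
    refine ⟨br_ψp_mono B hx ⟨hx.1.trans ht.1.le, ht.2.le⟩ ht.1, ?_⟩
    rw [← br_ψp_c1 B]
    exact br_ψp_mono B ⟨hx.1.trans ht.1.le, ht.2.le⟩ ⟨(uf_a_lt_c1 F).le, le_rfl⟩ ht.2
  · rintro ⟨h1, h2⟩
    have h3 := B.inv_p x hx
    have hy : y ∈ Icc F.a F.c := ⟨h3.1.1.trans h1.le, h2.le⟩
    refine ⟨F.f y, ⟨?_, ?_⟩, br_ψp_f B hy⟩
    · rw [← h3.2]; exact F.mono h3.1 hy h1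
    · exact F.mono hy ⟨F.hac.le, le_rfl⟩ h2

theorem br_image_m {x : ℝ} (hx : x ∈ Icc F.a (F.f F.c)) :
    B.ψm '' (Ioo x (F.f F.c)) = Ioo F.c (B.ψm x) := by
  ext y
  constructor
  · rintro ⟨t, ht, rfl⟩
    refine ⟨?_, br_ψm_anti B hx ⟨hx.1.trans ht.1.le, ht.2.le⟩ ht.1⟩
    rw [← br_ψm_c1 B]
    exact br_ψm_anti B ⟨hx.1.trans ht.1.le, ht.2.le⟩ ⟨(uf_a_lt_c1 F).le, le_rfl⟩ ht.2
  · rintro ⟨h1, h2⟩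
    have h3 := B.inv_m x hx
    have hy : y ∈ Icc F.c F.b := ⟨h1.le, h2.le.trans h3.1.2⟩
    refine ⟨F.f y, ⟨?_, ?_⟩, br_ψm_f B hy⟩
    · rw [← h3.2]; exact F.anti hy h3.1 h2
    · exact F.anti ⟨le_rfl, F.hcb.le⟩ hy h1

theorem br_cov (s : Bool) {x : ℝ} (hx : x ∈ Icc F.a (F.f F.c)) {h : ℝ → ℂ} (hh : Integrable h) :
    IntegrableOn (fun t => ((|deriv (B.br s) t| : ℝ) : ℂ) * h (B.br s t)) (Ioo x (F.f F.c)) ∧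
    ∫ t in Ioo x (F.f F.c), ((|deriv (B.br s) t| : ℝ) : ℂ) * h (B.br s t) =
      ∫ t in B.br s '' Ioo x (F.f F.c), h t := by
  have hd : ∀ t ∈ Ioo x (F.f F.c),
      HasDerivWithinAt (B.br s) (deriv (B.br s) t) (Ioo x (F.f F.c)) t :=
    fun t ht => (br_hasDerivAt B s ht.2).hasDerivWithinAt
  have hi : InjOn (B.br s) (Ioo x (F.f F.c)) :=
    (br_injOn B s).mono (fun t ht => (⟨hx.1.trans ht.1.le, ht.2.le⟩ : t ∈ Icc F.a (F.f F.c)))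
  constructor
  · have := (integrableOn_image_iff_integrableOn_abs_deriv_smul measurableSet_Ioo hd hi h).1
      hh.integrableOn
    simpa [Complex.real_smul] using this
  · rw [integral_image_eq_integral_abs_deriv_smul measurableSet_Ioo hd hi h]
    simp [Complex.real_smul]

theorem P1_integral_Ioo {x : ℝ} (hx : x ∈ Icc F.a (F.f F.c)) {h : ℝ → ℂ} (hh : Integrable h) :
    ∫ t in Ioo x (F.f F.c), B.P1 h t = ∫ t in Ioc (B.ψp x) (B.ψm x), h t := by
  have h1 : ∫ t in Ioo x (F.f F.c), B.P1 h t = ∫ t in Ioo x (F.f F.c),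
      ∑ s : Bool, ((|deriv (B.br s) t| : ℝ) : ℂ) * h (B.br s t) :=
    setIntegral_congr_fun measurableSet_Ioo fun t ht => P1_of_mem B h ⟨hx.1.trans_lt ht.1, ht.2⟩
  rw [h1, integral_finsetSum _ (fun s _ => (br_cov B s hx hh).1)]
  simp only [(br_cov B _ hx hh).2, Fintype.sum_bool]
  have e1 : B.br true '' Ioo x (F.f F.c) = Ioo (B.ψp x) F.c := br_image_p B hx
  have e2 : B.br false '' Ioo x (F.f F.c) = Ioo F.c (B.ψm x) := br_image_m B hx
  rw [e1, e2, ← integral_Ioc_eq_integral_Ioo, ← integral_Ioc_eq_integral_Ioo,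
    ← Ioc_union_Ioc_eq_Ioc (B.inv_p x hx).1.2 (B.inv_m x hx).1.1,
    setIntegral_union (Ioc_disjoint_Ioc_of_le le_rfl) measurableSet_Ioc hh.integrableOn hh.integrableOn]

theorem P1_integrable {h : ℝ → ℂ} (hh : Integrable h) : Integrable (B.P1 h) := by
  have h0 : F.a ∈ Icc F.a (F.f F.c) := ⟨le_rfl, (uf_a_lt_c1 F).le⟩
  have : B.P1 h = (Ioo F.a (F.f F.c)).indicator
    (fun x => ∑ s : Bool, ((|deriv (B.br s) x| : ℝ) : ℂ) * h (B.br s x)) := rfl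
  rw [this, integrable_indicator_iff measurableSet_Ioo]
  exact integrable_finsetSum _ (fun s _ => (br_cov B s h0 hh).1)

theorem P1_integral {h : ℝ → ℂ} (hh : Integrable h) (hs : Function.support h ⊆ Icc F.a F.b) :
    ∫ t, B.P1 h t = ∫ t, h t := by
  have h0 : F.a ∈ Icc F.a (F.f F.c) := ⟨le_rfl, (uf_a_lt_c1 F).le⟩
  have h1 : ∫ t, B.P1 h t = ∫ t in Ioo F.a (F.f F.c), B.P1 h t := by
    rw [setIntegral_eq_integral_of_forall_compl_eq_zero]
    intro x hx
    exact P1_of_notMem B h hx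
  rw [h1, P1_integral_Ioo B h0 hh, br_ψp_a, br_ψm_a, ← integral_Icc_eq_integral_Ioc,
    setIntegral_eq_integral_of_forall_compl_eq_zero]
  intro x hx
  by_contra hne
  exact hx (hs hne)

/-- integrals over `(x,b]` of a function vanishing beyond. -/
theorem setIntegral_P1_Ioc {x : ℝ} (hx : x ∈ Icc F.a (F.f F.c)) {h : ℝ → ℂ} (hh : Integrable h) :
    ∫ t in Ioc x F.b, B.P1 h t = ∫ t in Ioc (B.ψp x) (B.ψm x), h t := by
  rw [← P1_integral_Ioo B hx hh, ← integral_Ioc_eq_integral_Ioo]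
  have h0 : ∫ t in Ioc (F.f F.c) F.b, B.P1 h t = 0 := by
    rw [setIntegral_congr_fun measurableSet_Ioc (g := fun _ => (0:ℂ))
      (fun t ht => P1_of_notMem B h fun h' => absurd h'.2 (not_lt.2 ht.1.le))]
    simp
  rw [← Ioc_union_Ioc_eq_Ioc hx.2 (uf_c1_le_b F),
    setIntegral_union (Ioc_disjoint_Ioc_of_le le_rfl) measurableSet_Ioc
      (P1_integrable B hh).integrableOn (P1_integrable B hh).integrableOn, h0, add_zero]

end integral

section partiv
variable {F : PWUnimodal 2} {B : F.InvBranches}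
variable {V : Type} [NormedAddCommGroup V] [NormedSpace ℂ V] (R : BVRealization F.a F.b V)
variable {W : Type} [NormedAddCommGroup W] [NormedSpace ℂ W] (R1 : BV1Realization F.a F.b W)

theorem R1_inj {w w' : W} (h : ∀ x, R1.toFun w x = R1.toFun w' x) : w = w' := by
  rw [← sub_eq_zero]
  apply R1.inj
  funext x
  simp [h x]

def Dfun (v : V) : W := (R1.surj (R.toFun v) (R.bv v) (R.supp v)).choose

theorem Dfun_spec (v : V) (x : ℝ) :
    R1.toFun (Dfun R R1 v) x = -∫ t in Set.Ioc x F.b, R.toFun v t :=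
  (R1.surj (R.toFun v) (R.bv v) (R.supp v)).choose_spec x

def Dlin : V →ₗ[ℂ] W where
  toFun := Dfun R R1
  map_add' v v' := by
    apply R1_inj R1
    intro x
    rw [map_add, Pi.add_apply, Dfun_spec, Dfun_spec, Dfun_spec, map_add]
    simp only [Pi.add_apply]
    rw [integral_add (R.integrable v).integrableOn (R.integrable v').integrableOn]
    ring
  map_smul' z v := by
    apply R1_inj R1
    intro x
    rw [map_smul, Pi.smul_apply, Dfun_spec, RingHom.id_apply, map_smul, Dfun_spec]
    simp only [Pi.smul_apply]
    rw [integral_smul]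
    simp

theorem Dlin_spec (v : V) (x : ℝ) :
    R1.toFun (Dlin R R1 v) x = -∫ t in Set.Ioc x F.b, R.toFun v t := Dfun_spec R R1 v x

theorem Dlin_inj : Function.Injective (Dlin R R1) := by
  rw [injective_iff_map_eq_zero]
  intro v hv
  rw [R.zero_iff]
  refine ((bv_countable_disc (R.bv v)).mono ?_)
  intro x hx hcont
  apply hx
  have h0 : ∀ u, ∫ t in u..F.b, R.toFun v t = 0 := by
    intro u
    rcases le_total u F.b with hu | hu
    · rw [intervalIntegral.integral_of_le hu]
      have := Dlin_spec R R1 v u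
      rw [hv] at this
      simpa using this
    · rw [intervalIntegral.integral_of_ge hu, setIntegral_congr_fun measurableSet_Ioc
        (g := fun _ => (0:ℂ)) (fun t ht => R.zero_of_notMem v fun h' => absurd h'.2 (not_le.2 ht.1))]
      simp
  have h1 := intervalIntegral.integral_hasDerivAt_left (a := x) (b := F.b)
    ((R.integrable v).intervalIntegrable)
    ((bv_measurable (R.bv v)).stronglyMeasurable.stronglyMeasurableAtFilter) hcont
  simp only [h0] at h1
  have := h1.unique (hasDerivAt_const x (0:ℂ))
  simpa using this

theorem Dlin_surj : Function.Surjective (Dlin R R1) := by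
  intro w
  obtain ⟨g, hg, hs, hgw⟩ := R1.deriv_bv w
  obtain ⟨v, hv⟩ := R.surj g hg hs
  refine ⟨v, R1_inj R1 fun x => ?_⟩
  rw [Dlin_spec, hgw]
  congr 1
  refine integral_congr_ae (ae_restrict_of_ae ?_)
  exact countable_ae hv

theorem R1_const (w : W) {x : ℝ} (hx : x ≤ F.a) : R1.toFun w x = R1.toFun w F.a := by
  obtain ⟨g, hg, hs, hgw⟩ := R1.deriv_bv w
  have hgi := bv_integrable hg hs
  rw [hgw, hgw, ← Ioc_union_Ioc_eq_Ioc hx (F.hac.trans F.hcb).le,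
    setIntegral_union (Ioc_disjoint_Ioc_of_le le_rfl) measurableSet_Ioc
      hgi.integrableOn hgi.integrableOn]
  have : ∫ t in Ioc x F.a, g t = 0 := by
    rw [integral_Ioc_eq_integral_Ioo, setIntegral_congr_fun measurableSet_Ioo
        (g := fun _ => (0:ℂ))]
    · simp
    · intro t ht
      by_contra hne
      exact absurd (hs hne).1 (not_le.2 ht.2)
  rw [this, zero_add]

theorem Dlin_intertwine {TL1 : V →L[ℂ] V} {TL0' : W →L[ℂ] W}
    (hTL1 : ∀ φ : V, {x | R.toFun (TL1 φ) x ≠ B.L1c (R.toFun φ) x}.Countable)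
    (hTL0' : ∀ (φ : W) (x : ℝ), R1.toFun (TL0' φ) x = B.L0c (R1.toFun φ) x) (v : V) :
    Dlin R R1 (TL1 v) = TL0' (Dlin R R1 v) := by
  have hP : ∀ x, R1.toFun (Dlin R R1 (TL1 v)) x = -∫ t in Ioc x F.b, B.P1 (R.toFun v) t := by
    intro x
    rw [Dlin_spec]
    congr 1
    exact integral_congr_ae (ae_restrict_of_ae (countable_ae (TL1_P1 B R hTL1 v)))
  have hmain : ∀ x, F.a ≤ x → R1.toFun (Dlin R R1 (TL1 v)) x = R1.toFun (TL0' (Dlin R R1 v)) x := by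
    intro x hx
    rw [hP, hTL0', PWUnimodal.InvBranches.L0c]
    rcases le_or_gt x (F.f F.c) with h1 | h1
    · rw [setIntegral_P1_Ioc B ⟨hx, h1⟩ (R.integrable v)]
      rcases h1.lt_or_eq with h2 | h2
      · have hp := (B.inv_p x ⟨hx, h1⟩).1
        have hm := (B.inv_m x ⟨hx, h1⟩).1
        rw [Dlin_spec, Dlin_spec, ← Ioc_union_Ioc_eq_Ioc (hp.2.trans hm.1) hm.2,
          setIntegral_union (Ioc_disjoint_Ioc_of_le le_rfl) measurableSet_Ioc
            (R.integrable v).integrableOn (R.integrable v).integrableOn]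
        simp [PWUnimodal.χ, h2]
      · subst h2
        rw [br_ψp_c1, br_ψm_c1]
        simp
    · have : ∫ t in Ioc x F.b, B.P1 (R.toFun v) t = 0 := by
        rw [setIntegral_congr_fun measurableSet_Ioc (g := fun _ => (0:ℂ))
          (fun t ht => P1_of_notMem B _ fun h' => by linarith [h'.2, ht.1])]
        simp
      rw [this]
      simp [PWUnimodal.χ, not_lt.2 h1.le, h1.ne']
  apply R1_inj R1
  intro x
  rcases le_total F.a x with h | h
  · exact hmain x h
  · rw [R1_const R1 _ h, R1_const R1 (TL0' _) h, hmain _ le_rfl]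

theorem part_iv [CompleteSpace V] [CompleteSpace W] {TL1 : V →L[ℂ] V} {TL0' : W →L[ℂ] W}
    (hTL1 : ∀ φ : V, {x | R.toFun (TL1 φ) x ≠ B.L1c (R.toFun φ) x}.Countable)
    (hTL0' : ∀ (φ : W) (x : ℝ), R1.toFun (TL0' φ) x = B.L0c (R1.toFun φ) x) :
    spectrum ℂ TL0' = spectrum ℂ TL1 := by
  let e : V ≃ₗ[ℂ] W := LinearEquiv.ofBijective (Dlin R R1) ⟨Dlin_inj R R1, Dlin_surj R R1⟩
  rw [ContinuousLinearMap.spectrum_eq, ContinuousLinearMap.spectrum_eq,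
    ← AlgEquiv.spectrum_eq (e.conjAlgEquiv ℂ) (TL1 : V →ₗ[ℂ] V)]
  congr 1
  ext w
  obtain ⟨v, rfl⟩ := e.surjective w
  simp only [LinearEquiv.conjAlgEquiv_apply_apply, LinearEquiv.symm_apply_apply]
  exact (Dlin_intertwine R R1 hTL1 hTL0' v).symm

end partiv

section partiii
variable {F : PWUnimodal 2} {B : F.InvBranches}
variable {V : Type} [NormedAddCommGroup V] [NormedSpace ℂ V] (R : BVRealization F.a F.b V)

/-- `L₀` in normalised form. -/
theorem TL0_form {TL0 : V →L[ℂ] V}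
    (hTL0 : ∀ φ : V, {x | R.toFun (TL0 φ) x ≠ B.L0c (R.toFun φ) x}.Countable) (φ : V)
    {g g' : ℝ → ℂ} (hg : {x | g x ≠ R.toFun φ x}.Countable)
    (h1 : ∀ x < F.a, g' x = 0) (h2 : ∀ x ∈ Ioo F.a (F.f F.c), g' x = g (B.ψp x) - g (B.ψm x))
    (h3 : ∀ x, F.f F.c < x → g' x = 0) : {x | g' x ≠ R.toFun (TL0 φ) x}.Countable := by
  refine ((((hTL0 φ).union ((countable_singleton F.a).union (countable_singleton (F.f F.c)))).union
    (br_preimage_countable B true hg)).union (br_preimage_countable B false hg)).mono ?_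
  intro x hx
  by_contra hcon
  simp only [mem_union, not_or, mem_singleton_iff] at hcon
  obtain ⟨⟨⟨c1, c2, c3⟩, c4⟩, c5⟩ := hcon
  have c1' : R.toFun (TL0 φ) x = B.L0c (R.toFun φ) x := by
    by_contra hne; exact c1 hne
  apply hx
  rcases lt_or_ge x F.a with ha | ha
  · rw [h1 x ha, R.zero_of_notMem _ (fun h => absurd h.1 (not_le.2 ha))]
  have ha' : F.a < x := lt_of_le_of_ne ha (Ne.symm c2)
  rw [c1']
  rcases lt_or_ge x (F.f F.c) with hc | hc
  · have hI : x ∈ Icc F.a (F.f F.c) := ⟨ha, hc.le⟩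
    have e1 : g (B.ψp x) = R.toFun φ (B.ψp x) := by
      by_contra hne; exact c4 ⟨hI, hne⟩
    have e2 : g (B.ψm x) = R.toFun φ (B.ψm x) := by
      by_contra hne; exact c5 ⟨hI, hne⟩
    rw [h2 x ⟨ha', hc⟩, e1, e2]
    simp [PWUnimodal.InvBranches.L0c, PWUnimodal.χ, hc]
  · have hc' : F.f F.c < x := lt_of_le_of_ne hc (Ne.symm c3)
    rw [h3 x hc']
    simp [PWUnimodal.InvBranches.L0c, PWUnimodal.χ, not_lt.2 hc, c3]

theorem TL0_norm {TL0 : V →L[ℂ] V}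
    (hTL0 : ∀ φ : V, {x | R.toFun (TL0 φ) x ≠ B.L0c (R.toFun φ) x}.Countable) : ‖TL0‖ ≤ 1 := by
  refine TL0.opNorm_le_bound zero_le_one fun φ => ?_
  rw [one_mul]
  refine le_of_forall_pos_le_add fun ε hε => ?_
  obtain ⟨g, hg, hgv⟩ := R.exists_rep φ hε
  obtain ⟨x0, hx0, hg0⟩ := R.exists_zero φ hg (not_countable_Iio F.a)
    (fun x hx h => absurd h.1 (not_le.2 hx))
  obtain ⟨x1, hx1, hg1⟩ := R.exists_zero φ hg (not_countable_Ioi F.b)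
    (fun x hx h => absurd h.2 (not_le.2 hx))
  rw [mem_Iio] at hx0
  rw [mem_Ioi] at hx1
  have hac1 := uf_a_lt_c1 F
  set p : ℝ → ℝ := fun x => if x < F.a then x0 else B.ψp (min x (F.f F.c)) with hp
  set m : ℝ → ℝ := fun x => if x < F.a then x1 else B.ψm (min x (F.f F.c)) with hm
  have hI : ∀ x, ¬ x < F.a → min x (F.f F.c) ∈ Icc F.a (F.f F.c) := fun x hx =>
    ⟨le_min (not_lt.1 hx) hac1.le, min_le_right _ _⟩
  have hpm : Monotone p := by
    intro x y hxy
    simp only [hp]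
    by_cases hy : y < F.a
    · simp [hy, hxy.trans_lt hy]
    · by_cases hx : x < F.a
      · simp only [hx, hy, if_true, if_false]
        exact hx0.le.trans (B.inv_p _ (hI y hy)).1.1
      · simp only [hx, hy, if_false]
        exact (br_ψp_mono B).monotoneOn (hI x hx) (hI y hy) (min_le_min_right _ hxy)
  have hmm : Antitone m := by
    intro x y hxy
    simp only [hm]
    by_cases hy : y < F.a
    · simp [hy, hxy.trans_lt hy]
    · by_cases hx : x < F.a
      · simp only [hx, hy, if_true, if_false]
        exact (B.inv_m _ (hI y hy)).1.2.trans hx1.le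
      · simp only [hx, hy, if_false]
        exact (br_ψm_anti B).antitoneOn (hI x hx) (hI y hy) (min_le_min_right _ hxy)
  have hpc : MapsTo p univ (Iic F.c) := by
    intro x _
    simp only [hp, mem_Iic]
    split_ifs with hx
    · exact (hx0.trans F.hac).le
    · exact (B.inv_p _ (hI x hx)).1.2
  have hmc : MapsTo m univ (Ici F.c) := by
    intro x _
    simp only [hm, mem_Ici]
    split_ifs with hx
    · exact (F.hcb.trans hx1).le
    · exact (B.inv_m _ (hI x hx)).1.1
  refine R.norm_le (TL0 φ) (g := fun x => g (p x) + (-1) * g (m x)) ?_ (by positivity) ?_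
  · refine TL0_form R hTL0 φ hg ?_ ?_ ?_
    · intro x hx
      simp [hp, hm, hx, hg0, hg1]
    · intro x hx
      simp [hp, hm, not_lt.2 hx.1.le, min_eq_left hx.2.le]
      ring
    · intro x hx
      simp [hp, hm, not_lt.2 (hac1.trans hx).le, min_eq_right hx.le, br_ψp_c1, br_ψm_c1]
  · have k1 : eVariationOn (g ∘ p) univ ≤ eVariationOn g (Iic F.c) :=
      eVariationOn.comp_le_of_monotoneOn g p (hpm.monotoneOn _) hpc
    have k2 : eVariationOn (g ∘ m) univ ≤ eVariationOn g (Ici F.c) :=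
      eVariationOn.comp_le_of_antitoneOn g m (hmm.antitoneOn _) hmc
    have k3 : eVariationOn (fun x => (-1) * (g ∘ m) x) univ ≤ eVariationOn (g ∘ m) univ := by
      have := evar_const_smul (-1) (g ∘ m) univ
      rwa [enorm_neg, enorm_one, one_mul] at this
    have k4 := evar_add_le (g ∘ p) (fun x => (-1) * (g ∘ m) x) univ
    have k5 : eVariationOn g (Iic F.c) + eVariationOn g (Ici F.c) = eVariationOn g univ := by
      rw [← eVariationOn.union g (isGreatest_Iic) (isLeast_Ici), Iic_union_Ici]
    refine le_trans (le_trans k4 ?_) hgv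
    rw [← k5]
    exact add_le_add k1 (k3.trans k2)

theorem TL0_eig {TL0 : V →L[ℂ] V}
    (hTL0 : ∀ φ : V, {x | R.toFun (TL0 φ) x ≠ B.L0c (R.toFun φ) x}.Countable) :
    ∃ φ : V, φ ≠ 0 ∧ TL0 φ = φ := by
  have hcont : ContinuousOn (fun x => F.f x - x) (Icc F.c F.b) :=
    (F.cont.mono (Icc_subset_Icc_left F.hac.le)).sub continuousOn_id
  have h0 : (0:ℝ) ∈ Ioo (F.f F.b - F.b) (F.f F.c - F.c) := by
    rw [F.fb]
    exact ⟨by linarith [F.hac, F.hcb], by linarith [uf_c_lt_c1 F]⟩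
  obtain ⟨p, hp, hfp⟩ := intermediate_value_Ioo' F.hcb.le hcont h0
  have hfp : F.f p = p := by simpa [sub_eq_zero] using hfp
  have hpI : p ∈ Icc F.a F.b := ⟨(F.hac.trans hp.1).le, hp.2.le⟩
  have hpc1 : p < F.f F.c := by
    have := uf_lt_c1 F hpI hp.1.ne'
    rwa [hfp] at this
  have hψp : B.ψm p = p := by
    have := br_ψm_f B ⟨hp.1.le, hp.2.le⟩
    rwa [hfp] at this
  set g : ℝ → ℂ := (Icc F.a p).indicator (fun _ => (1:ℂ)) with hg
  have hbv : BoundedVariationOn g univ := by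
    have := evar_indicator_le (fun _ => (1:ℂ)) (P := Icc F.a p) ordConnected_Icc (M := 1)
      (fun x _ => by simp)
    refine ne_top_of_le_ne_top ?_ this
    rw [eVariationOn.constant_on (by rintro _ ⟨x, _, rfl⟩ _ ⟨y, _, rfl⟩; rfl)]
    simp
  obtain ⟨φ, hφ⟩ := R.surj g hbv (by
    intro x hx
    have : x ∈ Icc F.a p := by
      by_contra hne
      exact hx (by simp [hg, hne])
    exact ⟨this.1, this.2.trans hp.2.le⟩)
  have hφ' := countable_ne_symm hφ
  refine ⟨φ, ?_, ?_⟩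
  · intro he
    rw [R.zero_iff] at he
    refine not_countable_Ioo (F.hac.trans hp.1) ((he.union hφ).mono ?_)
    intro x hx
    by_contra hcon
    simp only [mem_union, Function.mem_support, mem_ofPred_eq, not_or, not_not] at hcon
    rw [hcon.1] at hcon
    have := hcon.2
    rw [hg, indicator_of_mem (Ioo_subset_Icc_self hx)] at this
    exact zero_ne_one this
  · have key : {x | g x ≠ R.toFun (TL0 φ) x}.Countable := by
      have h : {x | (Ico F.a p).indicator (fun _ => (1:ℂ)) x ≠ R.toFun (TL0 φ) x}.Countable := by
        refine TL0_form R hTL0 φ hφ' ?_ ?_ ?_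
        · intro x hx
          rw [indicator_of_notMem]
          exact fun h => absurd h.1 (not_le.2 hx)
        · intro x hx
          have h1 := br_ψp_mem B hx
          have h2 := br_ψm_mem B hx
          have e1 : g (B.ψp x) = 1 := by
            rw [hg, indicator_of_mem]
            exact ⟨h1.1.le, (h1.2.trans hp.1).le⟩
          rw [e1]
          have hpm : p ∈ Icc F.a (F.f F.c) := ⟨hpI.1, hpc1.le⟩
          rcases lt_or_ge x p with hxp | hxp
          · rw [indicator_of_mem (show x ∈ Ico F.a p from ⟨hx.1.le, hxp⟩)]
            have := br_ψm_anti B (Ioo_subset_Icc_self hx) hpm hxp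
            rw [hψp] at this
            rw [hg, indicator_of_notMem]
            · simp
            · exact fun h => absurd h.2 (not_le.2 this)
          · rw [indicator_of_notMem (show x ∉ Ico F.a p from fun h => absurd h.2 (not_lt.2 hxp))]
            have := (br_ψm_anti B).antitoneOn hpm (Ioo_subset_Icc_self hx) hxp
            rw [hψp] at this
            rw [hg, indicator_of_mem]
            · simp
            · exact ⟨(F.hac.trans h2.1).le, this⟩
        · intro x hx
          rw [indicator_of_notMem]
          exact fun h => by linarith [h.2]
      refine countable_ne_trans ?_ h
      refine (countable_singleton p).mono fun x hx => ?_
      by_contra hne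
      apply hx
      rw [hg]
      by_cases h1 : x ∈ Ico F.a p
      · rw [indicator_of_mem h1, indicator_of_mem (Ico_subset_Icc_self h1)]
      · rw [indicator_of_notMem h1, indicator_of_notMem]
        exact fun h2 => h1 ⟨h2.1, lt_of_le_of_ne h2.2 hne⟩
    exact (R.eq_of_countable (countable_ne_trans hφ key)).symm

theorem part_iii [CompleteSpace V] {TL0 : V →L[ℂ] V}
    (hTL0 : ∀ φ : V, {x | R.toFun (TL0 φ) x ≠ B.L0c (R.toFun φ) x}.Countable) :
    spectralRadius ℂ TL0 = 1 := by
  obtain ⟨φ, hφ, he⟩ := TL0_eig R hTL0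
  have : Nontrivial V := ⟨φ, 0, hφ⟩
  refine le_antisymm ?_ ?_
  · refine (spectrum.spectralRadius_le_nnnorm TL0).trans ?_
    have := TL0_norm R hTL0
    exact_mod_cast this
  · have h1 : (1:ℂ) ∈ spectrum ℂ TL0 := by
      rw [ContinuousLinearMap.spectrum_eq]
      refine Module.End.HasEigenvalue.mem_spectrum
        (Module.End.hasEigenvalue_of_hasEigenvector (x := φ) ⟨?_, hφ⟩)
      rw [Module.End.mem_eigenspace_iff]
      simpa using he
    have := le_iSup₂ (f := fun (k : ℂ) (_ : k ∈ spectrum ℂ TL0) => (‖k‖₊ : ENNReal)) 1 h1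
    simpa [spectralRadius] using this

end partiii

section phase
variable {F : PWUnimodal 2} {B : F.InvBranches}

/-- countable sets are contained in countable totally invariant sets. -/
theorem saturate (B : F.InvBranches) {E0 : Set ℝ} (h0 : E0.Countable) :
    ∃ E : Set ℝ, E0 ⊆ E ∧ E.Countable ∧ (∀ x ∈ E, F.f x ∈ E) ∧
      (∀ x ∈ Icc F.a F.b, F.f x ∈ E → x ∈ E) := by
  let S : Set ℝ → Set ℝ := fun A => A ∪ F.f '' A ∪ (B.br true '' A ∪ B.br false '' A)
  have hc : ∀ n, (S^[n] E0).Countable := by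
    intro n
    induction n with
    | zero => exact h0
    | succ n ih =>
      rw [Function.iterate_succ_apply']
      exact (ih.union (ih.image _)).union ((ih.image _).union (ih.image _))
  refine ⟨⋃ n, S^[n] E0, ?_, countable_iUnion hc, ?_, ?_⟩
  · exact subset_iUnion (fun n => S^[n] E0) 0
  · intro x hx
    obtain ⟨n, hn⟩ := mem_iUnion.1 hx
    refine mem_iUnion.2 ⟨n + 1, ?_⟩
    rw [Function.iterate_succ_apply']
    exact Or.inl (Or.inr ⟨x, hn, rfl⟩)
  · intro x hxI hx
    obtain ⟨n, hn⟩ := mem_iUnion.1 hx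
    refine mem_iUnion.2 ⟨n + 1, ?_⟩
    rw [Function.iterate_succ_apply']
    obtain ⟨s, hs⟩ := br_of_f B hxI
    cases s
    · exact Or.inr (Or.inr ⟨_, hn, hs⟩)
    · exact Or.inr (Or.inl ⟨_, hn, hs⟩)

/-- data of a peripheral eigenfunction, off a countable totally invariant set. -/
structure PhaseData (B : F.InvBranches) (E : Set ℝ) (h : ℝ → ℂ) (z : ℂ) : Prop where
  cE : E.Countable
  fE : ∀ x ∈ E, F.f x ∈ E
  Ef : ∀ x ∈ Icc F.a F.b, F.f x ∈ E → x ∈ E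
  aE : F.a ∈ E
  bE : F.b ∈ E
  ccE : F.c ∈ E
  hz : ∀ x, x ∉ E → z * h x = B.P1 h x
  hk : ∀ x, x ∉ E → ((‖h x‖ : ℝ) : ℂ) = B.P1 (fun y => ((‖h y‖ : ℝ) : ℂ)) x
  cont : ∀ x, x ∉ E → ContinuousAt h x
  nz : ‖z‖ = 1

variable {E : Set ℝ} {h : ℝ → ℂ} {z : ℂ}

theorem PhaseData.hk' (D : PhaseData B E h z) {x : ℝ} (hx : x ∈ Ioo F.a (F.f F.c)) (hE : x ∉ E) :
    ‖h x‖ = |deriv (B.br true) x| * ‖h (B.br true x)‖ +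
      |deriv (B.br false) x| * ‖h (B.br false x)‖ := by
  have := D.hk x hE
  rw [P1_of_mem B _ hx, Fintype.sum_bool] at this
  exact_mod_cast this

theorem PhaseData.hz' (D : PhaseData B E h z) {x : ℝ} (hx : x ∈ Ioo F.a (F.f F.c)) (hE : x ∉ E) :
    z * h x = ((|deriv (B.br true) x| : ℝ) : ℂ) * h (B.br true x) +
      ((|deriv (B.br false) x| : ℝ) : ℂ) * h (B.br false x) := by
  have := D.hz x hE
  rwa [P1_of_mem B _ hx, Fintype.sum_bool] at this

theorem PhaseData.brE (D : PhaseData B E h z) (s : Bool) {x : ℝ} (hx : x ∈ Ioo F.a (F.f F.c))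
    (hE : x ∉ E) : B.br s x ∉ E := by
  intro h'
  have := D.fE _ h'
  rw [br_f B s (Ioo_subset_Icc_self hx)] at this
  exact hE this

theorem PhaseData.zero_out (D : PhaseData B E h z) {x : ℝ} (hE : x ∉ E)
    (hx : x ∉ Ioo F.a (F.f F.c)) : h x = 0 := by
  have := D.hk x hE
  rw [P1_of_notMem B _ hx] at this
  simpa using this

theorem PhaseData.zero_left (D : PhaseData B E h z) {C : ℝ} (hC : ∀ x, ‖h x‖ ≤ C) {x : ℝ}
    (hE : x ∉ E) (hx : x < F.f (F.f F.c)) : h x = 0 := by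
  by_cases hxa : x ∈ Ioo F.a (F.f F.c)
  swap
  · exact D.zero_out hE hxa
  have hθ : 0 ≤ B.θ := (abs_nonneg _).trans (B.dψp _ (mem_Iic.2 le_rfl))
  have key : ∀ n : ℕ, ∀ x, F.a < x → x < F.f (F.f F.c) → x ∉ E → ‖h x‖ ≤ B.θ ^ n * C := by
    intro n
    induction n with
    | zero => intro x _ _ _; simpa using hC x
    | succ n ih =>
      intro x h1 h2 h3
      have hx : x ∈ Ioo F.a (F.f F.c) :=
        ⟨h1, h2.trans ((uf_c2_lt_c F).trans (uf_c_lt_c1 F))⟩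
      have hm : B.br false x = B.ψm x := rfl
      have hp : B.br true x = B.ψp x := rfl
      have hm0 : h (B.br false x) = 0 := by
        refine D.zero_out (D.brE false hx h3) fun h' => ?_
        have h4 := (B.inv_m x (Ioo_subset_Icc_self hx))
        have := F.anti h4.1 ⟨(uf_c_lt_c1 F).le, uf_c1_le_b F⟩ (by rw [← hm]; exact h'.2)
        rw [h4.2] at this
        linarith
      have hpI := br_ψp_mem B hx
      have hpx : B.ψp x < x := by
        have := uf_expand_p F le_rfl hpI.1 hpI.2.le
        rw [F.fa, (B.inv_p x (Ioo_subset_Icc_self hx)).2] at this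
        nlinarith [F.one_lt_κ, hpI.1]
      rw [D.hk' hx h3, hm0, norm_zero, mul_zero, add_zero, pow_succ', mul_assoc]
      refine mul_le_mul (br_deriv_le B true hx.2) ?_ (norm_nonneg _) hθ
      exact ih _ hpI.1 (hpx.trans h2) (D.brE true hx h3)
  have hlim : Tendsto (fun n : ℕ => B.θ ^ n * C) atTop (𝓝 (0 * C)) :=
    (tendsto_pow_atTop_nhds_zero_of_lt_one hθ B.θ_lt).mul_const C
  have := ge_of_tendsto' hlim (fun n => key n x hxa.1 hx hE)
  rw [zero_mul] at this
  exact norm_le_zero_iff.1 this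

theorem phase_aux {w1 w2 : ℂ} (h : ‖w1 + w2‖ = ‖w1‖ + ‖w2‖) :
    ((‖w1 + w2‖ : ℝ) : ℂ) * w1 = ((‖w1‖ : ℝ) : ℂ) * (w1 + w2) := by
  have h1 : SameRay ℝ w1 (w1 + w2) := (SameRay.refl w1).add_right (sameRay_iff_norm_add.2 h)
  have := sameRay_iff_norm_smul_eq.1 h1
  rw [Complex.real_smul, Complex.real_smul] at this
  exact this.symm

/-- the phase function. -/
def ph (h : ℝ → ℂ) (x : ℝ) : ℂ := h x / ((‖h x‖ : ℝ) : ℂ)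

theorem PhaseData.step (D : PhaseData B E h z) {y : ℝ} (hy : y ∈ Icc F.a F.b) (hE : y ∉ E)
    (h0 : h y ≠ 0) : h (F.f y) ≠ 0 ∧ ph h y = z * ph h (F.f y) := by
  have hfE : F.f y ∉ E := fun h' => hE (D.Ef y hy h')
  have hya : y ≠ F.a := fun h' => hE (h' ▸ D.aE)
  have hyb : y ≠ F.b := fun h' => hE (h' ▸ D.bE)
  have hyc : y ≠ F.c := fun h' => hE (h' ▸ D.ccE)
  have hx : F.f y ∈ Ioo F.a (F.f F.c) :=
    ⟨uf_a_lt F ⟨lt_of_le_of_ne hy.1 (Ne.symm hya), lt_of_le_of_ne hy.2 hyb⟩, uf_lt_c1 F hy hyc⟩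
  obtain ⟨s, hs⟩ := br_of_f B hy
  have hsum : ‖h (F.f y)‖ = |deriv (B.br s) (F.f y)| * ‖h (B.br s (F.f y))‖ +
      |deriv (B.br !s) (F.f y)| * ‖h (B.br (!s) (F.f y))‖ := by
    rw [D.hk' hx hfE]
    cases s
    · exact add_comm _ _
    · rfl
  have hsz : z * h (F.f y) = ((|deriv (B.br s) (F.f y)| : ℝ) : ℂ) * h (B.br s (F.f y)) +
      ((|deriv (B.br !s) (F.f y)| : ℝ) : ℂ) * h (B.br (!s) (F.f y)) := by
    rw [D.hz' hx hfE]
    cases s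
    · exact add_comm _ _
    · rfl
  rw [hs] at hsum hsz
  have hd : 0 < |deriv (B.br s) (F.f y)| := by
    rw [br_deriv B s hx, hs]
    have := uf_d_ge F hy
    have := F.one_lt_κ
    exact inv_pos.2 (by linarith)
  set d := |deriv (B.br s) (F.f y)|
  set d' := |deriv (B.br !s) (F.f y)|
  have hd' : 0 ≤ d' := abs_nonneg _
  have hny : 0 < ‖h y‖ := norm_pos_iff.2 h0
  have hpos : 0 < ‖h (F.f y)‖ := by rw [hsum]; positivity
  refine ⟨norm_pos_iff.1 hpos, ?_⟩
  have hn : ‖(d : ℂ) * h y + (d' : ℂ) * h (B.br (!s) (F.f y))‖ =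
      ‖(d : ℂ) * h y‖ + ‖(d' : ℂ) * h (B.br (!s) (F.f y))‖ := by
    rw [← hsz, norm_mul, D.nz, one_mul, hsum, norm_mul, norm_mul, Complex.norm_real,
      Complex.norm_real, Real.norm_of_nonneg hd.le, Real.norm_of_nonneg hd']
  have := phase_aux hn
  rw [← hsz, norm_mul, norm_mul, D.nz, one_mul, Complex.norm_real, Real.norm_of_nonneg hd.le] at this
  push_cast at this
  have hdc : (d : ℂ) ≠ 0 := by exact_mod_cast hd.ne'
  have h1 : ((‖h y‖ : ℝ) : ℂ) ≠ 0 := by exact_mod_cast hny.ne'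
  have h2 : ((‖h (F.f y)‖ : ℝ) : ℂ) ≠ 0 := by exact_mod_cast hpos.ne'
  unfold ph
  rw [← mul_div_assoc, div_eq_div_iff h1 h2]
  apply mul_left_cancel₀ hdc
  linear_combination this

theorem PhaseData.iter (D : PhaseData B E h z) (n : ℕ) {y : ℝ} (hy : y ∈ Icc F.a F.b) (hE : y ∉ E)
    (h0 : h y ≠ 0) : h (F.f^[n] y) ≠ 0 ∧ ph h y = z ^ n * ph h (F.f^[n] y) := by
  have hEn : ∀ n, F.f^[n] y ∉ E := by
    intro n
    induction n with
    | zero => exact hE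
    | succ n ih =>
      rw [Function.iterate_succ_apply']
      exact fun h' => ih (D.Ef _ (uf_iter_mem F n hy) h')
  induction n with
  | zero => simpa using h0
  | succ n ih =>
    obtain ⟨h1, h2⟩ := D.step (uf_iter_mem F n hy) (hEn n) ih.1
    rw [Function.iterate_succ_apply']
    refine ⟨h1, ?_⟩
    rw [ih.2, h2]
    ring

theorem mix_cover (hmix : F.Mixing) {x0 δ : ℝ} (hδ : 0 < δ)
    (hU : Ioo (x0 - δ) (x0 + δ) ⊆ Ioo (F.f (F.f F.c)) (F.f F.c)) {x : ℝ}
    (hx : x ∈ Ioo (F.f (F.f F.c)) (F.f F.c)) :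
    ∃ N, ∀ n ≥ N, ∃ y ∈ Ioo (x0 - δ) (x0 + δ), F.f^[n] y = x := by
  set U := Ioo (x0 - δ) (x0 + δ) with hUd
  have e1 : F.ck 1 = F.f F.c := rfl
  have e2 : F.ck 2 = F.f (F.f F.c) := rfl
  have hUJ : U ∩ Icc (F.ck 2) (F.ck 1) = U := by
    rw [e1, e2]
    exact inter_eq_left.2 (hU.trans Ioo_subset_Icc_self)
  have hne : (U ∩ Icc (F.ck 2) (F.ck 1)).Nonempty := by
    rw [hUJ]; exact ⟨x0, by constructor <;> linarith⟩
  have hV1 : (Ioo (F.f (F.f F.c)) x ∩ Icc (F.ck 2) (F.ck 1)).Nonempty := by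
    obtain ⟨y, hy⟩ := exists_between hx.1
    exact ⟨y, hy, hy.1.le, (hy.2.trans hx.2).le⟩
  have hV2 : (Ioo x (F.f F.c) ∩ Icc (F.ck 2) (F.ck 1)).Nonempty := by
    obtain ⟨y, hy⟩ := exists_between hx.2
    exact ⟨y, hy, (hx.1.trans hy.1).le, hy.2.le⟩
  obtain ⟨N1, hN1⟩ := hmix U _ isOpen_Ioo isOpen_Ioo hne hV1
  obtain ⟨N2, hN2⟩ := hmix U _ isOpen_Ioo isOpen_Ioo hne hV2
  refine ⟨max N1 N2, fun n hn => ?_⟩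
  obtain ⟨p, ⟨y1, hy1, rfl⟩, hp⟩ := hN1 n ((le_max_left _ _).trans hn)
  obtain ⟨q, ⟨y2, hy2, rfl⟩, hq⟩ := hN2 n ((le_max_right _ _).trans hn)
  rw [hUJ] at hy1 hy2
  have hUI : U ⊆ Icc F.a F.b := fun y hy =>
    ⟨(uf_a_le_c2 F).trans (hU hy).1.le, (hU hy).2.le.trans (uf_c1_le_b F)⟩
  have hcn : ContinuousOn (F.f^[n]) U := (F.cont.iterate F.mapsI n).mono hUI
  have hpre : IsPreconnected (F.f^[n] '' U) := isPreconnected_Ioo.image _ hcn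
  obtain ⟨y, hy, hyx⟩ := hpre.Icc_subset ⟨y1, hy1, rfl⟩ ⟨y2, hy2, rfl⟩ ⟨hp.2.le, hq.1.le⟩
  exact ⟨y, hy, hyx⟩

theorem PhaseData.main (D : PhaseData B E h z) (hmix : F.Mixing) {C : ℝ} (hC : ∀ x, ‖h x‖ ≤ C)
    (hne : ∃ x, x ∉ E ∧ h x ≠ 0) : z = 1 ∧ ∃ u : ℂ, u ≠ 0 ∧ ∀ x, x ∉ E → h x = u * (‖h x‖ : ℝ) := by
  have c1E : F.f F.c ∈ E := D.fE _ D.ccE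
  have c2E : F.f (F.f F.c) ∈ E := D.fE _ c1E
  have hJ : ∀ x, x ∉ E → h x ≠ 0 → x ∈ Ioo (F.f (F.f F.c)) (F.f F.c) := by
    intro x hx h0
    constructor
    · by_contra hle
      rcases (not_lt.1 hle).lt_or_eq with h1 | h1
      · exact h0 (D.zero_left hC hx h1)
      · exact hx (h1 ▸ c2E)
    · by_contra hle
      exact h0 (D.zero_out hx fun h' => hle h'.2)
  obtain ⟨x0, hx0, h0⟩ := hne
  have hx0J := hJ x0 hx0 h0
  have hphc : ContinuousAt (ph h) x0 := by
    unfold ph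
    refine (D.cont x0 hx0).div ?_ ?_
    · exact Complex.continuous_ofReal.continuousAt.comp (D.cont x0 hx0).norm
    · exact_mod_cast (norm_pos_iff.2 h0).ne'
  have key : ∀ ε > 0, ∀ x, x ∉ E → x ∈ Ioo (F.f (F.f F.c)) (F.f F.c) →
      ∃ N, ∀ n ≥ N, ‖z ^ n * ph h x - ph h x0‖ < ε ∧ h x ≠ 0 := by
    intro ε hε x hx hxJ
    have ev : ∀ᶠ y in 𝓝 x0, h y ≠ 0 ∧ ‖ph h y - ph h x0‖ < ε ∧
        y ∈ Ioo (F.f (F.f F.c)) (F.f F.c) := by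
      refine ((D.cont x0 hx0).eventually_ne h0).and (Eventually.and ?_ (isOpen_Ioo.mem_nhds hx0J))
      have := Metric.continuousAt_iff'.1 hphc ε hε
      simpa [dist_eq_norm] using this
    obtain ⟨δ, hδ, hball⟩ := Metric.eventually_nhds_iff_ball.1 ev
    rw [Real.ball_eq_Ioo] at hball
    obtain ⟨N, hN⟩ := mix_cover hmix hδ (fun y hy => (hball y hy).2.2) hxJ
    refine ⟨N, fun n hn => ?_⟩
    obtain ⟨y, hy, hyx⟩ := hN n hn
    obtain ⟨b1, b2, b3⟩ := hball y hy
    have hyI : y ∈ Icc F.a F.b :=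
      ⟨(uf_a_le_c2 F).trans b3.1.le, b3.2.le.trans (uf_c1_le_b F)⟩
    have hyE : y ∉ E := by
      have : ∀ m, y ∈ E → F.f^[m] y ∈ E := by
        intro m hm
        induction m with
        | zero => exact hm
        | succ m ih => rw [Function.iterate_succ_apply']; exact D.fE _ ih
      intro h'
      exact hx (hyx ▸ this n h')
    obtain ⟨i1, i2⟩ := D.iter n hyI hyE b1
    rw [hyx] at i1 i2
    exact ⟨by rw [← i2]; exact b2, i1⟩
  have hph0 : ‖ph h x0‖ = 1 := by
    unfold ph
    rw [norm_div, Complex.norm_real, norm_norm, div_self (norm_pos_iff.2 h0).ne']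
  have hz1 : z = 1 := by
    rw [← sub_eq_zero, ← norm_le_zero_iff]
    refine le_of_forall_pos_le_add fun ε hε => ?_
    obtain ⟨N, hN⟩ := key (ε / 2) (by positivity) x0 hx0 hx0J
    have k1 := (hN N le_rfl).1
    have k2 := (hN (N + 1) (Nat.le_succ N)).1
    have e : ‖z - 1‖ = ‖(z ^ (N + 1) * ph h x0 - ph h x0) - (z ^ N * ph h x0 - ph h x0)‖ := by
      have : (z ^ (N + 1) * ph h x0 - ph h x0) - (z ^ N * ph h x0 - ph h x0) =
        z ^ N * ph h x0 * (z - 1) := by ring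
      rw [this, norm_mul, norm_mul, norm_pow, D.nz, hph0]; simp
    have := norm_sub_le (z ^ (N + 1) * ph h x0 - ph h x0) (z ^ N * ph h x0 - ph h x0)
    rw [e]
    linarith
  refine ⟨hz1, ph h x0, by rw [← norm_pos_iff, hph0]; exact one_pos, fun x hx => ?_⟩
  by_cases hx0' : h x = 0
  · simp [hx0']
  have hxJ := hJ x hx hx0'
  have hpe : ph h x = ph h x0 := by
    rw [← sub_eq_zero, ← norm_le_zero_iff]
    refine le_of_forall_pos_le_add fun ε hε => ?_
    obtain ⟨N, hN⟩ := key ε hε x hx hxJ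
    have := (hN N le_rfl).1
    rw [hz1, one_pow, one_mul] at this
    linarith
  rw [← hpe]
  unfold ph
  have : ((‖h x‖ : ℝ) : ℂ) ≠ 0 := by exact_mod_cast (norm_pos_iff.2 hx0').ne'
  field_simp

end phase

section partii
variable {F : PWUnimodal 2} {B : F.InvBranches}
variable {V : Type} [NormedAddCommGroup V] [NormedSpace ℂ V] (R : BVRealization F.a F.b V)

/-- the integral, as a linear functional. -/
def Iint : V →ₗ[ℂ] ℂ where
  toFun φ := ∫ x, R.toFun φ x
  map_add' φ φ' := by
    rw [map_add]
    exact integral_add (R.integrable φ) (R.integrable φ')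
  map_smul' z φ := by
    rw [map_smul]
    exact integral_smul z _

theorem Iint_apply (φ : V) : Iint R φ = ∫ x, R.toFun φ x := rfl

theorem Iint_TL1 {TL1 : V →L[ℂ] V}
    (hTL1 : ∀ φ : V, {x | R.toFun (TL1 φ) x ≠ B.L1c (R.toFun φ) x}.Countable) (φ : V) :
    Iint R (TL1 φ) = Iint R φ := by
  rw [Iint_apply, Iint_apply, ← P1_integral B (R.integrable φ) (R.supp φ)]
  exact integral_congr_ae (countable_ae (TL1_P1 B R hTL1 φ))

theorem P1_norm_le (h : ℝ → ℂ) (x : ℝ) :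
    ‖B.P1 h x‖ ≤ (B.P1 (fun y => ((‖h y‖ : ℝ) : ℂ)) x).re := by
  by_cases hx : x ∈ Ioo F.a (F.f F.c)
  · rw [P1_of_mem B _ hx, P1_of_mem B _ hx, Complex.re_sum]
    refine (norm_sum_le _ _).trans (Finset.sum_le_sum fun s _ => ?_)
    rw [norm_mul, Complex.norm_real, Real.norm_of_nonneg (abs_nonneg _), ← Complex.ofReal_mul,
      Complex.ofReal_re]
  · rw [P1_of_notMem B _ hx, P1_of_notMem B _ hx]
    simp

theorem P1_im (h : ℝ → ℂ) (x : ℝ) :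
    (B.P1 (fun y => ((‖h y‖ : ℝ) : ℂ)) x).im = 0 := by
  by_cases hx : x ∈ Ioo F.a (F.f F.c)
  · rw [P1_of_mem B _ hx, Complex.im_sum]
    refine Finset.sum_eq_zero fun s _ => ?_
    rw [← Complex.ofReal_mul, Complex.ofReal_im]
  · rw [P1_of_notMem B _ hx]
    simp

theorem eig_main (hmix : F.Mixing) {TL1 : V →L[ℂ] V}
    (hTL1 : ∀ φ : V, {x | R.toFun (TL1 φ) x ≠ B.L1c (R.toFun φ) x}.Countable) {z : ℂ} {φ : V}
    (hφ : φ ≠ 0) (he : TL1 φ = z • φ) : ‖z‖ ≤ 1 ∧ (‖z‖ = 1 → z = 1 ∧ Iint R φ ≠ 0) := by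
  set h := R.toFun φ with hh
  set k : ℝ → ℂ := fun y => ((‖h y‖ : ℝ) : ℂ) with hk
  have hIntg : Integrable h := R.integrable φ
  have hkint : Integrable k := hIntg.norm.ofReal
  have hksupp : Function.support k ⊆ Icc F.a F.b := by
    intro x hx
    apply R.supp φ
    intro h'
    apply hx
    simp [hk, hh, h']
  have hPk := P1_integrable B hkint
  have hIPk : ∫ x, (B.P1 k x).re = ∫ x, ‖h x‖ := by
    have h1 : ∫ x, (B.P1 k x).re = (∫ x, B.P1 k x).re := integral_re hPk
    rw [h1, P1_integral B hkint hksupp, hk, integral_complex_ofReal, Complex.ofReal_re]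
  have hzP : {x | z * h x ≠ B.P1 h x}.Countable := by
    have := TL1_P1 B R hTL1 φ
    rw [he, map_smul] at this
    exact this
  have hle : ∀ᵐ x, ‖z‖ * ‖h x‖ ≤ (B.P1 k x).re := by
    filter_upwards [countable_ae hzP] with x hx
    rw [← norm_mul, hx]
    exact P1_norm_le h x
  have hpos : 0 < ∫ x, ‖h x‖ := by
    refine lt_of_le_of_ne (integral_nonneg fun x => norm_nonneg _) fun h0 => hφ ?_
    have h1 := (integral_eq_zero_iff_of_nonneg (fun x => norm_nonneg (h x)) hIntg.norm).1 h0.symm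
    refine R.eq_of_ae ?_
    filter_upwards [h1] with x hx
    rw [map_zero]
    simpa using hx
  have hint1 : ∫ x, ‖z‖ * ‖h x‖ = ‖z‖ * ∫ x, ‖h x‖ := integral_const_mul _ _
  constructor
  · have := integral_mono_ae (hIntg.norm.const_mul ‖z‖) hPk.re hle
    have h2 : ∫ x, ‖z‖ * ‖h x‖ ≤ ∫ x, (B.P1 k x).re := this
    rw [hint1, hIPk] at h2
    by_contra hcon
    nlinarith
  · intro hz
    have hae : B.P1 k =ᵐ[volume] k := by
      have h1 : (0 : ℝ → ℝ) ≤ᵐ[volume] fun x => (B.P1 k x).re - ‖h x‖ := by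
        filter_upwards [hle] with x hx
        rw [hz, one_mul] at hx
        simpa using hx
      have h2 : Integrable fun x => (B.P1 k x).re - ‖h x‖ := hPk.re.sub hIntg.norm
      have h3 : ∫ x, ((B.P1 k x).re - ‖h x‖) = 0 := by
        rw [integral_sub (f := fun x => (B.P1 k x).re) hPk.re hIntg.norm, hIPk, sub_self]
      have h4 := (integral_eq_zero_iff_of_nonneg_ae h1 h2).1 h3
      filter_upwards [h4] with x hx
      apply Complex.ext
      · simp only [Pi.zero_apply] at hx
        rw [hk, Complex.ofReal_re]
        linarith
      · rw [hk, P1_im, Complex.ofReal_im]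
    have hkbv : BoundedVariationOn k univ := by
      have hl : LipschitzWith 1 (fun w : ℂ => ((‖w‖ : ℝ) : ℂ)) := by
        intro x y
        rw [Complex.isometry_ofReal.edist_eq]
        exact lipschitzWith_one_norm x y
      exact hl.comp_boundedVariationOn (R.bv φ)
    obtain ⟨κ, hκ⟩ := R.surj k hkbv hksupp
    have hκe : TL1 κ = κ := by
      refine R.eq_of_ae ?_
      have e1 := countable_ae (countable_ne_trans (TL1_P1 B R hTL1 κ) (P1_congr_countable hκ))
      filter_upwards [e1, hae, countable_ae hκ] with x h1 h2 h3
      rw [h1, h2, h3]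
    have hkP : {x | k x ≠ B.P1 k x}.Countable := by
      refine countable_ne_trans (countable_ne_symm hκ) ?_
      have := TL1_P1 B R hTL1 κ
      rw [hκe] at this
      exact countable_ne_trans this (P1_congr_countable hκ)
    obtain ⟨E, hE0, hEc, hfE, hEf⟩ := saturate B
      (((hzP.union hkP).union (bv_countable_disc (R.bv φ))).union
        ((countable_singleton F.a).union ((countable_singleton F.b).union (countable_singleton F.c))))
    have D : PhaseData B E h z :=
      { cE := hEc, fE := hfE, Ef := hEf
        aE := hE0 (by simp), bE := hE0 (by simp), ccE := hE0 (by simp)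
        hz := fun x hx => by
          by_contra hne
          exact hx (hE0 (Or.inl (Or.inl (Or.inl hne))))
        hk := fun x hx => by
          by_contra hne
          exact hx (hE0 (Or.inl (Or.inl (Or.inr hne))))
        cont := fun x hx => by
          by_contra hne
          exact hx (hE0 (Or.inl (Or.inr hne)))
        nz := hz }
    obtain ⟨C, _, hC⟩ := bv_bounded (R.bv φ)
    obtain ⟨hz1, u, hu, hux⟩ := D.main hmix hC (by
      by_contra hcon
      push Not at hcon
      apply hφ
      rw [R.zero_iff]
      refine hEc.mono fun x hx => ?_
      by_contra hxE
      exact hx (hcon x hxE))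
    refine ⟨hz1, ?_⟩
    rw [Iint_apply]
    have : ∫ x, R.toFun φ x = ∫ x, u * ((‖h x‖ : ℝ) : ℂ) := by
      refine integral_congr_ae (countable_ae (hEc.mono fun x hx => ?_))
      by_contra hxE
      exact hx (hux x hxE)
    rw [this, integral_const_mul, integral_complex_ofReal]
    exact mul_ne_zero hu (by exact_mod_cast hpos.ne')

theorem P1_mul (g : ℝ → ℂ) (h : ℝ → ℂ) (x : ℝ) :
    B.P1 (fun y => g (F.f y) * h y) x = g x * B.P1 h x := by
  by_cases hx : x ∈ Ioo F.a (F.f F.c)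
  · rw [P1_of_mem B _ hx, P1_of_mem B _ hx, Finset.mul_sum]
    refine Finset.sum_congr rfl fun s _ => ?_
    rw [br_f B s (Ioo_subset_Icc_self hx)]
    ring
  · rw [P1_of_notMem B _ hx, P1_of_notMem B _ hx, mul_zero]

theorem rho_fixed {TL1 : V →L[ℂ] V}
    (hTL1 : ∀ φ : V, {x | R.toFun (TL1 φ) x ≠ B.L1c (R.toFun φ) x}.Countable)
    {ρ₀ : ℝ → ℝ} (hρ₀ : F.IsInvDensity ρ₀)
    (ρ₀V : V) (hρ₀V : {x | R.toFun ρ₀V x ≠ (ρ₀ x : ℂ)}.Countable) : TL1 ρ₀V = ρ₀V := by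
  set ρ : ℝ → ℂ := fun x => (ρ₀ x : ℂ) with hρ
  have hIntg : Integrable ρ := hρ₀.integrable.ofReal
  have hsupp : Function.support ρ ⊆ Icc F.a F.b := by
    intro x hx
    apply hρ₀.supp
    intro h'
    apply hx
    simp [hρ, h']
  have hae : ∀ᵐ x, B.P1 ρ x = ρ x := by
    refine ae_eq_of_integral_contDiff_smul_eq (P1_integrable B hIntg).locallyIntegrable
      hIntg.locallyIntegrable ?_
    intro g hg _
    have hgc : Continuous g := hg.continuous
    have e1 : ∫ x, g x • B.P1 ρ x = ∫ x, B.P1 (fun y => ((g (F.f y) : ℝ) : ℂ) * ρ y) x := by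
      congr 1
      funext x
      rw [P1_mul (fun y => ((g y : ℝ) : ℂ)), Complex.real_smul]
    have hs2 : Function.support (fun y => ((g (F.f y) : ℝ) : ℂ) * ρ y) ⊆ Icc F.a F.b := by
      intro x hx
      apply hsupp
      intro h'
      apply hx
      simp [h']
    have hi2 : Integrable (fun y => ((g (F.f y) : ℝ) : ℂ) * ρ y) := by
      rw [← integrableOn_iff_integrable_of_support_subset hs2]
      refine IntegrableOn.continuousOn_mul ?_ hIntg.integrableOn isCompact_Icc
      exact (Complex.continuous_ofReal.comp hgc).comp_continuousOn F.cont
    rw [e1, P1_integral B hi2 hs2]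
    have e2 : (fun y => ((g (F.f y) : ℝ) : ℂ) * ρ y) =
        fun y => ((g (F.f y) * ρ₀ y : ℝ) : ℂ) := by
      funext y; simp [hρ]
    have e3 : (fun y => g y • ρ y) = fun y => ((g y * ρ₀ y : ℝ) : ℂ) := by
      funext y; simp [hρ]
    rw [e2, e3, integral_complex_ofReal, integral_complex_ofReal, hρ₀.invariant g hgc]
  refine R.eq_of_ae ?_
  have e1 := countable_ae (countable_ne_trans (TL1_P1 B R hTL1 ρ₀V) (P1_congr_countable hρ₀V))
  filter_upwards [e1, hae, countable_ae hρ₀V] with x h1 h2 h3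
  rw [h1, h2, h3]

theorem rho_int {ρ₀ : ℝ → ℝ} (hρ₀ : F.IsInvDensity ρ₀)
    (ρ₀V : V) (hρ₀V : {x | R.toFun ρ₀V x ≠ (ρ₀ x : ℂ)}.Countable) : Iint R ρ₀V = 1 := by
  rw [Iint_apply, integral_congr_ae (countable_ae hρ₀V), integral_complex_ofReal, hρ₀.mass]
  simp

theorem part_ii (hmix : F.Mixing) {TL1 : V →L[ℂ] V}
    (hTL1 : ∀ φ : V, {x | R.toFun (TL1 φ) x ≠ B.L1c (R.toFun φ) x}.Countable)
    {lam0 : ℝ} (hlam0 : Filter.Tendsto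
      (fun n : ℕ => (sInf ((fun x => |F.dn n x|) '' Set.Icc F.a F.b))⁻¹ ^ ((n : ℝ)⁻¹))
      Filter.atTop (nhds lam0)) [CompleteSpace V]
    {ρ₀ : ℝ → ℝ} (hρ₀ : F.IsInvDensity ρ₀)
    (ρ₀V : V) (hρ₀V : {x | R.toFun ρ₀V x ≠ (ρ₀ x : ℂ)}.Countable) :
    TL1 ρ₀V = ρ₀V ∧ ρ₀V ≠ 0 ∧
      Module.End.eigenspace (TL1 : V →ₗ[ℂ] V) 1 = Submodule.span ℂ {ρ₀V} ∧
      Module.End.maxGenEigenspace (TL1 : V →ₗ[ℂ] V) 1 = Submodule.span ℂ {ρ₀V} ∧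
      (∀ z ∈ spectrum ℂ TL1, ‖z‖ ≤ 1) ∧
      (∀ z : ℂ, ‖z‖ = 1 → z ≠ 1 → ¬ Module.End.HasEigenvalue (TL1 : V →ₗ[ℂ] V) z) := by
  have hfix := rho_fixed R hTL1 hρ₀ ρ₀V hρ₀V
  have hI := rho_int R hρ₀ ρ₀V hρ₀V
  have hne : ρ₀V ≠ 0 := by
    intro h0
    rw [h0, map_zero] at hI
    exact zero_ne_one hI
  have hfixspan : ∀ φ, TL1 φ = φ → φ ∈ Submodule.span ℂ {ρ₀V} := by
    intro φ hφ
    rw [Submodule.mem_span_singleton]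
    refine ⟨Iint R φ, ?_⟩
    by_contra hcon
    have h1 : φ - Iint R φ • ρ₀V ≠ 0 := fun h => hcon (sub_eq_zero.1 h).symm
    have h2 := eig_main (z := 1) R hmix hTL1 h1 (by rw [map_sub, map_smul, hφ, hfix, one_smul])
    apply (h2.2 (by simp)).2
    rw [map_sub, map_smul, hI]
    simp
  have heig : Module.End.eigenspace (TL1 : V →ₗ[ℂ] V) 1 = Submodule.span ℂ {ρ₀V} := by
    refine le_antisymm ?_ ?_
    · intro φ hφ
      rw [Module.End.mem_eigenspace_iff] at hφ
      exact hfixspan φ (by simpa using hφ)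
    · rw [Submodule.span_singleton_le_iff_mem, Module.End.mem_eigenspace_iff]
      simpa using hfix
  have hgen : ∀ n : ℕ, ∀ φ : V, (((TL1 : V →ₗ[ℂ] V) - (1:ℂ) • 1) ^ n) φ = 0 →
      φ ∈ Submodule.span ℂ {ρ₀V} := by
    intro n
    induction n with
    | zero =>
      intro φ hn
      simp only [pow_zero, Module.End.one_apply] at hn
      rw [hn]; exact Submodule.zero_mem _
    | succ n ih =>
      intro φ hn
      rw [pow_succ, Module.End.mul_apply] at hn
      have h1 := ih _ hn
      have h2 : ((TL1 : V →ₗ[ℂ] V) - (1:ℂ) • 1) φ = TL1 φ - φ := by simp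
      rw [h2, Submodule.mem_span_singleton] at h1
      obtain ⟨t, ht⟩ := h1
      have h3 := congrArg (Iint R) ht
      rw [map_smul, hI, map_sub, Iint_TL1 R hTL1, sub_self] at h3
      have h4 : t = 0 := by simpa using h3
      rw [h4, zero_smul] at ht
      exact hfixspan φ (sub_eq_zero.1 ht.symm)
  refine ⟨hfix, hne, heig, ?_, ?_, ?_⟩
  · refine le_antisymm ?_ ?_
    · intro φ hφ
      rw [Module.End.mem_maxGenEigenspace] at hφ
      obtain ⟨n, hn⟩ := hφ
      exact hgen n φ hn
    · rw [← heig]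
      intro φ hφ
      rw [Module.End.mem_maxGenEigenspace]
      refine ⟨1, ?_⟩
      rw [Module.End.mem_eigenspace_iff] at hφ
      rw [pow_one, LinearMap.sub_apply, hφ]
      simp
  · intro z hz
    by_contra hcon
    obtain ⟨_, hl, _⟩ := uf_lam0 F hlam0
    have h1 := (part_i R hTL1 hlam0 z hz (by linarith)).2.1
    obtain ⟨φ, hφ⟩ := h1.exists_hasEigenvector
    exact hcon (eig_main R hmix hTL1 hφ.2 (Module.End.mem_eigenspace_iff.1 hφ.1)).1
  · intro z hz hz1 h1
    obtain ⟨φ, hφ⟩ := h1.exists_hasEigenvector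
    exact hz1 ((eig_main R hmix hTL1 hφ.2 (Module.End.mem_eigenspace_iff.1 hφ.1)).2 hz).1

end partii

/-- Lemma 3.1, spectral properties of the transfer operators. For a mixing
piecewise expanding `C²` unimodal map: (i) the essential spectral radius of `L₁` on `BV` is
`≤ λ₀`; (ii) `1` is a simple maximal eigenvalue of `L₁` on `BV` with eigenvector `ρ₀`, and
there is no other eigenvalue of modulus one; (iii) the spectral radius of `L₀` on `BV` is `1`;
(iv) the spectra of `L₀` on `BV^{(1)}` and of `L₁` on `BV` coincide. -/
theorem stmt_3 (F : PWUnimodal 2) (hmix : F.Mixing) (B : F.InvBranches)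
    (ρ₀ : ℝ → ℝ) (hρ₀ : F.IsInvDensity ρ₀)
    (lam0 : ℝ)
    (hlam0 : Filter.Tendsto
      (fun n : ℕ => (sInf ((fun x => |F.dn n x|) '' Set.Icc F.a F.b))⁻¹ ^ ((n : ℝ)⁻¹))
      Filter.atTop (nhds lam0))
    (V : Type) [NormedAddCommGroup V] [NormedSpace ℂ V] [CompleteSpace V]
    (R : BVRealization F.a F.b V)
    (W : Type) [NormedAddCommGroup W] [NormedSpace ℂ W] [CompleteSpace W]
    (R1 : BV1Realization F.a F.b W)
    (TL1 TL0 : V →L[ℂ] V) (TL0' : W →L[ℂ] W)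
    (hTL1 : ∀ φ : V, {x | R.toFun (TL1 φ) x ≠ B.L1c (R.toFun φ) x}.Countable)
    (hTL0 : ∀ φ : V, {x | R.toFun (TL0 φ) x ≠ B.L0c (R.toFun φ) x}.Countable)
    (hTL0' : ∀ (φ : W) (x : ℝ), R1.toFun (TL0' φ) x = B.L0c (R1.toFun φ) x)
    (ρ₀V : V) (hρ₀V : {x | R.toFun ρ₀V x ≠ (ρ₀ x : ℂ)}.Countable) :
    (∀ z ∈ spectrum ℂ TL1, lam0 < ‖z‖ →
      (∃ U ∈ nhds z, spectrum ℂ TL1 ∩ U = {z}) ∧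
      Module.End.HasEigenvalue (TL1 : V →ₗ[ℂ] V) z ∧
      FiniteDimensional ℂ (Module.End.maxGenEigenspace (TL1 : V →ₗ[ℂ] V) z)) ∧
    (TL1 ρ₀V = ρ₀V ∧ ρ₀V ≠ 0 ∧
      Module.End.eigenspace (TL1 : V →ₗ[ℂ] V) 1 = Submodule.span ℂ {ρ₀V} ∧
      Module.End.maxGenEigenspace (TL1 : V →ₗ[ℂ] V) 1 = Submodule.span ℂ {ρ₀V} ∧
      (∀ z ∈ spectrum ℂ TL1, ‖z‖ ≤ 1) ∧
      (∀ z : ℂ, ‖z‖ = 1 → z ≠ 1 → ¬ Module.End.HasEigenvalue (TL1 : V →ₗ[ℂ] V) z)) ∧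
    spectralRadius ℂ TL0 = 1 ∧
    spectrum ℂ TL0' = spectrum ℂ TL1 := by
  
  exact ⟨part_i R hTL1 hlam0, part_ii R hmix hTL1 hlam0 hρ₀ ρ₀V hρ₀V, part_iii R hTL0,
    part_iv R R1 hTL1 hTL0'⟩

end
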